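/- Let x ≥ 2 be a real number, q ≥ 1 an integer, and ε > 0. Then Σ_{a=1}^{q} |E_x(q,a)| ≪_ε x^{1/2+ε} q^{3/4}, where the implied constant depends only on ε. -/

import Mathlib

open scoped BigOperators

/-- the 3-fold divisor function `d₃(n) = Σ_{abc=n} 1` -/
def d3 (n : ℕ) : ℕ :=
  ((Finset.Icc 1 n ×ˢ Finset.Icc 1 n ×ˢ Finset.Icc 1 n).filter
    (fun p : ℕ × ℕ × ℕ => p.1 * p.2.1 * p.2.2 = n)).card

theorem card_divisors_le_rpow {ε : ℝ} (hε : 0 < ε) :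
    ∃ C : ℝ, 1 ≤ C ∧ ∀ n : ℕ, n ≠ 0 → (n.divisors.card : ℝ) ≤ C * (n : ℝ) ^ ε := by
  set C0 : ℝ := max 1 (1 / (ε * Real.log 2)) with hC0
  have hl2 : 0 < Real.log 2 := Real.log_pos one_lt_two
  have hC01 : 1 ≤ C0 := le_max_left _ _
  obtain ⟨K, hK⟩ := exists_nat_ge ((2 : ℝ) ^ (1 / ε))
  refine ⟨C0 ^ K, one_le_pow₀ hC01, fun n hn => ?_⟩
  rw [Nat.card_divisors hn]
  have key : ∀ p ∈ n.primeFactors, ((n.factorization p + 1 : ℕ) : ℝ) ≤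
      (if p < K then C0 else 1) * ((p : ℝ) ^ n.factorization p) ^ ε := by
    intro p hp
    have hpp := (Nat.prime_of_mem_primeFactors hp).two_le
    have hp2 : (2 : ℝ) ≤ p := by exact_mod_cast hpp
    set a := n.factorization p
    have hpow : ((p : ℝ) ^ a) ^ ε = ((p : ℝ) ^ ε) ^ a := by
      rw [← Real.rpow_natCast, ← Real.rpow_natCast, ← Real.rpow_mul (by positivity),
        ← Real.rpow_mul (by positivity), mul_comm]
    rw [hpow]
    split_ifs with h
    · have h1 : 1 + (a : ℝ) * (ε * Real.log 2) ≤ ((p : ℝ) ^ ε) ^ a := by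
        calc 1 + (a : ℝ) * (ε * Real.log 2) ≤ Real.exp ((a : ℝ) * (ε * Real.log 2)) := by
              linarith [Real.add_one_le_exp ((a : ℝ) * (ε * Real.log 2))]
          _ = ((2 : ℝ) ^ ε) ^ a := by
              rw [Real.rpow_def_of_pos two_pos, ← Real.exp_nat_mul]; congr 1; ring
          _ ≤ _ := by gcongr
      have h2 : (a : ℝ) ≤ C0 * ((a : ℝ) * (ε * Real.log 2)) := by
        calc (a : ℝ) = 1 / (ε * Real.log 2) * ((a : ℝ) * (ε * Real.log 2)) := by field_simp
          _ ≤ _ := by gcongr; exact le_max_right _ _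
      push_cast
      calc (a : ℝ) + 1 ≤ C0 * (1 + (a : ℝ) * (ε * Real.log 2)) := by nlinarith
        _ ≤ _ := by gcongr
    · have h1 : (2 : ℝ) ≤ (p : ℝ) ^ ε := by
        have : (2 : ℝ) ^ (1 / ε) ≤ p := hK.trans (by exact_mod_cast not_lt.mp h)
        calc (2 : ℝ) = ((2 : ℝ) ^ (1 / ε)) ^ ε := by
              rw [← Real.rpow_mul (by norm_num)]; field_simp; simp
          _ ≤ _ := by gcongr
      rw [one_mul]
      calc ((a + 1 : ℕ) : ℝ) ≤ (2 : ℝ) ^ a := by exact_mod_cast Nat.lt_two_pow_self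
        _ ≤ _ := by gcongr
  push_cast at key ⊢
  calc (∏ p ∈ n.primeFactors, ((n.factorization p : ℝ) + 1))
      ≤ ∏ p ∈ n.primeFactors, (if p < K then C0 else 1) * ((p : ℝ) ^ n.factorization p) ^ ε :=
        Finset.prod_le_prod (fun _ _ => by positivity) key
    _ = (∏ p ∈ n.primeFactors, (if p < K then C0 else 1)) * (n : ℝ) ^ ε := by
        rw [Finset.prod_mul_distrib]
        congr 1
        rw [Real.finsetProd_rpow _ _ (fun _ _ => by positivity)]
        congr 1
        conv_rhs => rw [← Nat.prod_factorization_pow_eq_self hn]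
        rw [Finsupp.prod]; push_cast; rfl
    _ ≤ _ := by
        gcongr
        rw [← Finset.prod_filter, Finset.prod_const]
        apply pow_le_pow_right₀ hC01
        calc _ ≤ (Finset.range K).card := Finset.card_le_card (fun p hp => by
              simp only [Finset.mem_filter] at hp; simpa using hp.2)
          _ = K := Finset.card_range K

open ZMod in
theorem sum_norm_sq_char {q : ℕ} [NeZero q] {ι : Type*} (s : Finset ι) (c : ι → ℂ)
    (z : ι → ZMod q) :
    ((∑ b : ZMod q, ‖∑ p ∈ s, c p * stdAddChar (b * z p)‖ ^ 2 : ℝ) : ℂ) =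
      q * ∑ p ∈ s, ∑ p' ∈ s, if z p = z p' then c p * (starRingEnd ℂ) (c p') else 0 := by
  classical
  push_cast
  simp_rw [← Complex.mul_conj', map_sum, map_mul, Finset.sum_mul_sum, ← AddChar.map_neg_eq_conj]
  rw [Finset.sum_comm, Finset.mul_sum]
  refine Finset.sum_congr rfl fun p _ => ?_
  rw [Finset.sum_comm, Finset.mul_sum]
  refine Finset.sum_congr rfl fun p' _ => ?_
  have h := AddChar.sum_mulShift (R := ZMod q) (ψ := stdAddChar (N := q)) (z p - z p')
    (isPrimitive_stdAddChar q)
  have h2 : ∀ b : ZMod q, c p * stdAddChar (b * z p) *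
      ((starRingEnd ℂ) (c p') * stdAddChar (-(b * z p'))) =
      (c p * (starRingEnd ℂ) (c p')) * stdAddChar (b * (z p - z p')) := by
    intro b
    rw [mul_sub, sub_eq_add_neg, AddChar.map_add_eq_mul]; ring
  simp_rw [h2, ← Finset.mul_sum, h, sub_eq_zero, ZMod.card]
  split_ifs <;> push_cast <;> ring

theorem sum_unit_mul {q : ℕ} [NeZero q] {β : Type*} [AddCommMonoid β] (f : ZMod q → β)
    (u : ZMod q) (hu : IsUnit u) : ∑ k : ZMod q, f (u * k) = ∑ k : ZMod q, f k := by
  obtain ⟨u, rfl⟩ := hu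
  exact Equiv.sum_comp (Units.mulLeft u) f

theorem norm_geom_char_le {q : ℕ} [NeZero q] (k : ZMod q) (hk : k ≠ 0) (A B : ℕ) :
    ‖∑ n ∈ Finset.Ico A B, (ZMod.stdAddChar (-(k * (n : ZMod q))) : ℂ)‖ ≤
      q / 2 * (1 / (k.val : ℝ) + 1 / ((q : ℝ) - k.val)) := by
  rcases le_or_gt B A with hAB | hAB
  · rw [Finset.Ico_eq_empty (by omega)]
    have : (k.val : ℝ) < q := by exact_mod_cast k.val_lt
    have : 0 < (q : ℝ) - k.val := by linarith
    simp only [Finset.sum_empty, norm_zero]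
    positivity
  have hkv : 0 < k.val := Nat.pos_of_ne_zero (by rwa [Ne, ZMod.val_eq_zero])
  have hkq : k.val < q := k.val_lt
  have hkv' : (0 : ℝ) < k.val := by exact_mod_cast hkv
  have hkq' : (k.val : ℝ) < q := by exact_mod_cast hkq
  have hq : (0 : ℝ) < q := by linarith
  set z : ℂ := ZMod.stdAddChar (-k) with hz
  have hpow : ∀ n : ℕ, (ZMod.stdAddChar (-(k * (n : ZMod q))) : ℂ) = z ^ n := by
    intro n
    rw [hz, ← AddChar.map_nsmul_eq_pow]; congr 1; simp [nsmul_eq_mul]; ring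
  simp_rw [hpow]
  have hz1 : ‖z - 1‖ = 2 * Real.sin (Real.pi * (k.val / q)) := by
    have h1 : z = (starRingEnd ℂ) (Complex.exp (Complex.I * ((2 * Real.pi * (k.val / q) : ℝ) : ℂ))) := by
      rw [hz, AddChar.map_neg_eq_conj]
      congr 1
      rw [ZMod.stdAddChar_apply, ZMod.toCircle_apply]
      congr 1; push_cast; ring
    have h2 : ‖z - 1‖ = ‖Complex.exp (Complex.I * ((2 * Real.pi * (k.val / q) : ℝ) : ℂ)) - 1‖ := by
      rw [h1, ← Complex.norm_conj]; simp
    rw [h2, Complex.norm_exp_I_mul_ofReal_sub_one, Real.norm_of_nonneg]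
    · congr 2; ring
    · apply mul_nonneg zero_le_two
      apply Real.sin_nonneg_of_nonneg_of_le_pi
      · positivity
      · have : (k.val : ℝ) / q ≤ 1 := by rw [div_le_one hq]; exact hkq'.le
        nlinarith [Real.pi_pos]
  have hsin : min ((k.val : ℝ) / q) (1 - k.val / q) * 2 ≤ Real.sin (Real.pi * (k.val / q)) := by
    have h0 : 0 < (k.val : ℝ) / q := by positivity
    have h1 : (k.val : ℝ) / q < 1 := by rw [div_lt_one hq]; exact hkq'
    set t := (k.val : ℝ) / q
    rcases le_total t (1 / 2) with h | h
    · have := Real.mul_le_sin (x := Real.pi * t) (by positivity) (by nlinarith [Real.pi_pos])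
      have h3 : 2 / Real.pi * (Real.pi * t) = 2 * t := by field_simp
      rw [h3] at this
      linarith [min_le_left t (1 - t)]
    · have := Real.mul_le_sin (x := Real.pi * (1 - t)) (by nlinarith [Real.pi_pos])
        (by nlinarith [Real.pi_pos])
      have h3 : 2 / Real.pi * (Real.pi * (1 - t)) = 2 * (1 - t) := by field_simp
      rw [h3, show Real.pi * (1 - t) = Real.pi - Real.pi * t by ring, Real.sin_pi_sub] at this
      linarith [min_le_right t (1 - t)]
  have h0 : 0 < (k.val : ℝ) / q := by positivity
  have h1 : 0 < 1 - (k.val : ℝ) / q := by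
    rw [sub_pos, div_lt_one hq]; exact hkq'
  have hmin : 0 < min ((k.val : ℝ) / q) (1 - k.val / q) := lt_min h0 h1
  have hzne : z ≠ 1 := by
    intro h
    rw [h, sub_self, norm_zero] at hz1
    linarith
  rw [geom_sum_Ico hzne hAB.le, norm_div, hz1]
  have hnz : ‖z‖ = 1 := by rw [hz]; exact AddChar.norm_apply _ _
  have hnum : ‖z ^ B - z ^ A‖ ≤ 2 := by
    calc _ ≤ ‖z ^ B‖ + ‖z ^ A‖ := norm_sub_le _ _
      _ = 2 := by rw [norm_pow, norm_pow, hnz]; norm_num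
  calc _ ≤ 2 / (2 * (min ((k.val : ℝ) / q) (1 - k.val / q) * 2)) := by gcongr
    _ = 1 / 2 * (1 / min ((k.val : ℝ) / q) (1 - k.val / q)) := by field_simp
    _ ≤ 1 / 2 * (1 / ((k.val : ℝ) / q) + 1 / (1 - (k.val : ℝ) / q)) := by
        gcongr
        rcases min_choice ((k.val : ℝ) / q) (1 - k.val / q) with h | h <;> rw [h]
        · have := one_div_pos.mpr h1; linarith
        · have := one_div_pos.mpr h0; linarith
    _ = _ := by
        have : (q : ℝ) - k.val ≠ 0 := by linarith
        field_simp

theorem card_mul_eq_zero_le {q : ℕ} [NeZero q] (k : ZMod q) :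
    (Finset.univ.filter fun d : ZMod q => k * d = 0).card ≤ Nat.gcd k.val q := by
  have hq : 0 < q := Nat.pos_of_ne_zero (NeZero.ne q)
  set g := Nat.gcd k.val q
  have hg : 0 < g := Nat.gcd_pos_of_pos_right _ hq
  have hgq : g ∣ q := Nat.gcd_dvd_right _ _
  have hdiv : ∀ d : ZMod q, k * d = 0 → q / g ∣ d.val := by
    intro d hd
    have h1 : q ∣ k.val * d.val := by
      rw [← ZMod.natCast_eq_zero_iff]; push_cast
      rw [ZMod.natCast_zmod_val, ZMod.natCast_zmod_val, hd]
    have h2 : q / g ∣ k.val / g * d.val := by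
      obtain ⟨t, ht⟩ := h1
      have hgk : g ∣ k.val := Nat.gcd_dvd_left _ _
      refine ⟨t, Nat.eq_of_mul_eq_mul_left hg ?_⟩
      rw [← mul_assoc, ← mul_assoc, Nat.mul_div_cancel' hgk, Nat.mul_div_cancel' hgq, ht]
    have hc : Nat.Coprime (q / g) (k.val / g) := (Nat.coprime_div_gcd_div_gcd hg).symm
    exact hc.dvd_of_dvd_mul_left h2
  calc _ ≤ (Finset.range g).card := by
        apply Finset.card_le_card_of_injOn (fun d => d.val / (q / g))
        · intro d hd
          simp only [Finset.coe_range, Set.mem_Iio]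
          apply Nat.div_lt_of_lt_mul
          rw [Nat.div_mul_cancel hgq]; exact d.val_lt
        · intro d hd d' hd' h
          simp only [Finset.coe_filter, Finset.mem_univ, true_and, Set.mem_ofPred_eq] at hd hd'
          apply ZMod.val_injective q
          obtain ⟨a, ha⟩ := hdiv d hd
          obtain ⟨b, hb⟩ := hdiv d' hd'
          have : 0 < q / g := Nat.div_pos (Nat.le_of_dvd hq hgq) hg
          simp only [ha, hb, Nat.mul_div_cancel_left _ this] at h
          rw [ha, hb, h]
    _ = g := Finset.card_range g

theorem sum_inv_le_one_add_log {m n : ℕ} (h : m ≤ n) :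
    ∑ j ∈ Finset.Icc 1 m, (1 : ℝ) / j ≤ 1 + Real.log n := by
  have h1 := harmonic_le_one_add_log n
  rw [harmonic_eq_sum_Icc] at h1
  push_cast at h1
  calc _ ≤ ∑ j ∈ Finset.Icc 1 n, (1 : ℝ) / j := by
        apply Finset.sum_le_sum_of_subset_of_nonneg
        · exact Finset.Icc_subset_Icc_right h
        · intros; positivity
    _ ≤ _ := by simpa using h1

theorem sum_sqrt_gcd_div_le (q : ℕ) (hq : 0 < q) :
    ∑ k ∈ Finset.Ico 1 q, Real.sqrt (Nat.gcd k q) / k ≤ q.divisors.card * (1 + Real.log q) := by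
  calc ∑ k ∈ Finset.Ico 1 q, Real.sqrt (Nat.gcd k q) / k
      = ∑ d ∈ q.divisors, ∑ k ∈ (Finset.Ico 1 q).filter (fun k => Nat.gcd k q = d),
          Real.sqrt (Nat.gcd k q) / k := by
        rw [Finset.sum_fiberwise_of_maps_to]
        intro k _
        exact Nat.mem_divisors.mpr ⟨Nat.gcd_dvd_right _ _, hq.ne'⟩
    _ ≤ ∑ d ∈ q.divisors, (1 + Real.log q) := by
        refine Finset.sum_le_sum fun d hd => ?_
        have hdp : 0 < d := Nat.pos_of_mem_divisors hd
        calc _ ≤ ∑ k ∈ (Finset.Icc 1 q).image (fun j => d * j), (d : ℝ) / k := by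
              calc _ ≤ ∑ k ∈ (Finset.Ico 1 q).filter (fun k => Nat.gcd k q = d), (d : ℝ) / k := by
                    refine Finset.sum_le_sum fun k hk => ?_
                    rw [(Finset.mem_filter.mp hk).2]
                    gcongr
                    rw [Real.sqrt_le_left (by positivity)]
                    have : (1 : ℝ) ≤ d := by exact_mod_cast hdp
                    nlinarith
                _ ≤ _ := by
                    apply Finset.sum_le_sum_of_subset_of_nonneg
                    · intro k hk
                      rw [Finset.mem_filter, Finset.mem_Ico] at hk
                      obtain ⟨j, hj⟩ : d ∣ k := hk.2 ▸ Nat.gcd_dvd_left _ _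
                      rw [Finset.mem_image]
                      refine ⟨j, ?_, hj.symm⟩
                      rw [Finset.mem_Icc]
                      constructor
                      · rcases Nat.eq_zero_or_pos j with h | h
                        · subst h; omega
                        · exact h
                      · have := Nat.le_mul_of_pos_left j hdp
                        omega
                    · intros; positivity
          _ = ∑ j ∈ Finset.Icc 1 q, (1 : ℝ) / j := by
              rw [Finset.sum_image (fun a _ b _ h => Nat.eq_of_mul_eq_mul_left hdp h)]
              refine Finset.sum_congr rfl fun j hj => ?_
              have : (0 : ℝ) < d := by exact_mod_cast hdp
              push_cast; field_simp
          _ ≤ _ := sum_inv_le_one_add_log le_rfl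
    _ = _ := by rw [Finset.sum_const, nsmul_eq_mul]

theorem sum_norm_sq_gauss_le {q : ℕ} [NeZero q] (θ : ZMod q → ℝ) (hθ1 : ∀ b, |θ b| ≤ 1)
    (hθ0 : ∀ b, ¬ IsUnit b → θ b = 0) (k : ZMod q) :
    ∑ b : ZMod q, ‖∑ c : ZMod q, (θ (b * c) : ℂ) * ZMod.stdAddChar (c * k)‖ ^ 2 ≤
      (q : ℝ) ^ 2 * Nat.gcd k.val q := by
  classical
  have h1 : ∑ b : ZMod q, ‖∑ c : ZMod q, (θ (b * c) : ℂ) * ZMod.stdAddChar (c * k)‖ ^ 2 ≤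
      ∑ b : ZMod q, ‖∑ m : ZMod q, (θ m : ℂ) * ZMod.stdAddChar (b * (m * k))‖ ^ 2 := by
    have h2 : ∑ b : ZMod q, ‖∑ c : ZMod q, (θ (b * c) : ℂ) * ZMod.stdAddChar (c * k)‖ ^ 2 =
        ∑ b ∈ Finset.univ.filter (fun b : ZMod q => IsUnit b),
          ‖∑ c : ZMod q, (θ (b * c) : ℂ) * ZMod.stdAddChar (c * k)‖ ^ 2 := by
      symm
      apply Finset.sum_filter_of_ne
      intro b _ hb
      by_contra hu
      apply hb
      have : ∀ c, θ (b * c) = 0 := fun c => hθ0 _ (fun h => hu (isUnit_of_mul_isUnit_left h))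
      simp [this]
    rw [h2]
    have hinj : Set.InjOn (fun b : ZMod q => b⁻¹)
        (Finset.univ.filter (fun b : ZMod q => IsUnit b) : Finset (ZMod q)) := by
      intro a ha b hb h
      simp only [Finset.coe_filter, Finset.mem_univ, true_and, Set.mem_ofPred_eq] at ha hb
      calc a = a * (b * b⁻¹) := by rw [ZMod.mul_inv_of_unit b hb, mul_one]
        _ = a * (b * a⁻¹) := by rw [show b⁻¹ = a⁻¹ from h.symm]
        _ = b * (a * a⁻¹) := by ring
        _ = b := by rw [ZMod.mul_inv_of_unit a ha, mul_one]
    calc _ = ∑ b ∈ Finset.univ.filter (fun b : ZMod q => IsUnit b),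
          ‖∑ m : ZMod q, (θ m : ℂ) * ZMod.stdAddChar (b⁻¹ * (m * k))‖ ^ 2 := by
          refine Finset.sum_congr rfl fun b hb => ?_
          have hb' : IsUnit b := (Finset.mem_filter.mp hb).2
          congr 2
          rw [← sum_unit_mul (fun m => (θ m : ℂ) * ZMod.stdAddChar (b⁻¹ * (m * k))) b hb']
          refine Finset.sum_congr rfl fun c _ => ?_
          congr 2
          calc c * k = (b * b⁻¹) * (c * k) := by rw [ZMod.mul_inv_of_unit b hb', one_mul]
            _ = _ := by ring
      _ = ∑ b ∈ (Finset.univ.filter (fun b : ZMod q => IsUnit b)).image (fun b => b⁻¹),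
          ‖∑ m : ZMod q, (θ m : ℂ) * ZMod.stdAddChar (b * (m * k))‖ ^ 2 := by
          rw [Finset.sum_image hinj]
      _ ≤ _ := Finset.sum_le_sum_of_subset_of_nonneg (Finset.subset_univ _)
          (fun _ _ _ => by positivity)
  refine h1.trans ?_
  have h3 := sum_norm_sq_char Finset.univ (fun m : ZMod q => (θ m : ℂ)) (fun m => m * k)
  have h4 : ∑ b : ZMod q, ‖∑ m : ZMod q, (θ m : ℂ) * ZMod.stdAddChar (b * (m * k))‖ ^ 2 =
      q * ∑ m : ZMod q, ∑ m' : ZMod q, if m * k = m' * k then θ m * θ m' else 0 := by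
    rw [← Complex.ofReal_inj, h3]
    push_cast
    congr 1
    refine Finset.sum_congr rfl fun m _ => Finset.sum_congr rfl fun m' _ => ?_
    split_ifs <;> simp [Complex.conj_ofReal]
  rw [h4]
  have h5 : ∀ m : ZMod q, ∑ m' : ZMod q, (if m * k = m' * k then θ m * θ m' else 0) ≤
      Nat.gcd k.val q := by
    intro m
    calc ∑ m' : ZMod q, (if m * k = m' * k then θ m * θ m' else 0)
        ≤ ∑ m' : ZMod q, (if k * (m' - m) = 0 then 1 else 0) := by
          refine Finset.sum_le_sum fun m' _ => ?_
          have : m * k = m' * k ↔ k * (m' - m) = 0 := by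
            rw [mul_sub, sub_eq_zero, eq_comm, mul_comm m', mul_comm m]
          simp only [this]
          split_ifs
          · calc θ m * θ m' ≤ |θ m * θ m'| := le_abs_self _
              _ = |θ m| * |θ m'| := abs_mul _ _
              _ ≤ 1 := mul_le_one₀ (hθ1 m) (abs_nonneg _) (hθ1 m')
          · exact le_rfl
      _ = ∑ d : ZMod q, (if k * d = 0 then (1 : ℝ) else 0) :=
          Equiv.sum_comp (Equiv.subRight m) (fun d => if k * d = 0 then (1 : ℝ) else 0)
      _ = ((Finset.univ.filter fun d : ZMod q => k * d = 0).card : ℝ) := by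
          rw [Finset.sum_boole]
      _ ≤ _ := by exact_mod_cast card_mul_eq_zero_le k
  calc _ ≤ (q : ℝ) * ∑ m : ZMod q, (Nat.gcd k.val q : ℝ) := by
        gcongr with m; exact h5 m
    _ = _ := by rw [Finset.sum_const, Finset.card_univ, ZMod.card, nsmul_eq_mul]; ring

/-- Completion: expand the sum over an interval in additive characters. -/
theorem sum_interval_eq_fourier {q : ℕ} [NeZero q] (θ : ZMod q → ℝ) (b : ZMod q) (I : Finset ℕ) :
    ((∑ n ∈ I, θ (b * n) : ℝ) : ℂ) = (1 / q) * ∑ k : ZMod q,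
      (∑ n ∈ I, (ZMod.stdAddChar (-(k * (n : ZMod q))) : ℂ)) *
        ∑ c : ZMod q, (θ (b * c) : ℂ) * ZMod.stdAddChar (c * k) := by
  classical
  have hq : (q : ℂ) ≠ 0 := Nat.cast_ne_zero.mpr (NeZero.ne q)
  simp_rw [Finset.sum_mul_sum]
  rw [Finset.sum_comm, Finset.mul_sum]
  push_cast
  refine Finset.sum_congr rfl fun n _ => ?_
  rw [Finset.sum_comm]
  have : ∀ c : ZMod q, ∑ k : ZMod q, (ZMod.stdAddChar (-(k * (n : ZMod q))) : ℂ) *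
      ((θ (b * c) : ℂ) * ZMod.stdAddChar (c * k)) =
      if c = n then q * (θ (b * c) : ℂ) else 0 := by
    intro c
    have h := AddChar.sum_mulShift (R := ZMod q) (ψ := ZMod.stdAddChar (N := q)) (c - (n : ZMod q))
      (ZMod.isPrimitive_stdAddChar q)
    have h2 : ∀ k : ZMod q, (ZMod.stdAddChar (-(k * (n : ZMod q))) : ℂ) *
        ((θ (b * c) : ℂ) * ZMod.stdAddChar (c * k)) =
        (θ (b * c) : ℂ) * ZMod.stdAddChar (k * (c - (n : ZMod q))) := by
      intro k
      rw [mul_sub, sub_eq_add_neg, AddChar.map_add_eq_mul, mul_comm c k]; ring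
    simp_rw [h2, ← Finset.mul_sum, h, sub_eq_zero, ZMod.card]
    split_ifs <;> push_cast <;> ring
  simp_rw [this]
  rw [Finset.sum_ite_eq' Finset.univ (n : ZMod q)]
  simp only [Finset.mem_univ, if_true]
  field_simp

noncomputable def pvConst (q : ℕ) : ℝ := Real.sqrt q * (q.divisors.card * (1 + Real.log q))

theorem polya_vinogradov_sq {q : ℕ} [NeZero q] (θ : ZMod q → ℝ) (hθ1 : ∀ b, |θ b| ≤ 1)
    (hθ0 : ∀ b, ¬ IsUnit b → θ b = 0) (hθs : ∑ b, θ b = 0) (A B : ℕ) :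
    ∑ b : ZMod q, (∑ n ∈ Finset.Ico A B, θ (b * n)) ^ 2 ≤ q * pvConst q ^ 2 := by
  classical
  have hq : 0 < q := Nat.pos_of_ne_zero (NeZero.ne q)
  have hq' : (0 : ℝ) < q := by exact_mod_cast hq
  set g : ZMod q → ZMod q → ℂ := fun b k => ∑ c : ZMod q, (θ (b * c) : ℂ) * ZMod.stdAddChar (c * k)
    with hg
  set f : ZMod q → ℂ := fun k => ∑ n ∈ Finset.Ico A B, (ZMod.stdAddChar (-(k * (n : ZMod q))) : ℂ)
    with hf
  have hg0 : ∀ b, g b 0 = 0 := by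
    intro b
    simp only [hg, mul_zero, AddChar.map_zero_eq_one, mul_one]
    rw [← Complex.ofReal_sum]
    by_cases hb : IsUnit b
    · rw [sum_unit_mul θ b hb, hθs, Complex.ofReal_zero]
    · rw [Finset.sum_eq_zero, Complex.ofReal_zero]
      intro c _
      exact hθ0 _ (fun h => hb (isUnit_of_mul_isUnit_left h))
  set w : ZMod q → ℝ := fun k => Real.sqrt (Nat.gcd k.val q) with hw
  have hwpos : ∀ k, 0 < w k := fun k => Real.sqrt_pos.mpr (by
    exact_mod_cast Nat.gcd_pos_of_pos_right _ hq)
  set s : Finset (ZMod q) := Finset.univ.filter (fun k => k ≠ 0) with hs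
  set W := ∑ k ∈ s, ‖f k‖ * w k with hWdef
  have hW : W ≤ q * (q.divisors.card * (1 + Real.log q)) := by
    calc W ≤ ∑ k ∈ s, (q / 2 * (1 / (k.val : ℝ) + 1 / ((q : ℝ) - k.val))) * w k := by
          apply Finset.sum_le_sum
          intro k hk
          exact mul_le_mul_of_nonneg_right (norm_geom_char_le k (Finset.mem_filter.mp hk).2 A B)
            (hwpos k).le
      _ = ∑ k ∈ s, (fun j : ℕ => (q / 2 * (1 / (j : ℝ) + 1 / ((q : ℝ) - j))) *
            Real.sqrt (Nat.gcd j q)) k.val := rfl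
      _ = ∑ j ∈ Finset.Ico 1 q, (q / 2 * (1 / (j : ℝ) + 1 / ((q : ℝ) - j))) *
            Real.sqrt (Nat.gcd j q) := by
          apply Finset.sum_bij (fun k _ => k.val)
          · intro k hk
            rw [Finset.mem_Ico]
            exact ⟨Nat.pos_of_ne_zero (by rw [Ne, ZMod.val_eq_zero]; exact (Finset.mem_filter.mp hk).2),
              k.val_lt⟩
          · intro a _ b _ h; exact ZMod.val_injective q h
          · intro j hj
            rw [Finset.mem_Ico] at hj
            refine ⟨(j : ZMod q), ?_, ZMod.val_cast_of_lt hj.2⟩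
            rw [hs, Finset.mem_filter]
            refine ⟨Finset.mem_univ _, ?_⟩
            intro h0
            rw [ZMod.natCast_eq_zero_iff] at h0
            exact absurd (Nat.le_of_dvd hj.1 h0) (by omega)
          · intros; rfl
      _ = q / 2 * (∑ j ∈ Finset.Ico 1 q, Real.sqrt (Nat.gcd j q) / j +
            ∑ j ∈ Finset.Ico 1 q, Real.sqrt (Nat.gcd j q) / ((q : ℝ) - j)) := by
          rw [← Finset.sum_add_distrib, Finset.mul_sum]
          refine Finset.sum_congr rfl fun j _ => ?_
          ring
      _ = q / 2 * (∑ j ∈ Finset.Ico 1 q, Real.sqrt (Nat.gcd j q) / j +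
            ∑ j ∈ Finset.Ico 1 q, Real.sqrt (Nat.gcd j q) / j) := by
          congr 2
          apply Finset.sum_bij (fun k _ => q - k)
          · intro k hk; rw [Finset.mem_Ico] at *; omega
          · intro a ha b hb h; rw [Finset.mem_Ico] at *; omega
          · intro b hb; rw [Finset.mem_Ico] at *; exact ⟨q - b, by rw [Finset.mem_Ico]; omega, by omega⟩
          · intro k hk
            rw [Finset.mem_Ico] at hk
            rw [Nat.cast_sub hk.2.le]
            congr 3
            rw [Nat.gcd_comm, Nat.gcd_comm (q - k)]
            exact (Nat.gcd_self_sub_right hk.2.le).symm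
      _ ≤ _ := by
          have := sum_sqrt_gcd_div_le q hq
          nlinarith
  have hW0 : 0 ≤ W := Finset.sum_nonneg fun k _ => mul_nonneg (norm_nonneg _) (hwpos k).le
  have hmain : ∀ b : ZMod q, (∑ n ∈ Finset.Ico A B, θ (b * n)) ^ 2 ≤
      (1 / q) ^ 2 * (W * ∑ k ∈ s, ‖f k‖ / w k * ‖g b k‖ ^ 2) := by
    intro b
    have h1 : |∑ n ∈ Finset.Ico A B, θ (b * n)| ≤ 1 / q * ∑ k ∈ s, ‖f k‖ * ‖g b k‖ := by
      rw [← Real.norm_eq_abs, ← Complex.norm_real, sum_interval_eq_fourier, norm_mul]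
      have : ‖(1 / q : ℂ)‖ = 1 / q := by simp
      rw [this]
      gcongr
      calc _ = ‖∑ k ∈ s, f k * g b k‖ := by
            congr 1; symm
            apply Finset.sum_filter_of_ne
            intro k _ hne h0
            apply hne
            rw [h0]
            simp only [hg0, mul_zero]
        _ ≤ ∑ k ∈ s, ‖f k * g b k‖ := norm_sum_le _ _
        _ = _ := by simp_rw [norm_mul]
    calc _ = |∑ n ∈ Finset.Ico A B, θ (b * n)| ^ 2 := (sq_abs _).symm
      _ ≤ (1 / q * ∑ k ∈ s, ‖f k‖ * ‖g b k‖) ^ 2 := by gcongr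
      _ = (1 / q) ^ 2 * (∑ k ∈ s, ‖f k‖ * ‖g b k‖) ^ 2 := by rw [mul_pow]
      _ ≤ _ := by
        gcongr
        apply Finset.sum_sq_le_sum_mul_sum_of_sq_le_mul
        · intro k _; exact mul_nonneg (norm_nonneg _) (hwpos k).le
        · intro k _; exact mul_nonneg (div_nonneg (norm_nonneg _) (hwpos k).le) (sq_nonneg _)
        · intro k _
          have := (hwpos k).ne'
          apply le_of_eq
          field_simp
  calc _ ≤ ∑ b : ZMod q, (1 / (q : ℝ)) ^ 2 * (W * ∑ k ∈ s, ‖f k‖ / w k * ‖g b k‖ ^ 2) :=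
        Finset.sum_le_sum fun b _ => hmain b
    _ = (1 / (q : ℝ)) ^ 2 * (W * ∑ k ∈ s, ‖f k‖ / w k * ∑ b : ZMod q, ‖g b k‖ ^ 2) := by
        rw [← Finset.mul_sum, ← Finset.mul_sum, Finset.sum_comm]
        simp_rw [Finset.mul_sum]
    _ ≤ (1 / (q : ℝ)) ^ 2 * (W * ∑ k ∈ s, ‖f k‖ / w k * ((q : ℝ) ^ 2 * Nat.gcd k.val q)) := by
        gcongr with k hk
        exact sum_norm_sq_gauss_le θ hθ1 hθ0 k
    _ = W * W := by
        rw [mul_left_comm]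
        congr 1
        rw [hWdef, Finset.mul_sum]
        refine Finset.sum_congr rfl fun k _ => ?_
        have h1 : (Nat.gcd k.val q : ℝ) = w k ^ 2 := (Real.sq_sqrt (by positivity)).symm
        have := (hwpos k).ne'
        rw [h1]
        field_simp
    _ ≤ (q * (q.divisors.card * (1 + Real.log q))) * (q * (q.divisors.card * (1 + Real.log q))) :=
        mul_le_mul hW hW hW0 (hW0.trans hW)
    _ = _ := by
        rw [pvConst, mul_pow, Real.sq_sqrt hq'.le]; ring

/-- `L²` Pólya–Vinogradov inequality on average over dilations. -/
theorem polya_vinogradov_linear {q : ℕ} [NeZero q] (θ : ZMod q → ℝ) (hθ1 : ∀ b, |θ b| ≤ 1)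
    (hθ0 : ∀ b, ¬ IsUnit b → θ b = 0) (hθs : ∑ b, θ b = 0) (A B : ℕ) :
    ∑ b : ZMod q, (∑ n ∈ Finset.Ico A B, θ (b * n)) ^ 2 ≤
      q * pvConst q * (Finset.Ico A B).card := by
  have hP : 0 ≤ pvConst q := by
    unfold pvConst
    have : 0 ≤ Real.log q := Real.log_natCast_nonneg q
    positivity
  have h1 := polya_vinogradov_sq θ hθ1 hθ0 hθs A B
  have h2 : ∑ b : ZMod q, (∑ n ∈ Finset.Ico A B, θ (b * n)) ^ 2 ≤
      q * ((Finset.Ico A B).card : ℝ) ^ 2 := by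
    calc _ ≤ ∑ b : ZMod q, ((Finset.Ico A B).card : ℝ) ^ 2 := by
          refine Finset.sum_le_sum fun b _ => ?_
          rw [← sq_abs]
          gcongr
          calc _ ≤ ∑ n ∈ Finset.Ico A B, |θ (b * n)| := Finset.abs_sum_le_sum_abs _ _
            _ ≤ ∑ n ∈ Finset.Ico A B, (1 : ℝ) := Finset.sum_le_sum fun n _ => hθ1 _
            _ = _ := by simp
      _ = _ := by rw [Finset.sum_const, Finset.card_univ, ZMod.card, nsmul_eq_mul]
  rcases le_total (pvConst q) ((Finset.Ico A B).card : ℝ) with h | h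
  · calc _ ≤ q * pvConst q ^ 2 := h1
      _ = q * pvConst q * pvConst q := by ring
      _ ≤ _ := by gcongr
  · calc _ ≤ q * ((Finset.Ico A B).card : ℝ) ^ 2 := h2
      _ = q * (Finset.Ico A B).card * (Finset.Ico A B).card := by ring
      _ ≤ _ := by gcongr

/-- `e1 t = exp(2πit)` -/
noncomputable def e1 (t : ℝ) : ℂ := Complex.exp (((2 * Real.pi * t : ℝ) : ℂ) * Complex.I)

theorem intervalIntegrable_sum_fun {ι E : Type*} [NormedAddCommGroup E] {s : Finset ι}
    {f : ι → ℝ → E} {μ : MeasureTheory.Measure ℝ} {a b : ℝ}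
    (h : ∀ i ∈ s, IntervalIntegrable (f i) μ a b) :
    IntervalIntegrable (fun x => ∑ i ∈ s, f i x) μ a b := by
  have := IntervalIntegrable.sum s h
  rwa [show (∑ i ∈ s, f i) = fun x => ∑ i ∈ s, f i x from funext fun x => Finset.sum_apply _ _ _]
    at this

theorem e1_add (s t : ℝ) : e1 (s + t) = e1 s * e1 t := by
  rw [e1, e1, e1, ← Complex.exp_add]; congr 1; push_cast; ring

theorem norm_e1 (t : ℝ) : ‖e1 t‖ = 1 := Complex.norm_exp_ofReal_mul_I _

theorem e1_zero : e1 0 = 1 := by simp [e1]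

theorem conj_e1 (t : ℝ) : (starRingEnd ℂ) (e1 t) = e1 (-t) := by
  rw [e1, e1, ← Complex.exp_conj, map_mul, Complex.conj_ofReal, Complex.conj_I]; congr 1
  push_cast; ring

theorem continuous_e1 : Continuous e1 := by unfold e1; fun_prop

theorem continuous_e1_mul (ξ : ℝ) : Continuous fun s => e1 (ξ * s) :=
  continuous_e1.comp (continuous_const.mul continuous_id)

theorem norm_e1_sub_one_le (t : ℝ) : ‖e1 t - 1‖ ≤ 2 * Real.pi * |t| := by
  have := Real.norm_exp_I_mul_ofReal_sub_one_le (x := 2 * Real.pi * t)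
  rw [mul_comm Complex.I] at this
  calc _ ≤ ‖2 * Real.pi * t‖ := this
    _ = _ := by
      rw [Real.norm_eq_abs, abs_mul, abs_of_pos (by positivity : 0 < 2 * Real.pi)]

/-- majorant of `|∫ e(ηs) ds|` over an interval of length `R` -/
noncomputable def kern (R η : ℝ) : ℝ := if η = 0 then R else min R (1 / (Real.pi * |η|))

theorem kern_nonneg {R : ℝ} (hR : 0 ≤ R) (η : ℝ) : 0 ≤ kern R η := by
  unfold kern; split_ifs
  · exact hR
  · exact le_min hR (by positivity)

theorem norm_integral_e1_le {a b : ℝ} (hab : a ≤ b) (η : ℝ) :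
    ‖∫ s in a..b, e1 (η * s)‖ ≤ kern (b - a) η := by
  have h1 : ‖∫ s in a..b, e1 (η * s)‖ ≤ b - a := by
    have := intervalIntegral.norm_integral_le_of_norm_le_const (a := a) (b := b) (C := 1)
      (f := fun s => e1 (η * s)) (fun s _ => (norm_e1 _).le)
    rwa [one_mul, abs_of_nonneg (by linarith)] at this
  unfold kern
  split_ifs with h
  · exact h1
  · refine le_min h1 ?_
    have hc : ((2 * Real.pi * η : ℝ) : ℂ) * Complex.I ≠ 0 := by
      apply mul_ne_zero _ Complex.I_ne_zero
      rw [Complex.ofReal_ne_zero]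
      have := Real.pi_ne_zero
      positivity
    have h2 : ∀ s : ℝ, e1 (η * s) = Complex.exp (((2 * Real.pi * η : ℝ) : ℂ) * Complex.I * s) := by
      intro s; rw [e1]; congr 1; push_cast; ring
    simp_rw [h2]
    rw [integral_exp_mul_complex hc, norm_div]
    rw [← h2, ← h2]
    have h3 : ‖((2 * Real.pi * η : ℝ) : ℂ) * Complex.I‖ = 2 * (Real.pi * |η|) := by
      rw [norm_mul, Complex.norm_I, mul_one, Complex.norm_real, Real.norm_eq_abs, abs_mul,
        abs_of_pos (by positivity : 0 < 2 * Real.pi)]; ring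
    rw [h3]
    have h4 : 0 < Real.pi * |η| := mul_pos Real.pi_pos (abs_pos.mpr h)
    rw [div_le_div_iff₀ (by positivity) h4]
    have : ‖e1 (η * b) - e1 (η * a)‖ ≤ 2 := by
      calc _ ≤ ‖e1 (η * b)‖ + ‖e1 (η * a)‖ := norm_sub_le _ _
        _ = 2 := by rw [norm_e1, norm_e1]; norm_num
    nlinarith

/-- the diagonal count weighted by the kernel -/
noncomputable def diagSum {q : ℕ} {ι : Type*} (R : ℝ) (z : ι → ZMod q) (ξ : ι → ℝ)
    (P : Finset ι) : ℝ :=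
  ∑ p ∈ P, ∑ p' ∈ P, if z p = z p' then kern R (ξ p - ξ p') else 0

theorem integral_sum_norm_sq_le {q : ℕ} [NeZero q] {ι : Type*} (P : Finset ι) (a : ι → ℂ) (A : ℝ)
    (ha : ∀ p ∈ P, ‖a p‖ ≤ A) (z : ι → ZMod q) (ξ : ι → ℝ) {a0 b0 : ℝ} (hab : a0 ≤ b0) :
    ∫ s in a0..b0, ∑ b : ZMod q, ‖∑ p ∈ P, a p * e1 (ξ p * s) * ZMod.stdAddChar (b * z p)‖ ^ 2 ≤
      q * A ^ 2 * diagSum (b0 - a0) z ξ P := by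
  have h1 : ((∫ s in a0..b0, ∑ b : ZMod q,
      ‖∑ p ∈ P, a p * e1 (ξ p * s) * ZMod.stdAddChar (b * z p)‖ ^ 2 : ℝ) : ℂ) =
      q * ∑ p ∈ P, ∑ p' ∈ P, if z p = z p' then
        a p * (starRingEnd ℂ) (a p') * ∫ s in a0..b0, e1 ((ξ p - ξ p') * s) else 0 := by
    rw [← intervalIntegral.integral_ofReal]
    simp_rw [sum_norm_sq_char]
    rw [intervalIntegral.integral_const_mul]
    congr 1
    rw [intervalIntegral.integral_finsetSum]
    · refine Finset.sum_congr rfl fun p _ => ?_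
      rw [intervalIntegral.integral_finsetSum]
      · refine Finset.sum_congr rfl fun p' _ => ?_
        split_ifs
        · rw [← intervalIntegral.integral_const_mul]
          congr 1; funext s
          rw [map_mul, conj_e1, sub_mul, sub_eq_add_neg, e1_add]; ring
        · simp
      · intro p' _
        apply Continuous.intervalIntegrable
        split_ifs
        · have h1 := continuous_e1_mul (ξ p)
          have h2 := continuous_e1_mul (ξ p')
          exact (continuous_const.mul h1).mul
            (Complex.continuous_conj.comp (continuous_const.mul h2))
        · exact continuous_const
    · intro p _
      apply Continuous.intervalIntegrable
      apply continuous_finsetSum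
      intro p' _
      split_ifs
      · have h1 := continuous_e1_mul (ξ p)
        have h2 := continuous_e1_mul (ξ p')
        exact (continuous_const.mul h1).mul
          (Complex.continuous_conj.comp (continuous_const.mul h2))
      · exact continuous_const
  refine (le_abs_self _).trans ?_
  rw [← Real.norm_eq_abs, ← Complex.norm_real, h1, norm_mul, Complex.norm_natCast, mul_assoc]
  gcongr
  rw [diagSum, Finset.mul_sum]
  refine (norm_sum_le _ _).trans (Finset.sum_le_sum fun p hp => ?_)
  rw [Finset.mul_sum]
  refine (norm_sum_le _ _).trans (Finset.sum_le_sum fun p' hp' => ?_)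
  split_ifs
  · rw [norm_mul, norm_mul, RCLike.norm_conj, sq]
    have hA := (norm_nonneg _).trans (ha p hp)
    have := ha p hp
    have := ha p' hp'
    have := norm_integral_e1_le hab (ξ p - ξ p')
    gcongr
  · simp

theorem exists_window {ξ δ : ℝ} (hδ : 0 < δ) (hξ : |ξ| * δ ≤ 1 / 16) :
    δ ≤ ‖∫ s in (-δ)..δ, e1 (ξ * s)‖ := by
  have h1 : ‖(∫ s in (-δ)..δ, e1 (ξ * s)) - (2 * δ : ℝ)‖ ≤ δ := by
    have h2 : (∫ s in (-δ)..δ, e1 (ξ * s)) - (2 * δ : ℝ) = ∫ s in (-δ)..δ, (e1 (ξ * s) - 1) := by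
      rw [intervalIntegral.integral_sub ((continuous_e1_mul ξ).intervalIntegrable _ _)
        (continuous_const.intervalIntegrable _ _), intervalIntegral.integral_const]
      simp; ring
    rw [h2]
    have h3 := intervalIntegral.norm_integral_le_of_norm_le_const (a := -δ) (b := δ)
      (C := 1 / 2) (f := fun s => e1 (ξ * s) - 1) (fun s hs => by
        refine (norm_e1_sub_one_le _).trans ?_
        rw [Set.uIoc_of_le (by linarith), Set.mem_Ioc] at hs
        have h4 : |s| ≤ δ := abs_le.mpr ⟨hs.1.le, hs.2⟩
        rw [abs_mul]
        have h5 : |ξ| * |s| ≤ 1 / 16 := le_trans (by gcongr) hξ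
        have := Real.pi_le_four
        nlinarith [Real.pi_pos])
    rw [abs_of_nonneg (by linarith)] at h3
    linarith
  have h3 : ‖((2 * δ : ℝ) : ℂ)‖ = 2 * δ := by
    rw [Complex.norm_real, Real.norm_of_nonneg (by positivity)]
  have h4 := norm_sub_norm_le ((2 * δ : ℝ) : ℂ) (∫ s in (-δ)..δ, e1 (ξ * s))
  rw [h3, norm_sub_rev] at h4
  linarith

theorem integral_window (ξ v δ : ℝ) :
    ∫ s in (v - δ)..(v + δ), e1 (ξ * s) = e1 (ξ * v) * ∫ s in (-δ)..δ, e1 (ξ * s) := by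
  rw [← intervalIntegral.integral_const_mul]
  simp_rw [← e1_add, ← mul_add]
  rw [intervalIntegral.integral_comp_add_left (f := fun s => e1 (ξ * s)) v]
  rfl

/-- Double large sieve in bilinear form, with a free parameter `lam` from AM-GM. -/
theorem bilinear_large_sieve {q : ℕ} [NeZero q] {ι : Type*} (P : Finset ι) (c : ι → ℂ)
    (hc : ∀ p ∈ P, ‖c p‖ ≤ 1) (z : ι → ZMod q) (ξ : ι → ℝ) {δ : ℝ} (hδ : 0 < δ)
    (hξ : ∀ p ∈ P, |ξ p| * δ ≤ 1 / 16) (J : Finset ℕ) (v : ℕ → ℝ) {V : ℝ} (hV : 0 ≤ V)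
    (hv : ∀ n ∈ J, 0 ≤ v n ∧ v n ≤ V) (θ : ZMod q → ℝ) (Q : ℝ)
    (hQ : ∀ s : ℝ, ∑ b : ZMod q, (∑ n ∈ J.filter (fun n => |v n - s| ≤ δ), θ (b * n)) ^ 2 ≤
      Q * (J.filter (fun n => |v n - s| ≤ δ)).card) {lam : ℝ} (hlam : 0 < lam) :
    ‖∑ b : ZMod q, ∑ p ∈ P, c p * ZMod.stdAddChar (b * z p) *
        ∑ n ∈ J, (θ (b * n) : ℂ) * e1 (ξ p * v n)‖ ≤
      lam * (δ * Q * J.card) + lam⁻¹ * (q / (2 * δ ^ 2) * diagSum (V + 2 * δ) z ξ P) := by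
  classical
  set w : ι → ℂ := fun p => ∫ s in (-δ)..δ, e1 (ξ p * s) with hw
  have hwδ : ∀ p ∈ P, δ ≤ ‖w p‖ := fun p hp => exists_window hδ (hξ p hp)
  have hw0 : ∀ p ∈ P, w p ≠ 0 := fun p hp h => by
    have := hwδ p hp; rw [h, norm_zero] at this; linarith
  set ind : ℕ → ℝ → ℝ := fun n s => if |v n - s| ≤ δ then 1 else 0 with hind
  have hindset : ∀ n, ind n = (Set.Icc (v n - δ) (v n + δ)).indicator (fun _ => (1 : ℝ)) := by
    intro n; funext s
    simp only [hind, Set.indicator_apply, Set.mem_Icc, abs_le]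
    congr 1
    apply propext
    constructor <;> rintro ⟨h1, h2⟩ <;> constructor <;> linarith
  set a0 := -δ with ha0
  set b0 := V + δ with hb0
  have hab : a0 ≤ b0 := by linarith
  have hindint : ∀ n, IntervalIntegrable (ind n) MeasureTheory.volume a0 b0 := by
    intro n
    rw [intervalIntegrable_iff, hindset]
    apply MeasureTheory.Integrable.indicator
    · exact (continuous_const.integrableOn_uIoc)
    · exact measurableSet_Icc
  have hatom : ∀ (n : ℕ) (f : ℝ → ℂ), Continuous f →
      IntervalIntegrable (fun s => (ind n s : ℂ) * f s) MeasureTheory.volume a0 b0 := by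
    intro n f hf
    have : (fun s => (ind n s : ℂ) * f s) = (Set.Icc (v n - δ) (v n + δ)).indicator f := by
      funext s
      rw [hindset]
      by_cases h : s ∈ Set.Icc (v n - δ) (v n + δ) <;> simp [h]
    rw [this, intervalIntegrable_iff]
    exact MeasureTheory.Integrable.indicator hf.integrableOn_uIoc measurableSet_Icc
  have hatomval : ∀ n ∈ J, ∀ f : ℝ → ℂ, Continuous f →
      ∫ s in a0..b0, (ind n s : ℂ) * f s = ∫ s in (v n - δ)..(v n + δ), f s := by
    intro n hn f hf
    have : (fun s => (ind n s : ℂ) * f s) = (Set.Icc (v n - δ) (v n + δ)).indicator f := by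
      funext s
      rw [hindset]
      by_cases h : s ∈ Set.Icc (v n - δ) (v n + δ) <;> simp [h]
    rw [this, intervalIntegral.integral_of_le hab, intervalIntegral.integral_of_le (by linarith),
      ← MeasureTheory.integral_Icc_eq_integral_Ioc, ← MeasureTheory.integral_Icc_eq_integral_Ioc,
      MeasureTheory.setIntegral_indicator measurableSet_Icc]
    congr 2
    apply Set.inter_eq_right.mpr
    have := hv n hn
    exact Set.Icc_subset_Icc (by linarith) (by linarith)
  set a : ι → ℂ := fun p => c p / w p with ha
  have haA : ∀ p ∈ P, ‖a p‖ ≤ 1 / δ := by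
    intro p hp
    rw [ha, norm_div]
    have := hwδ p hp
    have := hc p hp
    gcongr
  set D : ZMod q → ℝ → ℂ := fun b s => ∑ p ∈ P, a p * e1 (ξ p * s) * ZMod.stdAddChar (b * z p)
    with hD
  have hDcont : ∀ b, Continuous (D b) := by
    intro b
    apply continuous_finsetSum
    intro p _
    exact (continuous_const.mul (continuous_e1_mul _)).mul continuous_const
  set F : ZMod q → ℝ → ℂ := fun b s => ∑ n ∈ J, (ind n s : ℂ) * (θ (b * n) : ℂ) with hF
  have hS : ∑ b : ZMod q, ∑ p ∈ P, c p * ZMod.stdAddChar (b * z p) *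
        ∑ n ∈ J, (θ (b * n) : ℂ) * e1 (ξ p * v n) = ∫ s in a0..b0, ∑ b : ZMod q, D b s * F b s := by
    have hcont : ∀ (b : ZMod q) (p : ι) (n : ℕ), Continuous fun s => (θ (b * n) : ℂ) *
        (a p * e1 (ξ p * s) * ZMod.stdAddChar (b * z p)) := fun b p n =>
      continuous_const.mul ((continuous_const.mul (continuous_e1_mul _)).mul continuous_const)
    have hexp : ∀ b s, D b s * F b s = ∑ p ∈ P, ∑ n ∈ J, (ind n s : ℂ) * ((θ (b * n) : ℂ) *
        (a p * e1 (ξ p * s) * ZMod.stdAddChar (b * z p))) := by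
      intro b s
      rw [hD, hF, Finset.sum_mul_sum]
      refine Finset.sum_congr rfl fun p _ => Finset.sum_congr rfl fun n _ => ?_
      ring
    simp_rw [hexp]
    rw [intervalIntegral.integral_finsetSum]
    · refine Finset.sum_congr rfl fun b _ => ?_
      rw [intervalIntegral.integral_finsetSum]
      · refine Finset.sum_congr rfl fun p hp => ?_
        rw [intervalIntegral.integral_finsetSum]
        · rw [Finset.mul_sum]
          refine Finset.sum_congr rfl fun n hn => ?_
          rw [hatomval n hn _ (hcont b p n), intervalIntegral.integral_const_mul,
            intervalIntegral.integral_mul_const, intervalIntegral.integral_const_mul,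
            integral_window]
          have := hw0 p hp
          change _ = (θ (b * n) : ℂ) * (c p / w p * (e1 (ξ p * v n) * w p) * _)
          field_simp
        · intro n _; exact hatom n _ (hcont b p n)
      · intro p _
        exact intervalIntegrable_sum_fun (fun n _ => hatom n _ (hcont b p n))
    · intro b _
      exact intervalIntegrable_sum_fun fun p _ =>
        intervalIntegrable_sum_fun (fun n _ => hatom n _ (hcont b p n))
  have hFnorm : ∀ s, ∑ b, ‖F b s‖ ^ 2 ≤ Q * ∑ n ∈ J, ind n s := by
    intro s
    have h1 := hQ s
    have h2 : ((J.filter (fun n => |v n - s| ≤ δ)).card : ℝ) = ∑ n ∈ J, ind n s := by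
      simp [hind, Finset.sum_boole]
    rw [h2] at h1
    refine le_trans (le_of_eq ?_) h1
    refine Finset.sum_congr rfl fun b _ => ?_
    have h3 : F b s = ((∑ n ∈ J.filter (fun n => |v n - s| ≤ δ), θ (b * n) : ℝ) : ℂ) := by
      rw [Finset.sum_filter]
      push_cast
      refine Finset.sum_congr rfl fun n _ => ?_
      simp only [hind]
      split_ifs <;> simp
    rw [h3, Complex.norm_real, Real.norm_eq_abs, sq_abs]
  have hpt : ∀ s, ‖∑ b : ZMod q, D b s * F b s‖ ≤
      lam / 2 * (Q * ∑ n ∈ J, ind n s) + lam⁻¹ / 2 * ∑ b, ‖D b s‖ ^ 2 := by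
    intro s
    calc _ ≤ ∑ b : ZMod q, ‖D b s * F b s‖ := norm_sum_le _ _
      _ ≤ ∑ b : ZMod q, (lam / 2 * ‖F b s‖ ^ 2 + lam⁻¹ / 2 * ‖D b s‖ ^ 2) := by
          refine Finset.sum_le_sum fun b _ => ?_
          rw [norm_mul]
          have h1 : 0 ≤ lam⁻¹ / 2 * (lam * ‖F b s‖ - ‖D b s‖) ^ 2 := by positivity
          have h2 : lam⁻¹ / 2 * (lam * ‖F b s‖ - ‖D b s‖) ^ 2 =
            lam / 2 * ‖F b s‖ ^ 2 + lam⁻¹ / 2 * ‖D b s‖ ^ 2 - ‖D b s‖ * ‖F b s‖ := by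
            field_simp; ring
          linarith
      _ = lam / 2 * ∑ b, ‖F b s‖ ^ 2 + lam⁻¹ / 2 * ∑ b, ‖D b s‖ ^ 2 := by
          rw [Finset.sum_add_distrib, Finset.mul_sum, Finset.mul_sum]
      _ ≤ _ := by gcongr; exact hFnorm s
  have hii1 : IntervalIntegrable (fun s => lam / 2 * (Q * ∑ n ∈ J, ind n s))
      MeasureTheory.volume a0 b0 := by
    apply IntervalIntegrable.const_mul
    apply IntervalIntegrable.const_mul
    exact intervalIntegrable_sum_fun (fun n _ => hindint n)
  have hii2 : IntervalIntegrable (fun s => lam⁻¹ / 2 * ∑ b, ‖D b s‖ ^ 2)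
      MeasureTheory.volume a0 b0 := by
    apply Continuous.intervalIntegrable
    apply continuous_const.mul
    apply continuous_finsetSum
    intro b _
    exact (hDcont b).norm.pow 2
  have hQ0 : 0 ≤ Q ∨ J = ∅ := by
    rcases J.eq_empty_or_nonempty with h | ⟨n, hn⟩
    · exact Or.inr h
    · left
      have h1 := hQ (v n)
      have h2 : 0 < ((J.filter (fun m => |v m - v n| ≤ δ)).card : ℝ) := by
        exact_mod_cast Finset.card_pos.mpr ⟨n, by simp [hn, hδ.le]⟩
      have h3 : 0 ≤ Q * ((J.filter (fun m => |v m - v n| ≤ δ)).card : ℝ) :=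
        le_trans (Finset.sum_nonneg fun _ _ => sq_nonneg _) h1
      exact nonneg_of_mul_nonneg_left h3 h2
  rw [hS]
  calc _ ≤ ∫ s in a0..b0, (lam / 2 * (Q * ∑ n ∈ J, ind n s) + lam⁻¹ / 2 * ∑ b, ‖D b s‖ ^ 2) :=
        intervalIntegral.norm_integral_le_of_norm_le hab
          (Filter.Eventually.of_forall fun s _ => hpt s) (hii1.add hii2)
    _ = lam / 2 * (Q * ∑ n ∈ J, ∫ s in a0..b0, ind n s) +
          lam⁻¹ / 2 * ∫ s in a0..b0, ∑ b, ‖D b s‖ ^ 2 := by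
        rw [intervalIntegral.integral_add hii1 hii2, intervalIntegral.integral_const_mul,
          intervalIntegral.integral_const_mul, intervalIntegral.integral_const_mul,
          intervalIntegral.integral_finsetSum (fun n _ => hindint n)]
    _ = lam / 2 * (Q * ∑ n ∈ J, (2 * δ)) +
          lam⁻¹ / 2 * ∫ s in a0..b0, ∑ b, ‖D b s‖ ^ 2 := by
        congr 3
        refine Finset.sum_congr rfl fun n hn => ?_
        have h1 := hatomval n hn (fun _ => 1) continuous_const
        simp only [mul_one] at h1
        rw [intervalIntegral.integral_ofReal, intervalIntegral.integral_const] at h1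
        have h2 : ((∫ s in a0..b0, ind n s : ℝ) : ℂ) = ((2 * δ : ℝ) : ℂ) := by
          rw [h1]; simp; ring
        exact_mod_cast h2
    _ ≤ lam / 2 * (Q * ∑ n ∈ J, (2 * δ)) +
          lam⁻¹ / 2 * (q * (1 / δ) ^ 2 * diagSum (b0 - a0) z ξ P) := by
        gcongr
        exact integral_sum_norm_sq_le P a (1 / δ) haA z ξ hab
    _ = _ := by
        rw [Finset.sum_const, nsmul_eq_mul, show b0 - a0 = V + 2 * δ by rw [hb0, ha0]; ring]
        field_simp

theorem cut_indicator (L : ℕ) : ∀ c n : ℕ, c < 2 ^ L →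
    (if n < c then (1 : ℂ) else 0) =
      ∑ j ∈ Finset.range L, if (c / 2 ^ j % 2 = 1 ∧ n / 2 ^ j + 1 = c / 2 ^ j) then 1 else 0 := by
  induction L with
  | zero => intro c n hc; have : c = 0 := by simpa using hc
            subst this; simp
  | succ L ih =>
    intro c n hc
    rw [Finset.sum_range_succ']
    have h2 : ∀ j m : ℕ, m / 2 ^ (j + 1) = m / 2 / 2 ^ j := fun j m => by
      rw [Nat.div_div_eq_div_mul, pow_succ']
    simp_rw [h2]
    rw [← ih (c / 2) (n / 2) (by rw [pow_succ] at hc; omega)]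
    simp only [pow_zero, Nat.div_one]
    by_cases h1 : n / 2 < c / 2
    · rw [if_pos h1, if_pos (by omega), if_neg (by omega), add_zero]
    · by_cases h3 : c % 2 = 1 ∧ n + 1 = c
      · rw [if_neg h1, if_pos (by omega), if_pos h3, zero_add]
      · rw [if_neg h1, if_neg (by omega), if_neg h3, zero_add]

theorem diagSum_nonneg {q : ℕ} {ι : Type*} {R : ℝ} (hR : 0 ≤ R) (z : ι → ZMod q) (ξ : ι → ℝ)
    (P : Finset ι) : 0 ≤ diagSum R z ξ P := by
  refine Finset.sum_nonneg fun p _ => Finset.sum_nonneg fun p' _ => ?_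
  split_ifs
  · exact kern_nonneg hR _
  · exact le_rfl

theorem sum_diagSum_fiber_le {q : ℕ} {ι : Type*} {R : ℝ} (hR : 0 ≤ R) (z : ι → ZMod q)
    (ξ : ι → ℝ) (P : Finset ι) (f : ι → ℕ) (G : Finset ℕ) :
    ∑ g ∈ G, diagSum R z ξ (P.filter fun p => f p = g) ≤ diagSum R z ξ P := by
  classical
  have hk : ∀ p p', 0 ≤ (if z p = z p' then kern R (ξ p - ξ p') else 0) := by
    intro p p'; split_ifs
    · exact kern_nonneg hR _
    · exact le_rfl
  calc ∑ g ∈ G, diagSum R z ξ (P.filter fun p => f p = g)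
      ≤ ∑ g ∈ G, ∑ p ∈ P.filter (fun p => f p = g), ∑ p' ∈ P,
          (if z p = z p' then kern R (ξ p - ξ p') else 0) := by
        refine Finset.sum_le_sum fun g _ => Finset.sum_le_sum fun p _ => ?_
        exact Finset.sum_le_sum_of_subset_of_nonneg (Finset.filter_subset _ _) (fun _ _ _ => hk _ _)
    _ = ∑ p ∈ P.filter (fun p => f p ∈ G), ∑ p' ∈ P,
          (if z p = z p' then kern R (ξ p - ξ p') else 0) := by
        rw [← Finset.sum_fiberwise_of_maps_to (s := P.filter (fun p => f p ∈ G)) (t := G) (g := f)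
          (fun p hp => (Finset.mem_filter.mp hp).2)]
        refine Finset.sum_congr rfl fun g hg => Finset.sum_congr ?_ fun _ _ => rfl
        ext p
        simp only [Finset.mem_filter]
        constructor
        · rintro ⟨h1, h2⟩; exact ⟨⟨h1, h2 ▸ hg⟩, h2⟩
        · rintro ⟨⟨h1, _⟩, h2⟩; exact ⟨h1, h2⟩
    _ ≤ _ := Finset.sum_le_sum_of_subset_of_nonneg (Finset.filter_subset _ _)
        (fun _ _ _ => Finset.sum_nonneg fun _ _ => hk _ _)

theorem diagSum_mono {q : ℕ} {ι : Type*} {R : ℝ} (hR : 0 ≤ R) (z : ι → ZMod q)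
    (ξ : ι → ℝ) {P P' : Finset ι} (h : P ⊆ P') : diagSum R z ξ P ≤ diagSum R z ξ P' := by
  have hk : ∀ p p', 0 ≤ (if z p = z p' then kern R (ξ p - ξ p') else 0) := by
    intro p p'; split_ifs
    · exact kern_nonneg hR _
    · exact le_rfl
  calc diagSum R z ξ P ≤ ∑ p ∈ P, ∑ p' ∈ P',
          (if z p = z p' then kern R (ξ p - ξ p') else 0) :=
        Finset.sum_le_sum fun p _ => Finset.sum_le_sum_of_subset_of_nonneg h fun _ _ _ => hk _ _
    _ ≤ _ := Finset.sum_le_sum_of_subset_of_nonneg h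
        fun _ _ _ => Finset.sum_nonneg fun _ _ => hk _ _

/-- The double large sieve with a sharp cut `n < cut p` coupling the two variables. -/
theorem cut_large_sieve {q : ℕ} [NeZero q] {ι : Type*} (P : Finset ι) (c : ι → ℂ)
    (hc : ∀ p ∈ P, ‖c p‖ ≤ 1) (z : ι → ZMod q) (ξ : ι → ℝ) {δ : ℝ} (hδ : 0 < δ)
    (hξ : ∀ p ∈ P, |ξ p| * δ ≤ 1 / 16) (A0 B0 : ℕ) (v : ℕ → ℝ) {V : ℝ} (hV : 0 ≤ V)
    (hv : ∀ n ∈ Finset.Ico A0 B0, 0 ≤ v n ∧ v n ≤ V) (θ : ZMod q → ℝ) {Q : ℝ} (hQ0 : 0 ≤ Q)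
    (hQ : ∀ (A B : ℕ) (s : ℝ), A0 ≤ A → B ≤ B0 →
      ∑ b : ZMod q, (∑ n ∈ (Finset.Ico A B).filter (fun n => |v n - s| ≤ δ), θ (b * n)) ^ 2 ≤
      Q * ((Finset.Ico A B).filter (fun n => |v n - s| ≤ δ)).card)
    (cut : ι → ℕ) (L : ℕ) (hcut : ∀ p ∈ P, cut p < 2 ^ L) {lam : ℝ} (hlam : 0 < lam) :
    ‖∑ b : ZMod q, ∑ p ∈ P, c p * ZMod.stdAddChar (b * z p) *
        ∑ n ∈ (Finset.Ico A0 B0).filter (fun n => n < cut p), (θ (b * n) : ℂ) * e1 (ξ p * v n)‖ ≤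
      L * (lam * (δ * Q * (Finset.Ico A0 B0).card) +
        lam⁻¹ * (q / (2 * δ ^ 2) * diagSum (V + 2 * δ) z ξ P)) := by
  classical
  set J := Finset.Ico A0 B0 with hJ
  have hR : 0 ≤ V + 2 * δ := by positivity
  set Pj : ℕ → Finset ι := fun j => P.filter (fun p => cut p / 2 ^ j % 2 = 1) with hPj
  set Pg : ℕ → ℕ → Finset ι := fun j g => (Pj j).filter (fun p => cut p / 2 ^ j = g) with hPg
  set Jg : ℕ → ℕ → Finset ℕ := fun j g => J.filter (fun n => n / 2 ^ j + 1 = g) with hJg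
  set G : ℕ → Finset ℕ := fun j => (Pj j).image (fun p => cut p / 2 ^ j) with hG
  have hsplit : ∑ b : ZMod q, ∑ p ∈ P, c p * ZMod.stdAddChar (b * z p) *
        ∑ n ∈ J.filter (fun n => n < cut p), (θ (b * n) : ℂ) * e1 (ξ p * v n) =
      ∑ j ∈ Finset.range L, ∑ g ∈ G j, ∑ b : ZMod q, ∑ p ∈ Pg j g,
        c p * ZMod.stdAddChar (b * z p) * ∑ n ∈ Jg j g, (θ (b * n) : ℂ) * e1 (ξ p * v n) := by
    have h1 : ∀ b : ZMod q, ∀ p ∈ P, c p * ZMod.stdAddChar (b * z p) *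
        ∑ n ∈ J.filter (fun n => n < cut p), (θ (b * n) : ℂ) * e1 (ξ p * v n) =
        ∑ j ∈ Finset.range L, if cut p / 2 ^ j % 2 = 1 then c p * ZMod.stdAddChar (b * z p) *
          ∑ n ∈ Jg j (cut p / 2 ^ j), (θ (b * n) : ℂ) * e1 (ξ p * v n) else 0 := by
      intro b p hp
      rw [Finset.sum_filter]
      have h2 : ∀ n, (if n < cut p then (θ (b * n) : ℂ) * e1 (ξ p * v n) else 0) =
          ∑ j ∈ Finset.range L, if (cut p / 2 ^ j % 2 = 1 ∧ n / 2 ^ j + 1 = cut p / 2 ^ j) then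
            (θ (b * n) : ℂ) * e1 (ξ p * v n) else 0 := by
        intro n
        have h3 := cut_indicator L (cut p) n (hcut p hp)
        calc _ = (if n < cut p then (1 : ℂ) else 0) * ((θ (b * n) : ℂ) * e1 (ξ p * v n)) := by
              split_ifs <;> simp
          _ = _ := by
              rw [h3, Finset.sum_mul]
              refine Finset.sum_congr rfl fun j _ => ?_
              split_ifs <;> simp
      simp_rw [h2]
      rw [Finset.sum_comm, Finset.mul_sum]
      refine Finset.sum_congr rfl fun j _ => ?_
      split_ifs with h
      · congr 1
        rw [hJg, Finset.sum_filter]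
        simp [h]
      · simp [h]
    rw [Finset.sum_congr rfl fun b _ => Finset.sum_congr rfl fun p hp => h1 b p hp]
    simp_rw [Finset.sum_comm (s := P) (t := Finset.range L)]
    rw [Finset.sum_comm]
    refine Finset.sum_congr rfl fun j _ => ?_
    rw [Finset.sum_comm (s := G j)]
    refine Finset.sum_congr rfl fun b _ => ?_
    rw [← Finset.sum_filter, ← Finset.sum_fiberwise_of_maps_to (s := Pj j) (t := G j)
      (g := fun p => cut p / 2 ^ j) (fun p hp => Finset.mem_image_of_mem _ hp)]
    refine Finset.sum_congr rfl fun g _ => Finset.sum_congr rfl fun p hp => ?_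
    rw [(Finset.mem_filter.mp hp).2]
  rw [hsplit]
  have hbound : ∀ j ∈ Finset.range L, ∀ g ∈ G j, ‖∑ b : ZMod q, ∑ p ∈ Pg j g,
        c p * ZMod.stdAddChar (b * z p) * ∑ n ∈ Jg j g, (θ (b * n) : ℂ) * e1 (ξ p * v n)‖ ≤
      lam * (δ * Q * (Jg j g).card) +
        lam⁻¹ * (q / (2 * δ ^ 2) * diagSum (V + 2 * δ) z ξ (Pg j g)) := by
    intro j _ g _
    have hsub : ∀ p ∈ Pg j g, p ∈ P := fun p hp =>
      (Finset.mem_filter.mp (Finset.mem_filter.mp hp).1).1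
    have hIco : Jg j g = Finset.Ico (max A0 ((g - 1) * 2 ^ j)) (min B0 (g * 2 ^ j)) := by
      ext n
      simp only [hJg, hJ, Finset.mem_filter, Finset.mem_Ico, max_le_iff, lt_min_iff]
      have hpos : 0 < 2 ^ j := by positivity
      constructor
      · rintro ⟨⟨h1, h2⟩, h3⟩
        have h5 := Nat.div_add_mod n (2 ^ j)
        have h6 := Nat.mod_lt n hpos
        subst h3
        simp only [Nat.add_sub_cancel]
        refine ⟨⟨h1, Nat.div_mul_le_self n _⟩, h2, ?_⟩
        rw [add_mul, one_mul, mul_comm]; omega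
      · rintro ⟨⟨h1, h3⟩, h2, h4⟩
        refine ⟨⟨h1, h2⟩, ?_⟩
        have h5 : n / 2 ^ j < g := by rwa [Nat.div_lt_iff_lt_mul hpos]
        have h6 : g - 1 ≤ n / 2 ^ j := by rwa [Nat.le_div_iff_mul_le hpos]
        omega
    apply bilinear_large_sieve (Pg j g) c (fun p hp => hc p (hsub p hp)) z ξ hδ
      (fun p hp => hξ p (hsub p hp)) (Jg j g) v hV
      (fun n hn => hv n (Finset.mem_filter.mp hn).1) θ Q _ hlam
    intro s
    rw [hIco]
    exact hQ _ _ s (le_max_left _ _) (min_le_left _ _)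
  calc _ ≤ ∑ j ∈ Finset.range L, ∑ g ∈ G j, ‖∑ b : ZMod q, ∑ p ∈ Pg j g,
        c p * ZMod.stdAddChar (b * z p) * ∑ n ∈ Jg j g, (θ (b * n) : ℂ) * e1 (ξ p * v n)‖ :=
        (norm_sum_le _ _).trans (Finset.sum_le_sum fun j _ => norm_sum_le _ _)
    _ ≤ ∑ j ∈ Finset.range L, ∑ g ∈ G j, (lam * (δ * Q * (Jg j g).card) +
        lam⁻¹ * (q / (2 * δ ^ 2) * diagSum (V + 2 * δ) z ξ (Pg j g))) :=
        Finset.sum_le_sum fun j hj => Finset.sum_le_sum fun g hg => hbound j hj g hg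
    _ ≤ ∑ j ∈ Finset.range L, (lam * (δ * Q * J.card) +
        lam⁻¹ * (q / (2 * δ ^ 2) * diagSum (V + 2 * δ) z ξ P)) := by
        refine Finset.sum_le_sum fun j _ => ?_
        rw [Finset.sum_add_distrib, ← Finset.mul_sum, ← Finset.mul_sum, ← Finset.mul_sum,
          ← Finset.mul_sum]
        have h1 : ∑ g ∈ G j, diagSum (V + 2 * δ) z ξ (Pg j g) ≤ diagSum (V + 2 * δ) z ξ P :=
          (sum_diagSum_fiber_le hR z ξ (Pj j) (fun p => cut p / 2 ^ j) (G j)).trans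
            (diagSum_mono hR z ξ (Finset.filter_subset _ _))
        have h2 : ∑ g ∈ G j, ((Jg j g).card : ℝ) ≤ J.card := by
          rw [← Nat.cast_sum]
          have : ∑ g ∈ G j, (Jg j g).card ≤ J.card := by
            rw [← Finset.card_biUnion]
            · apply Finset.card_le_card
              intro n hn
              obtain ⟨g, _, hg⟩ := Finset.mem_biUnion.mp hn
              exact (Finset.mem_filter.mp hg).1
            · intro g _ g' _ hne
              rw [Function.onFun, Finset.disjoint_left]
              intro n hn hn'
              exact hne ((Finset.mem_filter.mp hn).2.symm.trans (Finset.mem_filter.mp hn').2)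
          exact_mod_cast this
        gcongr
    _ = _ := by rw [Finset.sum_const, Finset.card_range, nsmul_eq_mul]

theorem sum_le_harmonic {S : Finset ℕ} {κ : ℕ → ℕ} {Y : ℕ} (hinj : Set.InjOn κ S)
    (hmaps : ∀ m ∈ S, κ m ∈ Finset.Icc 1 Y) {f : ℕ → ℝ} {c : ℝ} (hc : 0 ≤ c)
    (hf : ∀ m ∈ S, f m ≤ c * (1 / (κ m : ℝ))) : ∑ m ∈ S, f m ≤ c * (1 + Real.log Y) := by
  classical
  calc _ ≤ ∑ m ∈ S, c * (1 / (κ m : ℝ)) := Finset.sum_le_sum hf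
    _ = c * ∑ k ∈ S.image κ, 1 / (k : ℝ) := by
        rw [Finset.sum_image hinj, Finset.mul_sum]
    _ ≤ c * ∑ k ∈ Finset.Icc 1 Y, 1 / (k : ℝ) := by
        gcongr
        intro k hk
        obtain ⟨m, hm, rfl⟩ := Finset.mem_image.mp hk
        exact hmaps m hm
    _ ≤ _ := by gcongr; exact sum_inv_le_one_add_log le_rfl

/-- majorant for the kernel in terms of the two products -/
noncomputable def prodKern (q : ℕ) (R W : ℝ) (a m : ℕ) : ℝ :=
  if (a : ZMod q) = m then (if a = m then R else W / |(a : ℝ) - m|) else 0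

theorem sum_prodKern_le {q : ℕ} (hq : 0 < q) {R W : ℝ} (hR : 0 ≤ R) (hW : 0 ≤ W) {a Y : ℕ}
    (haY : a < Y) :
    ∑ m ∈ Finset.Ico 1 Y, prodKern q R W a m ≤ R + 2 * (W / q) * (1 + Real.log Y) := by
  classical
  have hq' : (0 : ℝ) < q := by exact_mod_cast hq
  have h0 : ∀ m, 0 ≤ prodKern q R W a m := by
    intro m; unfold prodKern; split_ifs <;> positivity
  set S1 := (Finset.Ico 1 Y).filter (fun m => a < m ∧ q ∣ m - a)
  set S2 := (Finset.Ico 1 Y).filter (fun m => m < a ∧ q ∣ a - m)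
  have hsplit : ∑ m ∈ Finset.Ico 1 Y, prodKern q R W a m ≤
      R + ∑ m ∈ S1, W / |(a : ℝ) - m| + ∑ m ∈ S2, W / |(a : ℝ) - m| := by
    have : ∀ m ∈ Finset.Ico 1 Y, prodKern q R W a m ≤ (if m = a then R else 0) +
        (if (a < m ∧ q ∣ m - a) then W / |(a : ℝ) - m| else 0) +
        (if (m < a ∧ q ∣ a - m) then W / |(a : ℝ) - m| else 0) := by
      intro m _
      have hp : 0 ≤ W / |(a : ℝ) - m| := by positivity
      unfold prodKern
      by_cases hc : (a : ZMod q) = m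
      · rw [if_pos hc]
        rcases lt_trichotomy a m with h | h | h
        · have hd : q ∣ m - a := by
            rw [← ZMod.natCast_eq_zero_iff, Nat.cast_sub h.le, hc, sub_self]
          rw [if_neg h.ne, if_neg h.ne', if_pos ⟨h, hd⟩, if_neg (by omega)]; linarith
        · subst h; simp
        · have hd : q ∣ a - m := by
            rw [← ZMod.natCast_eq_zero_iff, Nat.cast_sub h.le, hc, sub_self]
          rw [if_neg h.ne', if_neg h.ne, if_neg (by omega), if_pos ⟨h, hd⟩]; linarith
      · rw [if_neg hc]
        split_ifs <;> positivity
    refine (Finset.sum_le_sum this).trans ?_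
    rw [Finset.sum_add_distrib, Finset.sum_add_distrib, ← Finset.sum_filter, ← Finset.sum_filter,
      ← Finset.sum_filter]
    gcongr
    calc _ = (((Finset.Ico 1 Y).filter (fun m => m = a)).card : ℝ) * R := by
          rw [Finset.sum_const, nsmul_eq_mul]
      _ ≤ 1 * R := by
          gcongr
          have : ((Finset.Ico 1 Y).filter (fun m => m = a)).card ≤ 1 := by
            rw [Finset.card_le_one]
            intro x hx y hy
            rw [(Finset.mem_filter.mp hx).2, (Finset.mem_filter.mp hy).2]
          exact_mod_cast this
      _ = R := one_mul R
  have h1 : ∑ m ∈ S1, W / |(a : ℝ) - m| ≤ W / q * (1 + Real.log Y) := by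
    have hdiv : ∀ m ∈ S1, a < m ∧ m < Y ∧ (m - a) / q * q = m - a := by
      intro m hm
      have := Finset.mem_filter.mp hm
      have h2 := Finset.mem_Ico.mp this.1
      exact ⟨this.2.1, h2.2, Nat.div_mul_cancel this.2.2⟩
    apply sum_le_harmonic (κ := fun m => (m - a) / q)
    · intro m hm m' hm' h
      have e1 := hdiv m hm
      have e2 := hdiv m' hm'
      simp only at h
      rw [h] at e1
      omega
    · intro m hm
      have e1 := hdiv m hm
      rw [Finset.mem_Icc]
      constructor
      · rcases Nat.eq_zero_or_pos ((m - a) / q) with h | h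
        · rw [h] at e1; omega
        · exact h
      · exact (Nat.div_le_self _ _).trans (by omega)
    · positivity
    · intro m hm
      have e1 := hdiv m hm
      have h3 : |(a : ℝ) - m| = ((m - a) / q : ℕ) * q := by
        rw [← Nat.cast_mul, e1.2.2, Nat.cast_sub e1.1.le, abs_sub_comm, abs_of_nonneg]
        have : (a : ℝ) < m := by exact_mod_cast e1.1
        linarith
      rw [h3, div_mul_div_comm, mul_one, mul_comm (q : ℝ)]
  have h2 : ∑ m ∈ S2, W / |(a : ℝ) - m| ≤ W / q * (1 + Real.log Y) := by
    have hdiv : ∀ m ∈ S2, m < a ∧ m < Y ∧ (a - m) / q * q = a - m := by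
      intro m hm
      have := Finset.mem_filter.mp hm
      have h2 := Finset.mem_Ico.mp this.1
      exact ⟨this.2.1, h2.2, Nat.div_mul_cancel this.2.2⟩
    apply sum_le_harmonic (κ := fun m => (a - m) / q)
    · intro m hm m' hm' h
      have e1 := hdiv m hm
      have e2 := hdiv m' hm'
      simp only at h
      rw [h] at e1
      omega
    · intro m hm
      have e1 := hdiv m hm
      rw [Finset.mem_Icc]
      constructor
      · rcases Nat.eq_zero_or_pos ((a - m) / q) with h | h
        · rw [h] at e1; omega
        · exact h
      · exact (Nat.div_le_self _ _).trans (by omega)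
    · positivity
    · intro m hm
      have e1 := hdiv m hm
      have h3 : |(a : ℝ) - m| = ((a - m) / q : ℕ) * q := by
        rw [← Nat.cast_mul, e1.2.2, Nat.cast_sub e1.1.le, abs_of_nonneg]
        have : (m : ℝ) < a := by exact_mod_cast e1.1
        linarith
      rw [h3, div_mul_div_comm, mul_one, mul_comm (q : ℝ)]
  linarith

/-- the index set of frequencies: `h` and a modulus variable coprime to `q` -/
def freqBox (q H N1 : ℕ) : Finset (ℕ × ℕ) :=
  (Finset.Ico H (2 * H) ×ˢ Finset.Ico N1 (2 * N1)).filter (fun p => Nat.Coprime p.2 q)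

noncomputable def freqClass (q : ℕ) (p : ℕ × ℕ) : ZMod q := -(p.1 : ZMod q) * (p.2 : ZMod q)⁻¹

noncomputable def freqSlope (p : ℕ × ℕ) : ℝ := p.1 / p.2

theorem kern_le_prodKern {q : ℕ} [NeZero q] {H N1 : ℕ} (hN1 : 0 < N1)
    {R : ℝ} (hR : 0 ≤ R) {p p' : ℕ × ℕ} (hp : p ∈ freqBox q H N1) (hp' : p' ∈ freqBox q H N1) :
    (if freqClass q p = freqClass q p' then kern R (freqSlope p - freqSlope p') else 0) ≤
      prodKern q R (2 * (N1 : ℝ) ^ 2) (p.1 * p'.2) (p'.1 * p.2) := by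
  obtain ⟨h, n⟩ := p
  obtain ⟨h', n'⟩ := p'
  simp only [freqBox, Finset.mem_filter, Finset.mem_product, Finset.mem_Ico] at hp hp'
  have hpos : 0 ≤ prodKern q R (2 * (N1 : ℝ) ^ 2) (h * n') (h' * n) := by
    unfold prodKern; split_ifs <;> positivity
  have hn : (0 : ℝ) < n := by exact_mod_cast (by omega : 0 < n)
  have hn' : (0 : ℝ) < n' := by exact_mod_cast (by omega : 0 < n')
  by_cases hz : freqClass q (h, n) = freqClass q (h', n')
  · rw [if_pos hz]
    simp only [freqClass, freqSlope] at hz ⊢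
    have hu := ZMod.coe_mul_inv_eq_one n hp.2
    have hu' := ZMod.coe_mul_inv_eq_one n' hp'.2
    have hcong : ((h * n' : ℕ) : ZMod q) = ((h' * n : ℕ) : ZMod q) := by
      push_cast
      have : (h : ZMod q) * (n : ZMod q)⁻¹ = h' * (n' : ZMod q)⁻¹ := by
        simpa using hz
      calc (h : ZMod q) * n' = (h * (n : ZMod q)⁻¹) * n * n' := by
            rw [mul_assoc (h : ZMod q), mul_comm (n : ZMod q)⁻¹, hu, mul_one]
        _ = h' * (n * (n' * (n' : ZMod q)⁻¹)) := by rw [this]; ring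
        _ = h' * n := by rw [hu', mul_one]
    unfold prodKern
    rw [if_pos hcong]
    have hdiff : (h : ℝ) / n - h' / n' = (((h * n' : ℕ) : ℝ) - (h' * n : ℕ)) / (n * n') := by
      push_cast; field_simp
    unfold kern
    rw [hdiff]
    by_cases he : h * n' = h' * n
    · rw [if_pos he, he, sub_self, zero_div, if_pos rfl]
    · rw [if_neg he]
      have hne : ((h * n' : ℕ) : ℝ) - (h' * n : ℕ) ≠ 0 := by
        rw [sub_ne_zero]; exact_mod_cast he
      rw [if_neg (div_ne_zero hne (by positivity))]
      refine (min_le_right _ _).trans ?_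
      rw [abs_div, abs_of_pos (by positivity : (0 : ℝ) < n * n')]
      have h1 : 0 < |((h * n' : ℕ) : ℝ) - (h' * n : ℕ)| := abs_pos.mpr hne
      rw [← mul_div_assoc, one_div_div, div_le_div_iff₀ (by positivity) h1]
      have h2 : (n : ℝ) ≤ 2 * N1 := by exact_mod_cast hp.1.2.2.le
      have h3 : (n' : ℝ) ≤ 2 * N1 := by exact_mod_cast hp'.1.2.2.le
      have h4 : (n : ℝ) * n' ≤ 2 * N1 * (2 * N1) := mul_le_mul h2 h3 hn'.le (by positivity)
      have h5 : (n : ℝ) * n' ≤ 2 * (N1 : ℝ) ^ 2 * Real.pi := by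
        nlinarith [Real.pi_gt_three, sq_nonneg (N1 : ℝ)]
      nlinarith
  · rw [if_neg hz]
    exact hpos

theorem card_prod_eq_le (s : Finset (ℕ × ℕ)) (hs : ∀ p ∈ s, 0 < p.1 * p.2) (m : ℕ) :
    (s.filter (fun p => p.1 * p.2 = m)).card ≤ m.divisors.card := by
  apply Finset.card_le_card_of_injOn (fun p => p.1)
  · intro p hp
    have hp' := Finset.mem_filter.mp hp
    have := hs p hp'.1
    simp only [Finset.mem_coe, Nat.mem_divisors]
    exact ⟨⟨p.2, hp'.2.symm⟩, by omega⟩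
  · intro p hp p' hp' h
    have h1 := Finset.mem_filter.mp hp
    have h2 := Finset.mem_filter.mp hp'
    have := hs p h1.1
    have h3 : 0 < p.1 := Nat.pos_of_mul_pos_right this
    simp only at h
    ext
    · exact h
    · apply Nat.eq_of_mul_eq_mul_left h3
      rw [h1.2, h, h2.2]

theorem diagSum_freqBox_le {q : ℕ} [NeZero q] {H N1 : ℕ} (hH : 0 < H) (hN1 : 0 < N1)
    {R : ℝ} (hR : 0 ≤ R) {D : ℝ} 
    (hD : ∀ m : ℕ, 0 < m → m < 4 * H * N1 → (m.divisors.card : ℝ) ≤ D) :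
    diagSum R (freqClass q) freqSlope (freqBox q H N1) ≤
      H * N1 * (D * (R + 4 * (N1 : ℝ) ^ 2 / q * (1 + Real.log (4 * H * N1)))) := by
  classical
  have hq : 0 < q := Nat.pos_of_ne_zero (NeZero.ne q)
  set W : ℝ := 2 * (N1 : ℝ) ^ 2 with hW
  have hW0 : 0 ≤ W := by positivity
  have hk0 : ∀ a m, 0 ≤ prodKern q R W a m := by
    intro a m; unfold prodKern; split_ifs <;> positivity
  set A := Finset.Ico H (2 * H)
  set B := Finset.Ico N1 (2 * N1)
  have hD0 : 0 ≤ D := (Nat.cast_nonneg _).trans (hD 1 one_pos (by nlinarith))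
  have hlt : ∀ h ∈ A, ∀ n ∈ B, 0 < h * n ∧ h * n < 4 * H * N1 := by
    intro h hh n hn
    rw [Finset.mem_Ico] at hh hn
    constructor
    · exact Nat.mul_pos (by omega) (by omega)
    · calc h * n < 2 * H * (2 * N1) := Nat.mul_lt_mul'' hh.2 hn.2
        _ = _ := by ring
  have hinner : ∀ a < 4 * H * N1, ∑ p ∈ A ×ˢ B, prodKern q R W a (p.1 * p.2) ≤
      D * (R + 4 * (N1 : ℝ) ^ 2 / q * (1 + Real.log (4 * H * N1))) := by
    intro a ha
    have hmaps : ∀ p ∈ A ×ˢ B, p.1 * p.2 ∈ Finset.Ico 1 (4 * H * N1) := by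
      intro p hp
      rw [Finset.mem_product] at hp
      have := hlt _ hp.1 _ hp.2
      rw [Finset.mem_Ico]; omega
    rw [← Finset.sum_fiberwise_of_maps_to hmaps]
    calc _ ≤ ∑ m ∈ Finset.Ico 1 (4 * H * N1), D * prodKern q R W a m := by
          refine Finset.sum_le_sum fun m hm => ?_
          rw [Finset.mem_Ico] at hm
          calc _ = ∑ p ∈ (A ×ˢ B).filter (fun p => p.1 * p.2 = m), prodKern q R W a m :=
                Finset.sum_congr rfl fun p hp => by rw [(Finset.mem_filter.mp hp).2]
            _ = (((A ×ˢ B).filter (fun p => p.1 * p.2 = m)).card : ℝ) * prodKern q R W a m := by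
                rw [Finset.sum_const, nsmul_eq_mul]
            _ ≤ _ := by
                apply mul_le_mul_of_nonneg_right _ (hk0 a m)
                refine le_trans ?_ (hD m hm.1 hm.2)
                exact_mod_cast card_prod_eq_le (A ×ˢ B) (fun p hp => by
                  rw [Finset.mem_product] at hp; exact (hlt _ hp.1 _ hp.2).1) m
      _ = D * ∑ m ∈ Finset.Ico 1 (4 * H * N1), prodKern q R W a m := by rw [Finset.mul_sum]
      _ ≤ _ := by
          gcongr
          refine (sum_prodKern_le hq hR hW0 ha).trans (le_of_eq ?_)
          rw [hW]; push_cast; ring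
  calc diagSum R (freqClass q) freqSlope (freqBox q H N1)
      ≤ ∑ p ∈ freqBox q H N1, ∑ p' ∈ freqBox q H N1, prodKern q R W (p.1 * p'.2) (p'.1 * p.2) :=
        Finset.sum_le_sum fun p hp => Finset.sum_le_sum fun p' hp' =>
          kern_le_prodKern hN1 hR hp hp'
    _ ≤ ∑ p ∈ A ×ˢ B, ∑ p' ∈ A ×ˢ B, prodKern q R W (p.1 * p'.2) (p'.1 * p.2) := by
        refine (Finset.sum_le_sum_of_subset_of_nonneg (Finset.filter_subset _ _)
          fun _ _ _ => Finset.sum_nonneg fun _ _ => hk0 _ _).trans ?_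
        exact Finset.sum_le_sum fun p _ => Finset.sum_le_sum_of_subset_of_nonneg
          (Finset.filter_subset _ _) fun _ _ _ => hk0 _ _
    _ = ∑ h ∈ A, ∑ n' ∈ B, ∑ p ∈ A ×ˢ B, prodKern q R W (h * n') (p.1 * p.2) := by
        simp_rw [Finset.sum_product]
        refine Finset.sum_congr rfl fun h _ => ?_
        rw [Finset.sum_congr rfl fun n _ => Finset.sum_comm]
        rw [Finset.sum_comm]
        refine Finset.sum_congr rfl fun n' _ => ?_
        rw [Finset.sum_comm]
    _ ≤ ∑ h ∈ A, ∑ n' ∈ B, D * (R + 4 * (N1 : ℝ) ^ 2 / q * (1 + Real.log (4 * H * N1))) :=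
        Finset.sum_le_sum fun h hh => Finset.sum_le_sum fun n' hn' => hinner _ (hlt h hh n' hn').2
    _ = _ := by
        simp only [Finset.sum_const, nsmul_eq_mul]
        rw [Nat.card_Ico, Nat.card_Ico, show 2 * H - H = H by omega, show 2 * N1 - N1 = N1 by omega]
        ring

theorem eq_Ico_of_ordConnected (S : Finset ℕ)
    (h : ∀ a ∈ S, ∀ b ∈ S, ∀ n, a ≤ n → n ≤ b → n ∈ S) : ∃ A B, S = Finset.Ico A B := by
  rcases S.eq_empty_or_nonempty with rfl | hne
  · exact ⟨0, 0, by simp⟩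
  · refine ⟨S.min' hne, S.max' hne + 1, ?_⟩
    ext n
    rw [Finset.mem_Ico]
    constructor
    · intro hn
      exact ⟨Finset.min'_le _ _ hn, Nat.lt_succ_of_le (Finset.le_max' _ _ hn)⟩
    · rintro ⟨h1, h2⟩
      exact h _ (Finset.min'_mem _ _) _ (Finset.max'_mem _ _) n h1 (by omega)

theorem filter_abs_div_sub_ordConnected {α : ℝ} (hα : 0 ≤ α) (s δ : ℝ) {A B : ℕ} (hA : 0 < A) :
    ∀ a ∈ (Finset.Ico A B).filter (fun n : ℕ => |α / n - s| ≤ δ),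
      ∀ b ∈ (Finset.Ico A B).filter (fun n : ℕ => |α / n - s| ≤ δ), ∀ n, a ≤ n → n ≤ b →
        n ∈ (Finset.Ico A B).filter (fun n : ℕ => |α / n - s| ≤ δ) := by
  intro a ha b hb n han hnb
  rw [Finset.mem_filter, Finset.mem_Ico] at *
  have h1 : (0 : ℝ) < a := by exact_mod_cast (by omega : 0 < a)
  have h2 : (a : ℝ) ≤ n := by exact_mod_cast han
  have h3 : (n : ℝ) ≤ b := by exact_mod_cast hnb
  have h4 : α / n ≤ α / a := by gcongr
  have h5 : α / b ≤ α / n := div_le_div_of_nonneg_left hα (by linarith) h3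
  have h6 := abs_le.mp ha.2
  have h7 := abs_le.mp hb.2
  refine ⟨⟨by omega, by omega⟩, abs_le.mpr ⟨by linarith, by linarith⟩⟩

/-- a mean value bound for `θ` dilated and summed over short hyperbolic segments of `[N, 2 * N)` -/
def SegBound {q : ℕ} [NeZero q] (θ : ZMod q → ℝ) (Q α δ : ℝ) (N : ℕ) : Prop :=
  ∀ (A B : ℕ) (s : ℝ), N ≤ A → B ≤ 2 * N →
    ∑ b : ZMod q, (∑ n ∈ (Finset.Ico A B).filter (fun n : ℕ => |α / n - s| ≤ δ), θ (b * n)) ^ 2 ≤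
      Q * ((Finset.Ico A B).filter (fun n : ℕ => |α / n - s| ≤ δ)).card

theorem segBound_pv {q : ℕ} [NeZero q] (θ : ZMod q → ℝ) (hθ1 : ∀ b, |θ b| ≤ 1)
    (hθ0 : ∀ b, ¬ IsUnit b → θ b = 0) (hθs : ∑ b, θ b = 0) {α : ℝ} (hα : 0 ≤ α) (δ : ℝ)
    {N : ℕ} (hN : 0 < N) : SegBound θ (q * pvConst q) α δ N := by
  intro A B s hA _
  obtain ⟨A', B', h⟩ := eq_Ico_of_ordConnected _
    (filter_abs_div_sub_ordConnected hα s δ (B := B) (lt_of_lt_of_le hN hA))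
  rw [h]
  exact polya_vinogradov_linear θ hθ1 hθ0 hθs A' B'

theorem segBound_one {α δ : ℝ} {N : ℕ} (hN : 0 < N) (hα : 8 * δ * (N : ℝ) ^ 2 < 2 * α) :
    SegBound (q := 1) (fun _ => 1) 2 α δ N := by
  intro A B s hA hB
  set S := (Finset.Ico A B).filter (fun n : ℕ => |α / n - s| ≤ δ) with hS
  have hcard : S.card ≤ 2 := by
    by_contra! hc
    obtain ⟨a, b, c, ha, hb, hcc, hab, hac, hbc⟩ := Finset.two_lt_card_iff.mp hc
    have key : ∀ m ∈ S, ∀ n ∈ S, ¬ (m + 2 ≤ n) := by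
      intro m hm n hn hmn
      rw [hS, Finset.mem_filter, Finset.mem_Ico] at hm hn
      have hm0 : (0 : ℝ) < m := by exact_mod_cast (by omega : 0 < m)
      have hn0 : (0 : ℝ) < n := by exact_mod_cast (by omega : 0 < n)
      have h1 : (m : ℝ) + 2 ≤ n := by exact_mod_cast hmn
      have h2 : (n : ℝ) ≤ 2 * N := by exact_mod_cast (by omega : n ≤ 2 * N)
      have h6 := abs_le.mp hm.2
      have h7 := abs_le.mp hn.2
      have h8 : α / m - α / n ≤ 2 * δ := by linarith
      have hδ : 0 ≤ δ := (abs_nonneg _).trans hm.2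
      have hα0 : 0 < α := by nlinarith [sq_nonneg (N : ℝ)]
      have h9 : α / m - α / n = α * (n - m) / (m * n) := by field_simp
      rw [h9, div_le_iff₀ (by positivity)] at h8
      have h10 : (m : ℝ) * n ≤ (2 * N) * (2 * N) := by gcongr; linarith
      have h11 : 2 * δ * (m * n) ≤ 2 * δ * ((2 * N) * (2 * N)) := by gcongr
      nlinarith
    have := key a ha b hb
    have := key b hb a ha
    have := key a ha c hcc
    have := key c hcc a ha
    have := key b hb c hcc
    have := key c hcc b hb
    omega
  have hcard' : (S.card : ℝ) ≤ 2 := by exact_mod_cast hcard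
  simp only [Finset.sum_const, nsmul_eq_mul, mul_one]
  rw [Finset.card_univ, ZMod.card, Nat.cast_one]
  nlinarith [(Nat.cast_nonneg S.card : (0 : ℝ) ≤ S.card)]

set_option maxHeartbeats 1000000 in
/-- Trilinear block estimate. -/
theorem block_le {q : ℕ} [NeZero q] {H N1 N2 : ℕ} (hH : 0 < H) (hN1 : 0 < N1) (hN2 : 0 < N2)
    {x α : ℝ} (hx : 0 < x) (hα : 0 ≤ α) (hαx : α ≤ 2 * x / q) (hN : (N1 : ℝ) ^ 2 * N2 ≤ x)
    (θ : ZMod q → ℝ) {Q : ℝ} (hQ0 : 0 < Q)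
    (hQ : SegBound θ Q α (N1 / (32 * H)) N2) {B : ℝ}
    (hD : ∀ m : ℕ, 0 < m → m < 4 * H * N1 → (m.divisors.card : ℝ) ≤ B)
    (hlog : 1 + Real.log (4 * H * N1) ≤ B) (P : Finset (ℕ × ℕ)) (hP : P ⊆ freqBox q H N1)
    (c : ℕ × ℕ → ℂ) (hc : ∀ p ∈ P, ‖c p‖ ≤ 1) (cut : ℕ × ℕ → ℕ) (L : ℕ)
    (hcut : ∀ p ∈ P, cut p < 2 ^ L) (hL : (L : ℝ) ≤ B) :
    ‖∑ b : ZMod q, ∑ p ∈ P, c p * ZMod.stdAddChar (b * freqClass q p) *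
        ∑ n ∈ (Finset.Ico N2 (2 * N2)).filter (fun n => n < cut p),
          (θ (b * n) : ℂ) * e1 (freqSlope p * (α / n))‖ ≤
      20 * B ^ 2 * Real.sqrt (q * Q * H * N1 * N2 * (1 + H * x / (q * N1 * N2))) := by
  classical
  have hq : (0 : ℝ) < q := by exact_mod_cast Nat.pos_of_ne_zero (NeZero.ne q)
  have hH' : (0 : ℝ) < H := by exact_mod_cast hH
  have hN1' : (0 : ℝ) < N1 := by exact_mod_cast hN1
  have hN2' : (0 : ℝ) < N2 := by exact_mod_cast hN2
  have h1 : (1 : ℝ) ≤ H := by exact_mod_cast hH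
  have h2 : (1 : ℝ) ≤ N1 := by exact_mod_cast hN1
  have hB1 : 1 ≤ B := by
    refine le_trans ?_ hlog
    have : 0 ≤ Real.log (4 * H * N1) := Real.log_nonneg (by nlinarith)
    linarith
  set δ : ℝ := N1 / (32 * H) with hδ
  have hδ0 : 0 < δ := by positivity
  set V : ℝ := α / N2
  have hV : 0 ≤ V := by positivity
  set X : ℝ := H * x / (q * N1 * N2) with hX
  have hX0 : 0 < X := by positivity
  set DS := diagSum (V + 2 * δ) (freqClass q) freqSlope P with hDS
  have hDS0 : 0 ≤ DS := diagSum_nonneg (by positivity) _ _ _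
  have hdiag : DS ≤ H * N1 * (B * (V + 2 * δ + 4 * (N1 : ℝ) ^ 2 / q * B)) := by
    refine (diagSum_mono (by positivity) _ _ hP).trans ?_
    refine (diagSum_freqBox_le hH hN1 (by positivity) hD).trans ?_
    gcongr
  set X' := δ * Q * (Finset.Ico N2 (2 * N2)).card with hX'
  set Y' := q / (2 * δ ^ 2) * DS with hY'
  have hcardN : ((Finset.Ico N2 (2 * N2)).card : ℝ) = N2 := by
    rw [Nat.card_Ico, show 2 * N2 - N2 = N2 by omega]
  have hX'0 : 0 < X' := by rw [hX', hcardN]; positivity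
  have hY'0 : 0 ≤ Y' := by positivity
  set T := q * Q * H * N1 * N2 * (1 + X) with hT
  have hT0 : 0 < T := by positivity
  have hXY : X' * Y' ≤ (10 * B) ^ 2 * T := by
    have hVδ : V ≤ 64 * X * δ := by
      calc V ≤ 2 * x / q / N2 := by simp only [V]; gcongr
        _ = 64 * X * δ := by rw [hX, hδ]; field_simp; norm_num
    have hNδ : 4 * (N1 : ℝ) ^ 2 / q ≤ 128 * X * δ := by
      calc 4 * (N1 : ℝ) ^ 2 / q = 4 * ((N1 : ℝ) ^ 2 * N2) / (q * N2) := by field_simp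
        _ ≤ 4 * x / (q * N2) := by gcongr
        _ = _ := by rw [hX, hδ]; field_simp; norm_num
    have hDS2 : DS ≤ H * N1 * (B * (194 * B * (1 + X) * δ)) := by
      refine hdiag.trans ?_
      gcongr
      have : 4 * (N1 : ℝ) ^ 2 / q * B ≤ 128 * X * δ * B := by gcongr
      have h3 : 64 * X * δ ≤ 64 * X * δ * B := le_mul_of_one_le_right (by positivity) hB1
      have h4 : 2 * δ ≤ 2 * δ * B := le_mul_of_one_le_right (by positivity) hB1
      nlinarith [mul_pos hδ0 (lt_of_lt_of_le one_pos hB1),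
        mul_pos (mul_pos hX0 hδ0) (lt_of_lt_of_le one_pos hB1)]
    calc X' * Y' = q * Q * N2 / (2 * δ) * DS := by
          rw [hX', hY', hcardN]; field_simp
      _ ≤ q * Q * N2 / (2 * δ) * (H * N1 * (B * (194 * B * (1 + X) * δ))) := by gcongr
      _ = 97 * B ^ 2 * T := by rw [hT]; field_simp; norm_num
      _ ≤ _ := by nlinarith [mul_nonneg (sq_nonneg B) hT0.le]
  have hmain : ∀ lam : ℝ, 0 < lam → _ ≤ L * (lam * X' + lam⁻¹ * Y') := fun lam hlam =>
    cut_large_sieve P c hc (freqClass q) freqSlope hδ0 (by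
      intro p hp
      have hp' := hP hp
      simp only [freqBox, Finset.mem_filter, Finset.mem_product, Finset.mem_Ico] at hp'
      have h3 : (p.1 : ℝ) ≤ 2 * H := by exact_mod_cast hp'.1.1.2.le
      have h4 : (N1 : ℝ) ≤ p.2 := by exact_mod_cast hp'.1.2.1
      have h5 : (0 : ℝ) < p.2 := by linarith
      rw [freqSlope, abs_of_nonneg (by positivity), hδ, div_mul_div_comm,
        div_le_div_iff₀ (by positivity) (by norm_num)]
      nlinarith [mul_le_mul h3 h4 hN1'.le (by positivity)]) N2 (2 * N2) (fun n => α / n) hV (by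
      intro n hn
      rw [Finset.mem_Ico] at hn
      have h4 : (N2 : ℝ) ≤ n := by exact_mod_cast hn.1
      exact ⟨by positivity, div_le_div_of_nonneg_left hα hN2' h4⟩) θ hQ0.le hQ cut L hcut hlam
  set S := ‖∑ b : ZMod q, ∑ p ∈ P, c p * ZMod.stdAddChar (b * freqClass q p) *
        ∑ n ∈ (Finset.Ico N2 (2 * N2)).filter (fun n => n < cut p),
          (θ (b * n) : ℂ) * e1 (freqSlope p * (α / n))‖
  set r := Real.sqrt T
  have hr : 0 < r := Real.sqrt_pos.mpr hT0
  have hr2 : r ^ 2 = T := Real.sq_sqrt hT0.le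
  have hB0 : 0 < B := by linarith
  have hl := hmain (10 * B * r / X') (by positivity)
  have hY2 : (10 * B * r / X')⁻¹ * Y' ≤ 10 * B * r := by
    rw [inv_div, div_mul_eq_mul_div, div_le_iff₀ (by positivity)]
    calc X' * Y' ≤ (10 * B) ^ 2 * T := hXY
      _ = _ := by rw [← hr2]; ring
  have hX2 : 10 * B * r / X' * X' = 10 * B * r := by field_simp
  calc S ≤ L * (10 * B * r / X' * X' + (10 * B * r / X')⁻¹ * Y') := hl
    _ ≤ B * (10 * B * r + 10 * B * r) := by rw [hX2]; gcongr
    _ = _ := by ring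

theorem sin_mul_dirichlet (a : ℝ) (M : ℕ) :
    Real.sin a * (1 + ∑ h ∈ Finset.Icc 1 M, 2 * Real.cos (2 * h * a)) =
      Real.sin ((2 * M + 1) * a) := by
  induction M with
  | zero => simp
  | succ M ih =>
    rw [Finset.sum_Icc_succ_top (by omega), ← add_assoc, mul_add, ih]
    have h1 : ((2 * ((M + 1 : ℕ) : ℝ) + 1) * a) = 2 * ((M + 1 : ℕ) : ℝ) * a + a := by ring
    have h2 : ((2 * (M : ℝ) + 1) * a) = 2 * ((M + 1 : ℕ) : ℝ) * a - a := by push_cast; ring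
    rw [h1, h2, Real.sin_add, Real.sin_sub]
    ring

theorem two_mul_le_sin_pi_mul {η t : ℝ} (h0 : 0 ≤ η) (h1 : η ≤ t) (h2 : t ≤ 1 - η) :
    2 * η ≤ Real.sin (Real.pi * t) := by
  have hpi := Real.pi_pos
  have key : ∀ u : ℝ, η ≤ u → u ≤ 1 / 2 → 2 * η ≤ Real.sin (Real.pi * u) := by
    intro u hu hu'
    have := Real.mul_le_sin (x := Real.pi * u) (by nlinarith) (by nlinarith)
    have h3 : 2 / Real.pi * (Real.pi * u) = 2 * u := by field_simp
    linarith
  rcases le_total t (1 / 2) with h | h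
  · exact key t h1 h
  · have := key (1 - t) (by linarith) (by linarith)
    rwa [mul_sub, mul_one, Real.sin_pi_sub] at this

theorem abs_fourier_sub_sawtooth_le {M : ℕ} (hM : 0 < M) {η t : ℝ} (h0 : 0 < η) (h1 : η ≤ t)
    (h2 : t ≤ 1 - η) :
    |∑ h ∈ Finset.Icc 1 M, Real.sin (2 * h * (Real.pi * t)) / (Real.pi * h) - (1 / 2 - t)| ≤
      1 / (M * η ^ 2) := by
  have hpi := Real.pi_pos
  set K : ℝ := 2 * M + 1 with hK
  have hM0 : (0 : ℝ) < M := by exact_mod_cast hM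
  have hK0 : 0 < K := by positivity
  set f : ℝ → ℝ := fun t =>
    ∑ h ∈ Finset.Icc 1 M, Real.sin (2 * h * (Real.pi * t)) / (Real.pi * h) - (1 / 2 - t) with hf
  set g : ℝ → ℝ := fun t =>
    f t + Real.cos (K * (Real.pi * t)) / (K * Real.pi * Real.sin (Real.pi * t)) with hg
  have hη : η ≤ 1 / 2 := by linarith
  have hf' : ∀ t, HasDerivAt f (1 + ∑ h ∈ Finset.Icc 1 M, 2 * Real.cos (2 * h * (Real.pi * t))) t := by
    intro t
    have hs : HasDerivAt
        (fun t => ∑ h ∈ Finset.Icc 1 M, Real.sin (2 * h * (Real.pi * t)) / (Real.pi * h))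
        (∑ h ∈ Finset.Icc 1 M, 2 * Real.cos (2 * h * (Real.pi * t))) t := by
      apply HasDerivAt.fun_sum
      intro h hh
      have hh0 : (0 : ℝ) < h := by
        exact_mod_cast (Finset.mem_Icc.mp hh).1
      have hl : HasDerivAt (fun t : ℝ => 2 * h * (Real.pi * t)) (2 * h * (Real.pi * 1)) t :=
        ((hasDerivAt_id t).const_mul Real.pi).const_mul (2 * (h : ℝ))
      refine ((hl.sin).div_const (Real.pi * h)).congr_deriv ?_
      field_simp
    refine (hs.sub ((hasDerivAt_const t (1 / 2 : ℝ)).sub (hasDerivAt_id t))).congr_deriv ?_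
    ring
  have hsin : ∀ t ∈ Set.Icc η (1 - η), 2 * η ≤ Real.sin (Real.pi * t) := fun t ht =>
    two_mul_le_sin_pi_mul h0.le ht.1 ht.2
  have hg' : ∀ t ∈ Set.Icc η (1 - η), HasDerivWithinAt g
      (-(Real.cos (K * (Real.pi * t)) * Real.cos (Real.pi * t)) / (K * Real.sin (Real.pi * t) ^ 2))
      (Set.Icc η (1 - η)) t := by
    intro t ht
    have hs := hsin t ht
    have hs0 : 0 < Real.sin (Real.pi * t) := by linarith
    apply HasDerivAt.hasDerivWithinAt
    have hl : HasDerivAt (fun t : ℝ => Real.pi * t) (Real.pi * 1) t :=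
      (hasDerivAt_id t).const_mul Real.pi
    have hd := (hf' t).add (((hl.const_mul K).cos).div ((hl.sin).const_mul (K * Real.pi))
      (by positivity))
    refine hd.congr_deriv ?_
    have hD := sin_mul_dirichlet (Real.pi * t) M
    rw [← hK] at hD
    have hD' : 1 + ∑ h ∈ Finset.Icc 1 M, 2 * Real.cos (2 * h * (Real.pi * t)) =
        Real.sin (K * (Real.pi * t)) / Real.sin (Real.pi * t) := by
      rw [eq_div_iff hs0.ne', mul_comm]; exact hD
    rw [hD']
    field_simp
    ring
  have hbound : ∀ t ∈ Set.Icc η (1 - η),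
      ‖-(Real.cos (K * (Real.pi * t)) * Real.cos (Real.pi * t)) /
        (K * Real.sin (Real.pi * t) ^ 2)‖ ≤ 1 / (K * (2 * η) ^ 2) := by
    intro t ht
    have hs := hsin t ht
    rw [norm_div, norm_neg, norm_mul, Real.norm_eq_abs, Real.norm_eq_abs, Real.norm_eq_abs,
      abs_of_nonneg (by positivity : 0 ≤ K * Real.sin (Real.pi * t) ^ 2)]
    have h3 := Real.abs_cos_le_one (K * (Real.pi * t))
    have h4 := Real.abs_cos_le_one (Real.pi * t)
    gcongr
    nlinarith [abs_nonneg (Real.cos (K * (Real.pi * t))), abs_nonneg (Real.cos (Real.pi * t))]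
  have hmv := (convex_Icc η (1 - η)).norm_image_sub_le_of_norm_hasDerivWithin_le hg' hbound
    (x := 1 / 2) (y := t) ⟨hη, by linarith⟩ ⟨h1, h2⟩
  have hg0 : g (1 / 2) = 0 := by
    simp only [hg, hf]
    have e1 : ∑ h ∈ Finset.Icc 1 M, Real.sin (2 * h * (Real.pi * (1 / 2))) / (Real.pi * h) = 0 := by
      refine Finset.sum_eq_zero fun h _ => ?_
      rw [show 2 * (h : ℝ) * (Real.pi * (1 / 2)) = h * Real.pi by ring, Real.sin_nat_mul_pi, zero_div]
    have e2 : Real.cos (K * (Real.pi * (1 / 2))) = 0 := by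
      rw [show K * (Real.pi * (1 / 2)) = M * Real.pi + Real.pi / 2 by rw [hK]; ring,
        Real.cos_add_pi_div_two, Real.sin_nat_mul_pi, neg_zero]
    rw [e1, e2]; norm_num
  rw [hg0, sub_zero, Real.norm_eq_abs, Real.norm_eq_abs] at hmv
  have ht2 : |t - 1 / 2| ≤ 1 / 2 := abs_le.mpr ⟨by linarith, by linarith⟩
  have hs := hsin t ⟨h1, h2⟩
  have hs0 : 0 < Real.sin (Real.pi * t) := by linarith
  have hb2 : |Real.cos (K * (Real.pi * t)) / (K * Real.pi * Real.sin (Real.pi * t))| ≤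
      1 / (K * Real.pi * (2 * η)) := by
    rw [abs_div, abs_of_nonneg (by positivity : 0 ≤ K * Real.pi * Real.sin (Real.pi * t))]
    gcongr
    exact Real.abs_cos_le_one _
  have hfg : f t = g t - Real.cos (K * (Real.pi * t)) / (K * Real.pi * Real.sin (Real.pi * t)) := by
    simp only [hg]; ring
  change |f t| ≤ _
  rw [hfg]
  refine (abs_sub _ _).trans ?_
  have e1 : 1 / (K * (2 * η) ^ 2) * |t - 1 / 2| ≤ 1 / (2 * (M * η ^ 2)) := by
    calc _ ≤ 1 / (K * (2 * η) ^ 2) * (1 / 2) := by gcongr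
      _ = 1 / (8 * K * η ^ 2) := by field_simp; norm_num
      _ ≤ _ := by
        apply one_div_le_one_div_of_le (by positivity)
        nlinarith [sq_nonneg η, mul_nonneg hM0.le (sq_nonneg η)]
  have e2 : 1 / (K * Real.pi * (2 * η)) ≤ 1 / (2 * (M * η ^ 2)) := by
    apply one_div_le_one_div_of_le (by positivity)
    have : M * η ≤ K * Real.pi := by
      nlinarith [Real.pi_gt_three]
    nlinarith
  have e3 : 1 / (2 * (M * η ^ 2)) + 1 / (2 * (M * η ^ 2)) = 1 / (M * η ^ 2) := by
    field_simp; norm_num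
  linarith

theorem abs_floor_sub_fourier_le {M : ℕ} (hM : 0 < M) {η v : ℝ} (h0 : 0 < η)
    (hd : ∀ k : ℤ, η ≤ |v - k|) :
    |(⌊v⌋ : ℝ) - (v - 1 / 2 + ∑ h ∈ Finset.Icc 1 M, Real.sin (2 * Real.pi * (h * v)) / (Real.pi * h))| ≤
      1 / (M * η ^ 2) := by
  have h1 := hd ⌊v⌋
  have h2 := hd (⌊v⌋ + 1)
  have h3 := Int.floor_le v
  have h4 := Int.lt_floor_add_one v
  push_cast at h2
  rw [abs_of_nonneg (by linarith)] at h1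
  rw [abs_of_nonpos (by linarith)] at h2
  have := abs_fourier_sub_sawtooth_le hM (t := v - ⌊v⌋) h0 h1 (by linarith)
  rw [← abs_neg] at this
  convert this using 2
  have hs : ∀ h ∈ Finset.Icc 1 M, Real.sin (2 * h * (Real.pi * (v - ⌊v⌋))) / (Real.pi * h) =
      Real.sin (2 * Real.pi * (h * v)) / (Real.pi * h) := by
    intro h _
    congr 1
    rw [← Real.sin_sub_int_mul_two_pi (2 * Real.pi * (h * v)) (h * ⌊v⌋)]
    congr 1
    push_cast; ring
  rw [Finset.sum_congr rfl hs]
  ring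

theorem card_filter_zmod_eq {q : ℕ} [NeZero q] (r : ZMod q) {u : ℝ} (hu : 0 ≤ u) :
    (((Finset.Icc 1 ⌊u⌋₊).filter (fun n : ℕ => (n : ZMod q) = r)).card : ℤ) =
      ⌊(u - r.val) / q⌋ - ⌊((1 / 2 : ℝ) - r.val) / q⌋ := by
  have hq : 0 < q := Nat.pos_of_ne_zero (NeZero.ne q)
  have h := Nat.Ioc_filter_modEq_card 0 ⌊u⌋₊ hq r.val
  have hset : (Finset.Icc 1 ⌊u⌋₊).filter (fun n : ℕ => (n : ZMod q) = r) =
      (Finset.Ioc 0 ⌊u⌋₊).filter (fun n => n ≡ r.val [MOD q]) := by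
    ext n
    simp only [Finset.mem_filter, Finset.mem_Icc, Finset.mem_Ioc, Nat.succ_le_iff,
      ← ZMod.natCast_eq_natCast_iff, ZMod.natCast_zmod_val]
  rw [hset, h]
  have e1 : ⌊((⌊u⌋₊ : ℚ) - (r.val : ℕ)) / q⌋ = ⌊(u - r.val) / q⌋ := by
    rw [Int.floor_div_natCast, Int.floor_div_natCast, Int.floor_sub_natCast, Int.floor_sub_natCast,
      Int.floor_natCast, Int.natCast_floor_eq_floor hu]
  have e2 : ⌊((0 : ℕ) - (r.val : ℕ) : ℚ) / q⌋ = ⌊((1 / 2 : ℝ) - r.val) / q⌋ := by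
    rw [Int.floor_div_natCast, Int.floor_div_natCast, Int.floor_sub_natCast, Int.floor_sub_natCast]
    norm_num
  rw [e1, e2]
  apply max_eq_left
  rw [sub_nonneg, ← e1, ← e2]
  apply Int.floor_le_floor
  have : (0 : ℚ) < q := by exact_mod_cast hq
  gcongr
  simp

theorem sum_zmod_fiber {q : ℕ} [NeZero q] (f : ZMod q → ℝ) (S : Finset ℕ) :
    ∑ n ∈ S, f (n : ZMod q) =
      ∑ r : ZMod q, f r * ((S.filter (fun n : ℕ => (n : ZMod q) = r)).card : ℝ) := by
  rw [← Finset.sum_fiberwise S (fun n : ℕ => (n : ZMod q))]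
  refine Finset.sum_congr rfl fun r _ => ?_
  rw [Finset.sum_congr rfl fun n hn => by rw [(Finset.mem_filter.mp hn).2], Finset.sum_const,
    nsmul_eq_mul, mul_comm]

/-- truncated Fourier series of the sawtooth function -/
noncomputable def sawSum (M : ℕ) (v : ℝ) : ℝ :=
  ∑ h ∈ Finset.Icc 1 M, Real.sin (2 * Real.pi * (h * v)) / (Real.pi * h)

theorem sawSum_eq_im (M : ℕ) (v : ℝ) :
    sawSum M v = (∑ h ∈ Finset.Icc 1 M, (1 / (Real.pi * h) : ℝ) * e1 (h * v)).im := by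
  rw [sawSum, Complex.im_sum]
  refine Finset.sum_congr rfl fun h _ => ?_
  rw [Complex.im_ofReal_mul, e1, Complex.exp_ofReal_mul_I_im]
  ring

theorem abs_sum_theta_sub_le {q : ℕ} [NeZero q] (f : ZMod q → ℝ) (hf : ∀ b, |f b| ≤ 1) {M : ℕ}
    (hM : 0 < M) {η u : ℝ} (hu : 0 ≤ u) (h0 : 0 < η) (hη : η ≤ 1 / 2)
    (hd : ∀ k : ℤ, η ≤ |u - k|) :
    |∑ n ∈ Finset.Icc 1 ⌊u⌋₊, f (n : ZMod q) - ((u - 1 / 2) / q * ∑ r : ZMod q, f r +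
      ∑ r : ZMod q, f r * (sawSum M ((u - r.val) / q) - sawSum M ((1 / 2 - r.val) / q)))| ≤
      2 * q ^ 3 / (M * η ^ 2) := by
  have hq : (0 : ℝ) < q := by exact_mod_cast Nat.pos_of_ne_zero (NeZero.ne q)
  have hM0 : (0 : ℝ) < M := by exact_mod_cast hM
  have hfl : ∀ w : ℝ, (∀ k : ℤ, η ≤ |w - k|) → ∀ r : ZMod q,
      |(⌊(w - r.val) / q⌋ : ℝ) - ((w - r.val) / q - 1 / 2 + sawSum M ((w - r.val) / q))| ≤
        q ^ 2 / (M * η ^ 2) := by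
    intro w hw r
    have := abs_floor_sub_fourier_le hM (η := η / q) (v := (w - r.val) / q) (by positivity) (by
      intro k
      have h1 := hw (r.val + k * q)
      have h2 : (w - r.val) / q - k = (w - ((r.val + k * q : ℤ) : ℝ)) / q := by
        push_cast; field_simp; ring
      rw [h2, abs_div, abs_of_pos hq]
      gcongr)
    refine this.trans (le_of_eq ?_)
    field_simp
  have hhalf : ∀ k : ℤ, η ≤ |(1 / 2 : ℝ) - k| := by
    intro k
    refine hη.trans ?_
    rcases le_or_gt k 0 with h | h
    · have : (k : ℝ) ≤ 0 := by exact_mod_cast h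
      rw [abs_of_nonneg (by linarith)]; linarith
    · have : (1 : ℝ) ≤ k := by exact_mod_cast h
      rw [abs_of_nonpos (by linarith)]; linarith
  rw [sum_zmod_fiber, Finset.mul_sum, ← Finset.sum_add_distrib, ← Finset.sum_sub_distrib]
  refine (Finset.abs_sum_le_sum_abs _ _).trans ?_
  have hterm : ∀ r ∈ (Finset.univ : Finset (ZMod q)),
      |f r * (((Finset.Icc 1 ⌊u⌋₊).filter (fun n : ℕ => (n : ZMod q) = r)).card : ℝ) -
        ((u - 1 / 2) / q * f r +
          f r * (sawSum M ((u - r.val) / q) - sawSum M ((1 / 2 - r.val) / q)))| ≤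
      2 * q ^ 2 / (M * η ^ 2) := by
    intro r _
    have hc := congrArg (Int.cast (R := ℝ)) (card_filter_zmod_eq r hu)
    rw [Int.cast_natCast, Int.cast_sub] at hc
    have h1 := hfl u hd r
    have h2 := hfl (1 / 2) hhalf r
    rw [hc]
    set a := (⌊(u - r.val) / q⌋ : ℝ)
    set b := (⌊((1 / 2 : ℝ) - r.val) / q⌋ : ℝ)
    have e : f r * (a - b) - ((u - 1 / 2) / q * f r +
          f r * (sawSum M ((u - r.val) / q) - sawSum M ((1 / 2 - r.val) / q))) =
        f r * ((a - ((u - r.val) / q - 1 / 2 + sawSum M ((u - r.val) / q))) -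
          (b - ((1 / 2 - r.val) / q - 1 / 2 + sawSum M ((1 / 2 - r.val) / q)))) := by
      field_simp; ring
    rw [e, abs_mul]
    calc _ ≤ 1 * (q ^ 2 / (M * η ^ 2) + q ^ 2 / (M * η ^ 2)) := by
          gcongr
          · exact hf r
          · exact (abs_sub _ _).trans (add_le_add h1 h2)
      _ = _ := by ring
  refine (Finset.sum_le_sum hterm).trans (le_of_eq ?_)
  rw [Finset.sum_const, Finset.card_univ, ZMod.card, nsmul_eq_mul]
  ring

theorem e1_div_val {q : ℕ} [NeZero q] (h : ℕ) (r : ZMod q) :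
    e1 (-(h * r.val) / q) = ZMod.stdAddChar (-(h : ZMod q) * r) := by
  have h1 : -(h : ZMod q) * r = ((-(h * r.val : ℤ) : ℤ) : ZMod q) := by
    push_cast; rw [ZMod.natCast_zmod_val, neg_mul]
  rw [h1, ZMod.stdAddChar_coe, e1]
  congr 1
  push_cast
  ring

theorem sum_sawSum_eq {q : ℕ} [NeZero q] (θ : ZMod q → ℝ) (M : ℕ) {n1 : ℕ} (hn1 : n1.Coprime q)
    (n2 : ℕ) (u : ℝ) :
    ∑ r : ZMod q, θ (n1 * n2 * r) * sawSum M ((u - r.val) / q) =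
      (∑ h ∈ Finset.Icc 1 M, (1 / (Real.pi * h) : ℝ) * (e1 (h * (u / q)) *
        ∑ b : ZMod q, θ (b * n2) * ZMod.stdAddChar (b * freqClass q (h, n1)))).im := by
  have hu := ZMod.coe_mul_inv_eq_one n1 hn1
  have hunit : IsUnit (n1 : ZMod q) := IsUnit.of_mul_eq_one _ hu
  have hin : ∀ h : ℕ, ∑ b : ZMod q, (θ (b * n2) : ℂ) * ZMod.stdAddChar (b * freqClass q (h, n1)) =
      ∑ r : ZMod q, (θ (n1 * n2 * r) : ℂ) * e1 (-(h * r.val) / q) := by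
    intro h
    refine (sum_unit_mul (fun b : ZMod q =>
      (θ (b * n2) : ℂ) * ZMod.stdAddChar (b * freqClass q (h, n1))) (n1 : ZMod q) hunit).symm.trans ?_
    refine Finset.sum_congr rfl fun r _ => ?_
    rw [e1_div_val, freqClass]
    congr 2
    · ring_nf
    · calc (n1 : ZMod q) * r * (-(h : ZMod q) * (n1 : ZMod q)⁻¹) =
          -(h : ZMod q) * r * (n1 * (n1 : ZMod q)⁻¹) := by ring
        _ = _ := by rw [hu, mul_one]
  simp_rw [hin, sawSum_eq_im, Complex.im_sum, Complex.im_ofReal_mul, Finset.mul_sum,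
    Complex.im_sum]
  rw [Finset.sum_comm]
  refine Finset.sum_congr rfl fun h _ => ?_
  rw [Finset.mul_sum]
  refine Finset.sum_congr rfl fun r _ => ?_
  have : e1 (h * ((u - r.val) / q)) = e1 (h * (u / q)) * e1 (-(h * r.val) / q) := by
    rw [← e1_add]; congr 1; ring
  rw [this, mul_left_comm (e1 _) (θ _ : ℂ), Complex.im_ofReal_mul]
  ring

/-- one frequency term in the Fourier expansion of a sum over the smoothest variable -/
noncomputable def freqTerm (q : ℕ) [NeZero q] (θ : ZMod q → ℝ) (p : ℕ × ℕ) (n : ℕ) (u : ℝ) : ℂ :=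
  (1 / (Real.pi * p.1) : ℝ) * (e1 (p.1 * (u / q)) *
    ∑ b : ZMod q, (θ (b * n) : ℂ) * ZMod.stdAddChar (b * freqClass q p))

theorem sum_swap_block {q : ℕ} [NeZero q] (θ : ZMod q → ℝ) (P : Finset (ℕ × ℕ))
    (F : ℕ × ℕ → Finset ℕ) (a : ℕ × ℕ → ℂ) (w : ℕ × ℕ → ℕ → ℂ) :
    ∑ p ∈ P, ∑ n ∈ F p, a p * w p n *
        ∑ b : ZMod q, (θ (b * n) : ℂ) * ZMod.stdAddChar (b * freqClass q p) =
      ∑ b : ZMod q, ∑ p ∈ P, a p * ZMod.stdAddChar (b * freqClass q p) *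
        ∑ n ∈ F p, (θ (b * n) : ℂ) * w p n := by
  rw [Finset.sum_comm (s := Finset.univ)]
  refine Finset.sum_congr rfl fun p _ => ?_
  simp_rw [Finset.mul_sum]
  rw [Finset.sum_comm]
  refine Finset.sum_congr rfl fun b _ => ?_
  refine Finset.sum_congr rfl fun n _ => ?_
  ring

theorem norm_freqTerm_box_le {q : ℕ} [NeZero q] {H N1 N2 : ℕ} (hH : 0 < H) (hN1 : 0 < N1)
    (hN2 : 0 < N2) {x α : ℝ} (hx : 0 < x) (hα : 0 ≤ α) (hαx : α ≤ 2 * x)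
    (hN : (N1 : ℝ) ^ 2 * N2 ≤ x) (hbig : (q : ℝ) * N1 * N2 ≤ H * x)
    (θ : ZMod q → ℝ) {Q : ℝ} (hQ0 : 0 < Q)
    (hQ : SegBound θ Q (α / q) (N1 / (32 * H)) N2) {B : ℝ}
    (hD : ∀ m : ℕ, 0 < m → m < 4 * H * N1 → (m.divisors.card : ℝ) ≤ B)
    (hlog : 1 + Real.log (4 * H * N1) ≤ B) (P : Finset (ℕ × ℕ)) (hP : P ⊆ freqBox q H N1)
    (β : ℕ → ℝ) (cut : ℕ → ℕ) (L : ℕ)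
    (hcut : ∀ p ∈ P, cut p.2 < 2 ^ L) (hL : (L : ℝ) ≤ B) :
    ‖∑ p ∈ P, ∑ n ∈ (Finset.Ico N2 (2 * N2)).filter (fun n => n < cut p.2),
      freqTerm q θ p n (β p.2 + α / (p.2 * n))‖ ≤ 30 * B ^ 2 * Real.sqrt (Q * x) := by
  have hq : (0 : ℝ) < q := by exact_mod_cast Nat.pos_of_ne_zero (NeZero.ne q)
  have hH' : (0 : ℝ) < H := by exact_mod_cast hH
  have hN1' : (0 : ℝ) < N1 := by exact_mod_cast hN1
  have hN2' : (0 : ℝ) < N2 := by exact_mod_cast hN2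
  set c : ℕ × ℕ → ℂ := fun p => ((H / (Real.pi * p.1) : ℝ) : ℂ) * e1 (p.1 * (β p.2 / q)) with hc
  have hmem : ∀ p ∈ P, 0 < p.1 ∧ H ≤ p.1 ∧ 0 < p.2 := by
    intro p hp
    have := hP hp
    simp only [freqBox, Finset.mem_filter, Finset.mem_product, Finset.mem_Ico] at this
    omega
  have h := block_le hH hN1 hN2 hx (α := α / q) (by positivity) (by gcongr) hN θ hQ0 hQ hD hlog
    P hP c (by
      intro p hp
      obtain ⟨h0, h1, -⟩ := hmem p hp
      have h0' : (0 : ℝ) < p.1 := by exact_mod_cast h0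
      have h1' : (H : ℝ) ≤ p.1 := by exact_mod_cast h1
      rw [hc]
      simp only [norm_mul, norm_e1, mul_one, Complex.norm_real, Real.norm_eq_abs]
      rw [abs_of_nonneg (by positivity), div_le_one (by positivity)]
      nlinarith [Real.pi_gt_three]) (fun p => cut p.2) L hcut hL
  rw [← sum_swap_block θ P (fun p => (Finset.Ico N2 (2 * N2)).filter (fun n => n < cut p.2)) c
    (fun p n => e1 (freqSlope p * (α / q / n)))] at h
  have heq : ∑ p ∈ P, ∑ n ∈ (Finset.Ico N2 (2 * N2)).filter (fun n => n < cut p.2),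
      freqTerm q θ p n (β p.2 + α / (p.2 * n)) = ((1 / H : ℝ) : ℂ) *
      ∑ p ∈ P, ∑ n ∈ (Finset.Ico N2 (2 * N2)).filter (fun n => n < cut p.2),
        c p * e1 (freqSlope p * (α / q / n)) *
        ∑ b : ZMod q, (θ (b * n) : ℂ) * ZMod.stdAddChar (b * freqClass q p) := by
    rw [Finset.mul_sum]
    refine Finset.sum_congr rfl fun p hp => ?_
    rw [Finset.mul_sum]
    refine Finset.sum_congr rfl fun n hn => ?_
    obtain ⟨h0, -, h2⟩ := hmem p hp
    have h0' : (0 : ℝ) < p.1 := by exact_mod_cast h0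
    have h2' : (0 : ℝ) < p.2 := by exact_mod_cast h2
    have hn' : (0 : ℝ) < n := by
      exact_mod_cast lt_of_lt_of_le hN2 (Finset.mem_Ico.mp (Finset.mem_filter.mp hn).1).1
    have e2 : e1 (p.1 * ((β p.2 + α / (p.2 * n)) / q)) =
        e1 (p.1 * (β p.2 / q)) * e1 (freqSlope p * (α / q / n)) := by
      rw [← e1_add, freqSlope]; congr 1; field_simp
    have e3 : ((1 / (Real.pi * p.1) : ℝ) : ℂ) =
        ((1 / H : ℝ) : ℂ) * ((H / (Real.pi * p.1) : ℝ) : ℂ) := by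
      rw [← Complex.ofReal_mul]; congr 1; field_simp
    rw [freqTerm, e2, e3, hc]
    ring
  rw [heq, norm_mul, Complex.norm_real, Real.norm_eq_abs, abs_of_nonneg (by positivity)]
  have hT : q * Q * H * N1 * N2 * (1 + H * x / (q * N1 * N2)) ≤ (3 / 2 * H) ^ 2 * (Q * x) := by
    have e4 : q * Q * H * N1 * N2 * (1 + H * x / (q * N1 * N2)) =
        Q * H * (q * N1 * N2 + H * x) := by field_simp
    rw [e4]
    have : Q * H * (q * N1 * N2 + H * x) ≤ Q * H * (H * x + H * x) := by gcongr
    nlinarith [mul_pos (mul_pos hQ0 hx) (mul_pos hH' hH')]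
  have hsq : Real.sqrt (q * Q * H * N1 * N2 * (1 + H * x / (q * N1 * N2))) ≤
      3 / 2 * H * Real.sqrt (Q * x) := by
    refine (Real.sqrt_le_sqrt hT).trans (le_of_eq ?_)
    rw [Real.sqrt_mul (by positivity), Real.sqrt_sq (by positivity)]
  calc _ ≤ 1 / H * (20 * B ^ 2 * (3 / 2 * H * Real.sqrt (Q * x))) := by gcongr; exact h.trans (by gcongr)
    _ = _ := by field_simp; ring

/-- Bound for sums of integrals with variable upper limit. -/
theorem norm_sum_integral_le {ι : Type*} (I : Finset ι) (f : ι → ℝ → ℂ)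
    (hf : ∀ i ∈ I, Continuous (f i)) (u : ι → ℝ) {a b K : ℝ} (hab : a ≤ b)
    (hu : ∀ i ∈ I, a ≤ u i ∧ u i ≤ b)
    (hK : ∀ s, a ≤ s → s ≤ b → ‖∑ i ∈ I.filter (fun i => s ≤ u i), f i s‖ ≤ K) :
    ‖∑ i ∈ I, ∫ s in a..u i, f i s‖ ≤ K * (b - a) := by
  classical
  have h1 : ∑ i ∈ I, ∫ s in a..u i, f i s =
      ∫ s in a..b, ∑ i ∈ I.filter (fun i => s ≤ u i), f i s := by
    have h2 : ∀ i ∈ I, IntervalIntegrable ({s | s ≤ u i}.indicator (f i)) MeasureTheory.volume a b := by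
      intro i hi
      rw [intervalIntegrable_iff]
      exact ((intervalIntegrable_iff.mp ((hf i hi).intervalIntegrable a b)).indicator
        measurableSet_Iic)
    calc _ = ∑ i ∈ I, ∫ s in a..b, {s | s ≤ u i}.indicator (f i) s :=
          Finset.sum_congr rfl fun i hi => (intervalIntegral.integral_indicator (hu i hi)).symm
      _ = ∫ s in a..b, ∑ i ∈ I, {s | s ≤ u i}.indicator (f i) s :=
          (intervalIntegral.integral_finsetSum h2).symm
      _ = _ := by
          congr 1; ext s
          rw [Finset.sum_filter]
          refine Finset.sum_congr rfl fun i _ => ?_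
          rw [Set.indicator_apply]; rfl
  rw [h1]
  have := intervalIntegral.norm_integral_le_of_norm_le_const (a := a) (b := b) (C := K)
    (f := fun s => ∑ i ∈ I.filter (fun i => s ≤ u i), f i s) (by
      intro s hs
      rw [Set.uIoc_of_le hab] at hs
      exact hK s hs.1.le hs.2)
  rwa [abs_of_nonneg (by linarith)] at this

theorem exists_cut_of_antitone (p : ℕ → Prop) (hp : ∀ m n, m ≤ n → p n → p m) (B : ℕ) :
    ∃ c ≤ B, ∀ n < B, p n ↔ n < c := by
  classical
  by_cases h : ∃ n < B, ¬ p n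
  · refine ⟨Nat.find h, (Nat.find_spec h).1.le, fun n hn => ⟨fun hpn => ?_, fun hlt => ?_⟩⟩
    · by_contra! hle
      exact (Nat.find_spec h).2 (hp _ _ hle hpn)
    · by_contra hpn
      exact Nat.find_min h hlt ⟨hn, hpn⟩
  · push Not at h
    exact ⟨B, le_rfl, fun n hn => ⟨fun _ => hn, fun _ => h n hn⟩⟩

theorem integral_e1 (h : ℝ) (a b : ℝ) :
    ∫ s in a..b, (2 * Real.pi * h * Complex.I : ℂ) * e1 (h * s) = e1 (h * b) - e1 (h * a) := by
  apply intervalIntegral.integral_eq_sub_of_hasDerivAt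
  · intro s _
    unfold e1
    have h1 : HasDerivAt (fun s : ℝ => (((2 * Real.pi * (h * s) : ℝ) : ℂ) * Complex.I))
        (((2 * Real.pi * (h * 1) : ℝ) : ℂ) * Complex.I) s :=
      (((hasDerivAt_id s).const_mul h).const_mul (2 * Real.pi)).ofReal_comp.mul_const _
    refine h1.cexp.congr_deriv ?_
    push_cast; ring
  · apply Continuous.intervalIntegrable
    have := continuous_e1_mul h
    fun_prop

theorem norm_freqTerm_sub_box_le {q : ℕ} [NeZero q] {H N1 N2 : ℕ} (hH : 0 < H) (hN1 : 0 < N1)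
    (hN2 : 0 < N2) {x : ℝ} (hx : 0 < x)
    (hN : (N1 : ℝ) ^ 2 * N2 ≤ x) (hsmall : H * x ≤ (q : ℝ) * N1 * N2)
    (θ : ZMod q → ℝ) {Q : ℝ} (hQ0 : 0 < Q)
    (hQ : SegBound θ Q 0 (N1 / (32 * H)) N2) {B : ℝ}
    (hD : ∀ m : ℕ, 0 < m → m < 4 * H * N1 → (m.divisors.card : ℝ) ≤ B)
    (hlog : 1 + Real.log (4 * H * N1) ≤ B) (P : Finset (ℕ × ℕ)) (hP : P ⊆ freqBox q H N1)
    (u : ℕ → ℕ → ℝ) (cut : ℕ → ℕ) (L : ℕ)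
    (hanti : ∀ n1 m n, 0 < m → m ≤ n → u n1 n ≤ u n1 m)
    (hu : ∀ p ∈ P, ∀ n ∈ (Finset.Ico N2 (2 * N2)).filter (fun n => n < cut p.2),
      1 / 2 ≤ u p.2 n ∧ u p.2 n ≤ 2 * x / (N1 * N2))
    (hcut : ∀ p ∈ P, cut p.2 < 2 ^ L) (hL : (L : ℝ) ≤ B) :
    ‖∑ p ∈ P, ∑ n ∈ (Finset.Ico N2 (2 * N2)).filter (fun n => n < cut p.2),
      (freqTerm q θ p n (u p.2 n) - freqTerm q θ p n (1 / 2))‖ ≤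
      120 * B ^ 2 * Real.sqrt (Q * x) := by
  classical
  have hq : (0 : ℝ) < q := by exact_mod_cast Nat.pos_of_ne_zero (NeZero.ne q)
  have hH' : (0 : ℝ) < H := by exact_mod_cast hH
  have hN1' : (0 : ℝ) < N1 := by exact_mod_cast hN1
  have hN2' : (0 : ℝ) < N2 := by exact_mod_cast hN2
  have hN11 : (1 : ℝ) ≤ N1 := by exact_mod_cast hN1
  set F : ℕ × ℕ → Finset ℕ := fun p => (Finset.Ico N2 (2 * N2)).filter (fun n => n < cut p.2)
    with hF
  set G : ℕ × ℕ → ℕ → ℂ := fun p n =>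
    ∑ b : ZMod q, (θ (b * n) : ℂ) * ZMod.stdAddChar (b * freqClass q p) with hG
  set b0 := 2 * x / (N1 * N2) with hb0
  have hab : 1 / 2 ≤ b0 := by
    rw [hb0, div_le_div_iff₀ (by norm_num) (by positivity)]
    nlinarith [mul_pos hN1' hN2']
  set f : (Σ _ : ℕ × ℕ, ℕ) → ℝ → ℂ := fun i s =>
    (2 * Complex.I / q : ℂ) * e1 ((i.1.1 / q : ℝ) * s) * G i.1 i.2 with hf
  have hmem : ∀ p ∈ P, 0 < p.1 := by
    intro p hp
    have := hP hp
    simp only [freqBox, Finset.mem_filter, Finset.mem_product, Finset.mem_Ico] at this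
    omega
  have hsum : ∑ p ∈ P, ∑ n ∈ F p, (freqTerm q θ p n (u p.2 n) - freqTerm q θ p n (1 / 2)) =
      ∑ i ∈ P.sigma F, ∫ s in (1 / 2 : ℝ)..(u i.1.2 i.2), f i s := by
    rw [Finset.sum_sigma]
    refine Finset.sum_congr rfl fun p hp => Finset.sum_congr rfl fun n _ => ?_
    have h0 : (p.1 : ℂ) ≠ 0 := by exact_mod_cast (hmem p hp).ne'
    have hq0 : (q : ℂ) ≠ 0 := by exact_mod_cast NeZero.ne q
    have hpi : (Real.pi : ℂ) ≠ 0 := by exact_mod_cast Real.pi_ne_zero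
    have h1 : ∀ s, f ⟨p, n⟩ s = ((1 / (Real.pi * p.1) : ℝ) * G p n) *
        ((2 * Real.pi * (p.1 / q : ℝ) * Complex.I : ℂ) * e1 ((p.1 / q : ℝ) * s)) := by
      intro s
      simp only [hf]
      push_cast
      field_simp
    simp_rw [h1]
    rw [intervalIntegral.integral_const_mul, integral_e1]
    simp only [freqTerm]
    rw [show (p.1 : ℝ) * (u p.2 n / q) = p.1 / q * u p.2 n by ring,
      show (p.1 : ℝ) * (1 / 2 / q) = p.1 / q * (1 / 2) by ring]
    ring
  have hbound : 2 / q * (20 * B ^ 2 *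
      Real.sqrt (q * Q * H * N1 * N2 * (1 + H * x / (q * N1 * N2)))) * b0 ≤
      120 * B ^ 2 * Real.sqrt (Q * x) := by
    have hT : q * Q * H * N1 * N2 * (1 + H * x / (q * N1 * N2)) ≤
        (3 / 2 * (q * N1 * N2 / x)) ^ 2 * (Q * x) := by
      have e4 : q * Q * H * N1 * N2 * (1 + H * x / (q * N1 * N2)) =
          Q * H * (q * N1 * N2 + H * x) := by field_simp
      have e5 : (3 / 2 * (q * N1 * N2 / x)) ^ 2 * (Q * x) =
          9 / 4 * Q * (q * N1 * N2) ^ 2 / x := by field_simp; ring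
      rw [e4, e5, le_div_iff₀ hx]
      set Y := (q : ℝ) * N1 * N2
      have hY : 0 < Y := by positivity
      calc Q * H * (Y + H * x) * x = Q * (H * x) * (Y + H * x) := by ring
        _ ≤ Q * Y * (Y + Y) := by gcongr
        _ ≤ _ := by nlinarith [mul_pos hQ0 (mul_pos hY hY)]
    have hsq : Real.sqrt (q * Q * H * N1 * N2 * (1 + H * x / (q * N1 * N2))) ≤
        3 / 2 * (q * N1 * N2 / x) * Real.sqrt (Q * x) := by
      refine (Real.sqrt_le_sqrt hT).trans (le_of_eq ?_)
      rw [Real.sqrt_mul (by positivity), Real.sqrt_sq (by positivity)]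
    calc _ ≤ 2 / q * (20 * B ^ 2 * (3 / 2 * (q * N1 * N2 / x) * Real.sqrt (Q * x))) * b0 := by
          gcongr
      _ = _ := by rw [hb0]; field_simp; ring
  rw [hsum]
  refine (norm_sum_integral_le _ f ?_ (fun i => u i.1.2 i.2) hab ?_ (K := 2 / q * (20 * B ^ 2 *
    Real.sqrt (q * Q * H * N1 * N2 * (1 + H * x / (q * N1 * N2))))) ?_).trans
    (le_trans ?_ hbound)
  · intro i _
    have := continuous_e1_mul (i.1.1 / q : ℝ)
    simp only [hf]
    fun_prop
  · intro i hi
    rw [Finset.mem_sigma] at hi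
    exact hu _ hi.1 _ hi.2
  · intro s _ _
    have hex : ∀ p : ℕ × ℕ, ∃ c ≤ cut p.2, ∀ n < cut p.2, (n = 0 ∨ s ≤ u p.2 n) ↔ n < c := by
      intro p
      apply exists_cut_of_antitone
      intro m n hmn hn
      rcases Nat.eq_zero_or_pos m with h | h
      · exact Or.inl h
      · right
        rcases hn with h' | h'
        · omega
        · exact h'.trans (hanti _ _ _ h hmn)
    choose c hc hc' using hex
    have hfilt : ∀ p, (F p).filter (fun n => s ≤ u p.2 n) =
        (Finset.Ico N2 (2 * N2)).filter (fun n => n < c p) := by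
      intro p
      ext n
      simp only [hF, Finset.mem_filter, Finset.mem_Ico]
      constructor
      · rintro ⟨⟨h1, h2⟩, h3⟩
        exact ⟨h1, (hc' p n h2).mp (Or.inr h3)⟩
      · rintro ⟨h1, h2⟩
        have h3 := lt_of_lt_of_le h2 (hc p)
        exact ⟨⟨h1, h3⟩, ((hc' p n h3).mpr h2).resolve_left (by omega)⟩
    have h := block_le hH hN1 hN2 hx (α := 0) le_rfl (by positivity) hN θ hQ0 hQ hD hlog
      P hP (fun p => e1 ((p.1 / q : ℝ) * s)) (fun p _ => (norm_e1 _).le) c L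
      (fun p hp => lt_of_le_of_lt (hc p) (hcut p hp)) hL
    rw [← sum_swap_block θ P (fun p => (Finset.Ico N2 (2 * N2)).filter (fun n => n < c p))
      (fun p => e1 ((p.1 / q : ℝ) * s)) (fun p n => e1 (freqSlope p * (0 / n)))] at h
    have heq : ∑ i ∈ (P.sigma F).filter (fun i => s ≤ u i.1.2 i.2), f i s = (2 * Complex.I / q) *
        ∑ p ∈ P, ∑ n ∈ (Finset.Ico N2 (2 * N2)).filter (fun n => n < c p),
          e1 ((p.1 / q : ℝ) * s) * e1 (freqSlope p * (0 / n)) *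
          ∑ b : ZMod q, (θ (b * n) : ℂ) * ZMod.stdAddChar (b * freqClass q p) := by
      rw [Finset.sum_filter, Finset.sum_sigma, Finset.mul_sum]
      refine Finset.sum_congr rfl fun p _ => ?_
      rw [← Finset.sum_filter, hfilt, Finset.mul_sum]
      refine Finset.sum_congr rfl fun n _ => ?_
      simp only [hf, zero_div, mul_zero, e1_zero, mul_one, hG]
      ring
    rw [heq, norm_mul]
    have h2 : ‖(2 * Complex.I / q : ℂ)‖ = 2 / q := by simp
    rw [h2]
    gcongr
  · gcongr
    linarith

theorem sum_dyadic {E : Type*} [AddCommMonoid E] (f : ℕ → E) (L : ℕ) :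
    ∑ n ∈ Finset.Ico 1 (2 ^ L), f n =
      ∑ i ∈ Finset.range L, ∑ n ∈ Finset.Ico (2 ^ i) (2 * 2 ^ i), f n := by
  induction L with
  | zero => simp
  | succ L ih =>
    rw [Finset.sum_range_succ, ← ih, pow_succ, mul_comm (2 ^ L) 2]
    exact (Finset.sum_Ico_consecutive f Nat.one_le_two_pow (by omega)).symm

/-- the part of a frequency box with bounded modulus variable -/
def freqBoxLe (q H N1 Z : ℕ) : Finset (ℕ × ℕ) := (freqBox q H N1).filter (fun p => p.2 ≤ Z)

theorem sum_Icc_dyadic {E : Type*} [AddCommMonoid E] (q Z J L : ℕ) (hZ : Z < 2 ^ L) (c : ℕ → ℕ)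
    (hc : ∀ n1 ∈ Finset.Icc 1 Z, c n1 < 2 ^ L) (T : ℕ × ℕ → ℕ → E) :
    ∑ n1 ∈ (Finset.Icc 1 Z).filter (fun n => n.Coprime q), ∑ n2 ∈ Finset.Icc 1 (c n1),
        ∑ h ∈ Finset.Ico 1 (2 ^ J), T (h, n1) n2 =
      ∑ k ∈ Finset.range J, ∑ i ∈ Finset.range L, ∑ j ∈ Finset.range L,
        ∑ p ∈ freqBoxLe q (2 ^ k) (2 ^ i) Z,
          ∑ n ∈ (Finset.Ico (2 ^ j) (2 * 2 ^ j)).filter (fun n => n < c p.2 + 1), T p n := by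
  have h1 : (Finset.Icc 1 Z).filter (fun n => n.Coprime q) =
      (Finset.Ico 1 (2 ^ L)).filter (fun n => n.Coprime q ∧ n ≤ Z) := by
    ext n; simp only [Finset.mem_filter, Finset.mem_Icc, Finset.mem_Ico]
    constructor
    · rintro ⟨⟨h1, h2⟩, h3⟩; exact ⟨⟨h1, by omega⟩, h3, h2⟩
    · rintro ⟨⟨h1, h2⟩, h3, h4⟩; exact ⟨⟨h1, h4⟩, h3⟩
  have h2 : ∀ n1 ∈ (Finset.Icc 1 Z).filter (fun n => n.Coprime q),
      ∑ n2 ∈ Finset.Icc 1 (c n1), ∑ h ∈ Finset.Ico 1 (2 ^ J), T (h, n1) n2 =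
      ∑ k ∈ Finset.range J, ∑ j ∈ Finset.range L, ∑ h ∈ Finset.Ico (2 ^ k) (2 * 2 ^ k),
        ∑ n ∈ (Finset.Ico (2 ^ j) (2 * 2 ^ j)).filter (fun n => n < c n1 + 1), T (h, n1) n := by
    intro n1 hn1
    have hcn := hc n1 (Finset.mem_filter.mp hn1).1
    have h3 : Finset.Icc 1 (c n1) = (Finset.Ico 1 (2 ^ L)).filter (fun n => n < c n1 + 1) := by
      ext n; simp only [Finset.mem_filter, Finset.mem_Icc, Finset.mem_Ico]; omega
    rw [Finset.sum_comm, sum_dyadic]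
    refine Finset.sum_congr rfl fun k _ => ?_
    rw [Finset.sum_comm (s := Finset.range L)]
    refine Finset.sum_congr rfl fun h _ => ?_
    rw [h3, Finset.sum_filter, sum_dyadic]
    simp_rw [Finset.sum_filter]
  rw [Finset.sum_congr rfl h2, Finset.sum_comm]
  refine Finset.sum_congr rfl fun k _ => ?_
  rw [h1, Finset.sum_filter, sum_dyadic]
  refine Finset.sum_congr rfl fun i _ => ?_
  rw [← Finset.sum_filter, Finset.sum_comm]
  refine Finset.sum_congr rfl fun j _ => ?_
  rw [Finset.sum_comm, freqBoxLe, freqBox, Finset.filter_filter, Finset.sum_filter,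
    Finset.sum_product]
  refine Finset.sum_congr rfl fun h _ => ?_
  rw [Finset.sum_filter]

theorem abs_sum_sub_le_of_box {q : ℕ} [NeZero q] (θ : ZMod q → ℝ) (hθ1 : ∀ b, |θ b| ≤ 1)
    (hθ0 : ∀ b, ¬ IsUnit b → θ b = 0) (Z J L : ℕ) (hJ : 0 < J) (hZ : Z < 2 ^ L) (c : ℕ → ℕ)
    (hc : ∀ n1 ∈ Finset.Icc 1 Z, c n1 < 2 ^ L) (u : ℕ → ℕ → ℝ) {η K : ℝ} (h0 : 0 < η)
    (hη : η ≤ 1 / 2) (hu : ∀ n1 ∈ Finset.Icc 1 Z, ∀ n2 ∈ Finset.Icc 1 (c n1),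
      0 ≤ u n1 n2 ∧ ∀ k : ℤ, η ≤ |u n1 n2 - k|)
    (hbox : ∀ k < J, ∀ i < L, ∀ j < L, |(∑ p ∈ freqBoxLe q (2 ^ k) (2 ^ i) Z,
          ∑ n ∈ (Finset.Ico (2 ^ j) (2 * 2 ^ j)).filter (fun n => n < c p.2 + 1),
          (freqTerm q θ p n (u p.2 n) - freqTerm q θ p n (1 / 2))).im| ≤ K) :
    |∑ n1 ∈ Finset.Icc 1 Z, ∑ n2 ∈ Finset.Icc 1 (c n1),
      (∑ n3 ∈ Finset.Icc 1 ⌊u n1 n2⌋₊, θ ((n1 * n2 * n3 : ℕ) : ZMod q) -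
        (u n1 n2 - 1 / 2) / q * ∑ r : ZMod q, θ (n1 * n2 * r))| ≤
      J * (L * (L * K)) + 2 ^ L * (2 ^ L * (2 * q ^ 3 / ((2 ^ J - 1) * η ^ 2))) := by
  classical
  have hM : 0 < 2 ^ J - 1 := by
    have : 2 ^ 1 ≤ 2 ^ J := Nat.pow_le_pow_right (by norm_num) hJ
    omega
  set E : ℝ := 2 * q ^ 3 / ((2 ^ J - 1) * η ^ 2) with hE
  have hM' : ((2 ^ J - 1 : ℕ) : ℝ) = 2 ^ J - 1 := by
    rw [Nat.cast_sub Nat.one_le_two_pow]; push_cast; ring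
  have hM1 : (0 : ℝ) < 2 ^ J - 1 := by rw [← hM']; exact_mod_cast hM
  have hE0 : 0 ≤ E := by positivity
  set T : ℕ × ℕ → ℕ → ℝ := fun p n =>
    (freqTerm q θ p n (u p.2 n) - freqTerm q θ p n (1 / 2)).im with hT
  have hnonunit : ∀ n1 : ℕ, ¬ n1.Coprime q → ∀ r : ZMod q, θ (n1 * r) = 0 := by
    intro n1 hn1 r
    apply hθ0
    intro h
    exact hn1 ((ZMod.isUnit_iff_coprime n1 q).mp (isUnit_of_mul_isUnit_left h))
  have hred : ∑ n1 ∈ Finset.Icc 1 Z, ∑ n2 ∈ Finset.Icc 1 (c n1),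
      (∑ n3 ∈ Finset.Icc 1 ⌊u n1 n2⌋₊, θ ((n1 * n2 * n3 : ℕ) : ZMod q) -
        (u n1 n2 - 1 / 2) / q * ∑ r : ZMod q, θ (n1 * n2 * r)) =
      ∑ n1 ∈ (Finset.Icc 1 Z).filter (fun n => n.Coprime q), ∑ n2 ∈ Finset.Icc 1 (c n1),
      (∑ n3 ∈ Finset.Icc 1 ⌊u n1 n2⌋₊, θ ((n1 * n2 * n3 : ℕ) : ZMod q) -
        (u n1 n2 - 1 / 2) / q * ∑ r : ZMod q, θ (n1 * n2 * r)) := by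
    rw [Finset.sum_filter]
    refine Finset.sum_congr rfl fun n1 _ => ?_
    split_ifs with h
    · rfl
    · refine Finset.sum_eq_zero fun n2 _ => ?_
      rw [Finset.sum_eq_zero, Finset.sum_eq_zero, mul_zero, sub_zero]
      · intro r _; rw [mul_assoc]; exact hnonunit n1 h _
      · intro n3 _; push_cast; rw [mul_assoc]; exact hnonunit n1 h _
  rw [hred]
  have hpt : ∀ n1 ∈ (Finset.Icc 1 Z).filter (fun n => n.Coprime q), ∀ n2 ∈ Finset.Icc 1 (c n1),
      |(∑ n3 ∈ Finset.Icc 1 ⌊u n1 n2⌋₊, θ ((n1 * n2 * n3 : ℕ) : ZMod q) -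
        (u n1 n2 - 1 / 2) / q * ∑ r : ZMod q, θ (n1 * n2 * r)) -
        ∑ h ∈ Finset.Ico 1 (2 ^ J), T (h, n1) n2| ≤ E := by
    intro n1 hn1 n2 hn2
    rw [Finset.mem_filter] at hn1
    have h1 := abs_sum_theta_sub_le (fun r : ZMod q => θ (n1 * n2 * r)) (fun b => hθ1 _) hM
      (hu n1 hn1.1 n2 hn2).1 h0 hη (hu n1 hn1.1 n2 hn2).2
    have h2 : ∑ r : ZMod q, θ (n1 * n2 * r) *
        (sawSum (2 ^ J - 1) ((u n1 n2 - r.val) / q) - sawSum (2 ^ J - 1) ((1 / 2 - r.val) / q)) =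
        ∑ h ∈ Finset.Ico 1 (2 ^ J), T (h, n1) n2 := by
      have hI : Finset.Ico 1 (2 ^ J) = Finset.Icc 1 (2 ^ J - 1) := by
        ext n; simp only [Finset.mem_Icc, Finset.mem_Ico]; omega
      simp_rw [mul_sub]
      rw [Finset.sum_sub_distrib, sum_sawSum_eq θ _ hn1.2, sum_sawSum_eq θ _ hn1.2, hI,
        ← Complex.sub_im, ← Finset.sum_sub_distrib, Complex.im_sum]
      rfl
    rw [h2, hM'] at h1
    rw [sub_sub]
    convert h1 using 4
    push_cast
    rfl
  set A : ℕ → ℕ → ℝ := fun n1 n2 => (∑ n3 ∈ Finset.Icc 1 ⌊u n1 n2⌋₊, θ ((n1 * n2 * n3 : ℕ) : ZMod q) -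
        (u n1 n2 - 1 / 2) / q * ∑ r : ZMod q, θ (n1 * n2 * r)) with hA
  have hdy := sum_Icc_dyadic q Z J L hZ c hc T
  have hTb : |∑ n1 ∈ (Finset.Icc 1 Z).filter (fun n => n.Coprime q), ∑ n2 ∈ Finset.Icc 1 (c n1),
        ∑ h ∈ Finset.Ico 1 (2 ^ J), T (h, n1) n2| ≤ J * (L * (L * K)) := by
    rw [hdy]
    calc _ ≤ ∑ k ∈ Finset.range J, ∑ i ∈ Finset.range L, ∑ j ∈ Finset.range L, K := by
          refine (Finset.abs_sum_le_sum_abs _ _).trans (Finset.sum_le_sum fun k hk => ?_)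
          refine (Finset.abs_sum_le_sum_abs _ _).trans (Finset.sum_le_sum fun i hi => ?_)
          refine (Finset.abs_sum_le_sum_abs _ _).trans (Finset.sum_le_sum fun j hj => ?_)
          have := hbox k (Finset.mem_range.mp hk) i (Finset.mem_range.mp hi) j
            (Finset.mem_range.mp hj)
          rw [Complex.im_sum] at this
          simp_rw [Complex.im_sum] at this
          exact this
      _ = _ := by simp
  have herr : |∑ n1 ∈ (Finset.Icc 1 Z).filter (fun n => n.Coprime q), ∑ n2 ∈ Finset.Icc 1 (c n1),
      (A n1 n2 - ∑ h ∈ Finset.Ico 1 (2 ^ J), T (h, n1) n2)| ≤ 2 ^ L * (2 ^ L * E) := by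
    have hcardle : (((Finset.Icc 1 Z).filter (fun n => n.Coprime q)).card : ℝ) ≤ 2 ^ L := by
      have h1 : ((Finset.Icc 1 Z).filter (fun n => n.Coprime q)).card ≤ 2 ^ L := by
        refine (Finset.card_filter_le _ _).trans ?_
        rw [Nat.card_Icc]; omega
      exact_mod_cast h1
    calc _ ≤ ∑ n1 ∈ (Finset.Icc 1 Z).filter (fun n => n.Coprime q), 2 ^ L * E := by
          refine (Finset.abs_sum_le_sum_abs _ _).trans (Finset.sum_le_sum fun n1 hn1 => ?_)
          calc _ ≤ ∑ n2 ∈ Finset.Icc 1 (c n1), E :=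
                (Finset.abs_sum_le_sum_abs _ _).trans
                  (Finset.sum_le_sum fun n2 hn2 => hpt n1 hn1 n2 hn2)
            _ = (c n1 : ℝ) * E := by simp
            _ ≤ _ := by
                gcongr
                exact_mod_cast (hc n1 (Finset.mem_filter.mp hn1).1).le
      _ = _ * (2 ^ L * E) := by rw [Finset.sum_const, nsmul_eq_mul]
      _ ≤ _ := by gcongr
  simp_rw [Finset.sum_sub_distrib (f := fun n2 => A _ n2)] at herr
  rw [Finset.sum_sub_distrib] at herr
  have := abs_le.mp herr
  have := abs_le.mp hTb
  rw [abs_le]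
  constructor <;> linarith

/-- A region `n₁ ≤ Z`, `n₂ ≤ c(n₁)` below a hyperbola-type function
`u(n₁,n₂) = β(n₁) + α/(n₁n₂)` that stays away from the integers. -/
structure HypRegion (x : ℝ) (Z : ℕ) (c : ℕ → ℕ) (β : ℕ → ℝ) (α : ℝ) : Prop where
  one_le : 1 ≤ x
  nonneg : 0 ≤ α
  le_two_mul : α ≤ 2 * x
  left : ∀ n1 ∈ Finset.Icc 1 Z, ∀ n2 ∈ Finset.Icc 1 (c n1), (n1 : ℝ) ^ 2 * n2 ≤ x
  right : ∀ n1 ∈ Finset.Icc 1 Z, ∀ n2 ∈ Finset.Icc 1 (c n1), (n1 : ℝ) * n2 ^ 2 ≤ x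
  half_le : ∀ n1 ∈ Finset.Icc 1 Z, ∀ n2 ∈ Finset.Icc 1 (c n1), 1 / 2 ≤ β n1 + α / (n1 * n2)
  upper : ∀ n1 ∈ Finset.Icc 1 Z, ∀ n2 ∈ Finset.Icc 1 (c n1),
    (β n1 + α / (n1 * n2)) * (n1 * n2) ≤ 2 * x
  gap : ∀ n1 ∈ Finset.Icc 1 Z, ∀ n2 ∈ Finset.Icc 1 (c n1), ∀ k : ℤ,
    1 / (2 * x) ≤ |β n1 + α / (n1 * n2) - k|

/-- `B` dominates the divisor counts and logarithms that occur up to the level `2 ^ J * 2 ^ L`. -/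
structure LevelBound (B : ℝ) (J L : ℕ) : Prop where
  tau : ∀ m : ℕ, 0 < m → m < 4 * 2 ^ J * 2 ^ L → (m.divisors.card : ℝ) ≤ B
  log : 1 + Real.log (4 * 2 ^ J * 2 ^ L) ≤ B
  len : (L : ℝ) ≤ B
  lenJ : (J : ℝ) ≤ B

section

variable {q : ℕ} {x : ℝ} {Z : ℕ} {c : ℕ → ℕ} {β : ℕ → ℝ} {α : ℝ}

theorem HypRegion.box_cases (h : HypRegion x Z c β α) {H N1 N2 : ℕ} (T : ℕ × ℕ → ℕ → ℂ) :
    (∑ p ∈ freqBoxLe q H N1 Z,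
      ∑ n ∈ (Finset.Ico N2 (2 * N2)).filter (fun n => n < c p.2 + 1), T p n = 0) ∨
    ((N1 : ℝ) ^ 2 * N2 ≤ x ∧ (N1 : ℝ) * N2 ^ 2 ≤ x) ∨ N1 = 0 ∨ N2 = 0 := by
  by_contra! hcon
  obtain ⟨h1, h2, h3, h4⟩ := hcon
  obtain ⟨p, hp, hp0⟩ := Finset.exists_ne_zero_of_sum_ne_zero h1
  obtain ⟨n, hn, -⟩ := Finset.exists_ne_zero_of_sum_ne_zero hp0
  simp only [freqBoxLe, freqBox, Finset.mem_filter, Finset.mem_product, Finset.mem_Ico] at hp hn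
  have hp2 : p.2 ∈ Finset.Icc 1 Z := by simp only [Finset.mem_Icc]; omega
  have hn2 : n ∈ Finset.Icc 1 (c p.2) := by simp only [Finset.mem_Icc]; omega
  have hl := h.left _ hp2 _ hn2
  have hr := h.right _ hp2 _ hn2
  have e1 : (N1 : ℝ) ≤ p.2 := by exact_mod_cast hp.1.1.2.1
  have e2 : (N2 : ℝ) ≤ n := by exact_mod_cast hn.1.1
  have a : (N1 : ℝ) ^ 2 * N2 ≤ x := le_trans (by gcongr) hl
  have b : (N1 : ℝ) * N2 ^ 2 ≤ x := le_trans (by gcongr) hr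
  exact absurd b (not_le.mpr (h2 a))

theorem LevelBound.tau_box {B : ℝ} {J L : ℕ} (hB : LevelBound B J L) {k i : ℕ} (hk : k < J)
    (hi : i < L) (m : ℕ) (h0 : 0 < m) (hm : m < 4 * 2 ^ k * 2 ^ i) : (m.divisors.card : ℝ) ≤ B := by
  refine hB.tau m h0 (lt_of_lt_of_le hm ?_)
  gcongr <;> norm_num

theorem LevelBound.log_box {B : ℝ} {J L : ℕ} (hB : LevelBound B J L) {k i : ℕ} (hk : k < J)
    (hi : i < L) : 1 + Real.log (4 * (2 ^ k : ℕ) * (2 ^ i : ℕ)) ≤ B := by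
  refine le_trans ?_ hB.log
  push_cast
  gcongr <;> norm_num

theorem norm_box_le [NeZero q] (h : HypRegion x Z c β α) (θ : ZMod q → ℝ) (hθ1 : ∀ b, |θ b| ≤ 1)
    (hθ0 : ∀ b, ¬ IsUnit b → θ b = 0) (hθs : ∑ b, θ b = 0) (hQ : 0 < (q : ℝ) * pvConst q)
    {B : ℝ} {J L : ℕ} (hB : LevelBound B J L) (hc : ∀ n1 ∈ Finset.Icc 1 Z, c n1 + 1 < 2 ^ L)
    {k i j : ℕ} (hk : k < J) (hi : i < L) :
    ‖∑ p ∈ freqBoxLe q (2 ^ k) (2 ^ i) Z,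
          ∑ n ∈ (Finset.Ico (2 ^ j) (2 * 2 ^ j)).filter (fun n => n < c p.2 + 1),
          (freqTerm q θ p n (β p.2 + α / (p.2 * n)) - freqTerm q θ p n (1 / 2))‖ ≤
      120 * B ^ 2 * Real.sqrt (q * pvConst q * x) := by
  have hx := h.one_le
  rcases h.box_cases (q := q) (H := 2 ^ k) (N1 := 2 ^ i) (N2 := 2 ^ j)
    (fun p n => freqTerm q θ p n (β p.2 + α / (p.2 * n)) - freqTerm q θ p n (1 / 2)) with h0 | h0
  · rw [h0, norm_zero]; positivity
  have hN := h0.resolve_right (by simp)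
  have hsub : freqBoxLe q (2 ^ k) (2 ^ i) Z ⊆ freqBox q (2 ^ k) (2 ^ i) := Finset.filter_subset _ _
  have hmem : ∀ p ∈ freqBoxLe q (2 ^ k) (2 ^ i) Z, p.2 ∈ Finset.Icc 1 Z ∧ 2 ^ i ≤ p.2 := by
    intro p hp
    simp only [freqBoxLe, freqBox, Finset.mem_filter, Finset.mem_product, Finset.mem_Ico] at hp
    have : 0 < 2 ^ i := by positivity
    simp only [Finset.mem_Icc]; omega
  have hcut : ∀ p ∈ freqBoxLe q (2 ^ k) (2 ^ i) Z, c p.2 + 1 < 2 ^ L :=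
    fun p hp => hc _ (hmem p hp).1
  rcases le_total ((q : ℝ) * (2 ^ i : ℕ) * (2 ^ j : ℕ)) ((2 ^ k : ℕ) * x) with hbig | hsmall
  · simp_rw [Finset.sum_sub_distrib]
    have a := norm_freqTerm_box_le (by positivity) (by positivity) (by positivity) (by linarith)
      h.nonneg h.le_two_mul hN.1 hbig θ hQ
      (segBound_pv θ hθ1 hθ0 hθs (by have := h.nonneg; positivity) _ (by positivity))
      (hB.tau_box hk hi) (hB.log_box hk hi) _ hsub β (fun n => c n + 1) L hcut hB.len
    have b := norm_freqTerm_box_le (by positivity) (by positivity) (by positivity) (by linarith)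
      le_rfl (by linarith) hN.1 hbig θ hQ
      (segBound_pv θ hθ1 hθ0 hθs (by simp) _ (by positivity))
      (hB.tau_box hk hi) (hB.log_box hk hi) _ hsub (fun _ => 1 / 2) (fun n => c n + 1) L hcut hB.len
    simp only [zero_div, add_zero] at b
    refine (norm_sub_le _ _).trans ?_
    have : 0 ≤ B ^ 2 * Real.sqrt (q * pvConst q * x) := by positivity
    linarith
  · exact norm_freqTerm_sub_box_le (by positivity) (by positivity) (by positivity) (by linarith)
      hN.1 hsmall θ hQ (segBound_pv θ hθ1 hθ0 hθs le_rfl _ (by positivity))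
      (hB.tau_box hk hi) (hB.log_box hk hi) _ hsub (fun n1 n2 => β n1 + α / (n1 * n2))
      (fun n => c n + 1) L (by
        intro n1 m n hm hmn
        have hα := h.nonneg
        rcases Nat.eq_zero_or_pos n1 with rfl | hn1
        · simp
        · have : (0 : ℝ) < m := by exact_mod_cast hm
          have : (0 : ℝ) < n1 := by exact_mod_cast hn1
          have : (m : ℝ) ≤ n := by exact_mod_cast hmn
          gcongr) (by
        intro p hp n hn
        obtain ⟨h1, h1'⟩ := hmem p hp
        simp only [Finset.mem_filter, Finset.mem_Ico] at hn
        have hj : 0 < 2 ^ j := by positivity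
        have h2 : n ∈ Finset.Icc 1 (c p.2) := by simp only [Finset.mem_Icc]; omega
        refine ⟨h.half_le _ h1 _ h2, ?_⟩
        have h3 := h.upper _ h1 _ h2
        rw [le_div_iff₀ (by positivity)]
        refine le_trans ?_ h3
        have : 0 ≤ β p.2 + α / (p.2 * n) := by linarith [h.half_le _ h1 _ h2]
        have e1 : ((2 ^ i : ℕ) : ℝ) ≤ p.2 := by exact_mod_cast h1'
        have e2 : ((2 ^ j : ℕ) : ℝ) ≤ n := by exact_mod_cast hn.1.1
        gcongr) hcut hB.len

theorem abs_sum_theta_le [NeZero q] (h : HypRegion x Z c β α) (θ : ZMod q → ℝ) (hθ1 : ∀ b, |θ b| ≤ 1)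
    (hθ0 : ∀ b, ¬ IsUnit b → θ b = 0) (hθs : ∑ b, θ b = 0) (hQ : 0 < (q : ℝ) * pvConst q)
    {B : ℝ} {J L : ℕ} (hJ : 0 < J) (hB : LevelBound B J L) (hZ : Z < 2 ^ L)
    (hc : ∀ n1 ∈ Finset.Icc 1 Z, c n1 + 1 < 2 ^ L) :
    |∑ n1 ∈ Finset.Icc 1 Z, ∑ n2 ∈ Finset.Icc 1 (c n1),
      ∑ n3 ∈ Finset.Icc 1 ⌊β n1 + α / (n1 * n2)⌋₊, θ ((n1 * n2 * n3 : ℕ) : ZMod q)| ≤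
    120 * B ^ 5 * Real.sqrt (q * pvConst q * x) + 8 * q ^ 3 * x ^ 2 * 4 ^ L / (2 ^ J - 1) := by
  have hx := h.one_le
  have h1 := abs_sum_sub_le_of_box θ hθ1 hθ0 Z J L hJ hZ c
    (fun n hn => (Nat.lt_succ_self _).trans (hc n hn)) (fun n1 n2 => β n1 + α / (n1 * n2))
    (η := 1 / (2 * x)) (by positivity) (by
      rw [div_le_div_iff₀ (by positivity) (by positivity)]; linarith)
    (fun n1 h1 n2 h2 => ⟨by linarith [h.half_le n1 h1 n2 h2], h.gap n1 h1 n2 h2⟩)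
    (fun k hk i hi j _ => (Complex.abs_im_le_norm _).trans
      (norm_box_le h θ hθ1 hθ0 hθs hQ hB hc hk hi))
  have h2 : ∀ n1 n2 : ℕ, ∑ r : ZMod q, θ (n1 * n2 * r) = 0 := by
    intro n1 n2
    by_cases hu : IsUnit ((n1 : ZMod q) * n2)
    · rw [sum_unit_mul θ _ hu, hθs]
    · refine Finset.sum_eq_zero fun r _ => hθ0 _ fun hr => hu (isUnit_of_mul_isUnit_left hr)
  simp_rw [h2, mul_zero, sub_zero] at h1
  refine h1.trans ?_
  have hJ1 : (1 : ℝ) < 2 ^ J := one_lt_pow₀ (by norm_num) hJ.ne'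
  have hJ2 : (0 : ℝ) < 2 ^ J - 1 := by linarith
  have hB0 : 0 ≤ B := le_trans (Nat.cast_nonneg _) hB.len
  refine add_le_add ?_ (le_of_eq ?_)
  · calc (J : ℝ) * (L * (L * (120 * B ^ 2 * Real.sqrt (q * pvConst q * x))))
        ≤ B * (B * (B * (120 * B ^ 2 * Real.sqrt (q * pvConst q * x)))) := by
          have := hB.len; have := hB.lenJ
          gcongr
      _ = _ := by ring
  · have : (4 : ℝ) ^ L = 2 ^ L * 2 ^ L := by rw [← mul_pow]; norm_num
    rw [this]
    field_simp
    ring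

theorem abs_sum_floor_sub_le (h : HypRegion x Z c (fun _ => 0) (x + 1 / 2))
    {B : ℝ} {J L : ℕ} (hJ : 0 < J) (hB : LevelBound B J L) (hZ : Z < 2 ^ L)
    (hc : ∀ n1 ∈ Finset.Icc 1 Z, c n1 + 1 < 2 ^ L) :
    |∑ n1 ∈ Finset.Icc 1 Z, ∑ n2 ∈ Finset.Icc 1 (c n1),
      ((⌊(x + 1 / 2) / (n1 * n2)⌋₊ : ℝ) - (x + 1 / 2) / (n1 * n2) + 1 / 2)| ≤
    30 * B ^ 5 * Real.sqrt (2 * x) + 8 * x ^ 2 * 4 ^ L / (2 ^ J - 1) := by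
  have hx := h.one_le
  have hbox : ∀ k < J, ∀ i < L, ∀ j < L, |(∑ p ∈ freqBoxLe 1 (2 ^ k) (2 ^ i) Z,
          ∑ n ∈ (Finset.Ico (2 ^ j) (2 * 2 ^ j)).filter (fun n => n < c p.2 + 1),
          (freqTerm 1 (fun _ => 1) p n ((fun n1 n2 : ℕ => 0 + (x + 1 / 2) / (n1 * n2)) p.2 n) -
            freqTerm 1 (fun _ => 1) p n (1 / 2))).im| ≤ 30 * B ^ 2 * Real.sqrt (2 * x) := by
    intro k hk i hi j hj
    have him : ∀ (p : ℕ × ℕ) (n : ℕ), (freqTerm 1 (fun _ => 1) p n (1 / 2)).im = 0 := by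
      intro p n
      have h1 : e1 (p.1 * (1 / 2 / (1 : ℕ))) = ((-1 : ℝ) : ℂ) ^ p.1 := by
        have : ((2 * Real.pi * (p.1 * (1 / 2 / (1 : ℕ))) : ℝ) : ℂ) * Complex.I =
            (p.1 : ℂ) * (Real.pi * Complex.I) := by push_cast; ring
        rw [e1, this, Complex.exp_nat_mul, Complex.exp_pi_mul_I]; norm_num
      have h2 : ∀ b : ZMod 1, b = 0 := fun b => Subsingleton.elim _ _
      unfold freqTerm
      rw [h1]
      have : ∀ b : ZMod 1, (((1 : ℝ) : ℂ)) * ZMod.stdAddChar (b * freqClass 1 p) = 1 := by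
        intro b; rw [h2 (b * _)]; simp
      simp_rw [this]
      simp only [← Complex.ofReal_pow, Finset.sum_const, nsmul_eq_mul]
      norm_cast
    have hre : (∑ p ∈ freqBoxLe 1 (2 ^ k) (2 ^ i) Z,
          ∑ n ∈ (Finset.Ico (2 ^ j) (2 * 2 ^ j)).filter (fun n => n < c p.2 + 1),
          (freqTerm 1 (fun _ => 1) p n ((fun n1 n2 : ℕ => 0 + (x + 1 / 2) / (n1 * n2)) p.2 n) -
            freqTerm 1 (fun _ => 1) p n (1 / 2))).im = (∑ p ∈ freqBoxLe 1 (2 ^ k) (2 ^ i) Z,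
          ∑ n ∈ (Finset.Ico (2 ^ j) (2 * 2 ^ j)).filter (fun n => n < c p.2 + 1),
          freqTerm 1 (fun _ => 1) p n ((fun _ => (0 : ℝ)) p.2 + (x + 1 / 2) / (p.2 * n))).im := by
      simp_rw [Complex.im_sum, Complex.sub_im, him, sub_zero]
    rw [hre]
    refine (Complex.abs_im_le_norm _).trans ?_
    rcases h.box_cases (q := 1) (H := 2 ^ k) (N1 := 2 ^ i) (N2 := 2 ^ j)
      (fun p n => freqTerm 1 (fun _ => 1) p n ((fun _ => (0 : ℝ)) p.2 + (x + 1 / 2) / (p.2 * n)))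
      with h0 | h0
    · rw [h0, norm_zero]; positivity
    have hN := h0.resolve_right (by simp)
    have hsub : freqBoxLe 1 (2 ^ k) (2 ^ i) Z ⊆ freqBox 1 (2 ^ k) (2 ^ i) :=
      Finset.filter_subset _ _
    have hcut : ∀ p ∈ freqBoxLe 1 (2 ^ k) (2 ^ i) Z, c p.2 + 1 < 2 ^ L := by
      intro p hp
      simp only [freqBoxLe, freqBox, Finset.mem_filter, Finset.mem_product, Finset.mem_Ico] at hp
      have : 0 < 2 ^ i := by positivity
      refine hc _ ?_
      simp only [Finset.mem_Icc]; omega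
    have hk1 : (1 : ℝ) ≤ (2 ^ k : ℕ) := by exact_mod_cast Nat.one_le_two_pow
    have hi1 : (1 : ℝ) ≤ (2 ^ i : ℕ) := by exact_mod_cast Nat.one_le_two_pow
    have hj1 : (1 : ℝ) ≤ (2 ^ j : ℕ) := by exact_mod_cast Nat.one_le_two_pow
    refine norm_freqTerm_box_le (by positivity) (by positivity) (by positivity) (by linarith)
      h.nonneg h.le_two_mul hN.1 ?_ (fun _ => 1) (by norm_num) (segBound_one (by positivity) ?_)
      (hB.tau_box hk hi) (hB.log_box hk hi) _ hsub (fun _ => 0) (fun n => c n + 1) L hcut hB.len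
    · have : ((1 : ℕ) : ℝ) * (2 ^ i : ℕ) * (2 ^ j : ℕ) ≤ x := by
        refine le_trans ?_ hN.1
        rw [Nat.cast_one, one_mul]
        gcongr
        nlinarith
      nlinarith
    · have h3 : 8 * (((2 ^ i : ℕ) : ℝ) / (32 * (2 ^ k : ℕ))) * ((2 ^ j : ℕ) : ℝ) ^ 2 =
          ((2 ^ i : ℕ) : ℝ) * ((2 ^ j : ℕ) : ℝ) ^ 2 / (4 * (2 ^ k : ℕ)) := by
        field_simp; norm_num
      rw [h3, div_lt_iff₀ (by positivity), Nat.cast_one, div_one]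
      have := hN.2
      nlinarith
  have h1 := abs_sum_sub_le_of_box (q := 1) (fun _ => 1) (by simp)
    (fun b hb => absurd (isUnit_of_subsingleton b) hb) Z J L hJ hZ c
    (fun n hn => (Nat.lt_succ_self _).trans (hc n hn))
    (fun n1 n2 => 0 + (x + 1 / 2) / (n1 * n2))
    (η := 1 / (2 * x)) (by positivity) (by
      rw [div_le_div_iff₀ (by positivity) (by positivity)]; linarith)
    (fun n1 h1 n2 h2 => ⟨by linarith [h.half_le n1 h1 n2 h2], h.gap n1 h1 n2 h2⟩) hbox
  have hJ1 : (1 : ℝ) < 2 ^ J := one_lt_pow₀ (by norm_num) hJ.ne'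
  have hJ2 : (0 : ℝ) < 2 ^ J - 1 := by linarith
  have hB0 : 0 ≤ B := le_trans (Nat.cast_nonneg _) hB.len
  have hE : ∑ n1 ∈ Finset.Icc 1 Z, ∑ n2 ∈ Finset.Icc 1 (c n1),
      ((⌊(x + 1 / 2) / ((n1 : ℝ) * n2)⌋₊ : ℝ) - (x + 1 / 2) / (n1 * n2) + 1 / 2) =
      ∑ n1 ∈ Finset.Icc 1 Z, ∑ n2 ∈ Finset.Icc 1 (c n1),
      (∑ n3 ∈ Finset.Icc 1 ⌊0 + (x + 1 / 2) / ((n1 : ℝ) * n2)⌋₊, (fun _ : ZMod 1 => (1 : ℝ)) ((n1 * n2 * n3 : ℕ) : ZMod 1) -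
        ((0 + (x + 1 / 2) / ((n1 : ℝ) * n2)) - 1 / 2) / (1 : ℕ) * ∑ r : ZMod 1, (fun _ => (1 : ℝ)) (n1 * n2 * r)) := by
    refine Finset.sum_congr rfl fun n1 _ => Finset.sum_congr rfl fun n2 _ => ?_
    simp
    ring
  rw [hE]
  refine h1.trans ?_
  refine add_le_add ?_ (le_of_eq ?_)
  · calc (J : ℝ) * (L * (L * (30 * B ^ 2 * Real.sqrt (2 * x))))
        ≤ B * (B * (B * (30 * B ^ 2 * Real.sqrt (2 * x)))) := by
          have := hB.len; have := hB.lenJ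
          gcongr
      _ = _ := by ring
  · have : (4 : ℝ) ^ L = 2 ^ L * 2 ^ L := by rw [← mul_pow]; norm_num
    rw [this]
    field_simp
    norm_num

end

/-- sum over the triples `abc ≤ x` satisfying a condition -/
noncomputable def tripleSum (f : ℕ → ℝ) (x : ℕ) (P : ℕ → ℕ → ℕ → Prop) : ℝ := by
  classical
  exact ∑ a ∈ Finset.Icc 1 x, ∑ b ∈ Finset.Icc 1 x, ∑ c ∈ Finset.Icc 1 x,
    if a * b * c ≤ x ∧ P a b c then f (a * b * c) else 0

theorem tripleSum_swap (f : ℕ → ℝ) (x : ℕ) (P : ℕ → ℕ → ℕ → Prop) :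
    tripleSum f x P = tripleSum f x (fun a b c => P b a c) := by
  unfold tripleSum
  rw [Finset.sum_comm]
  refine Finset.sum_congr rfl fun a _ => Finset.sum_congr rfl fun b _ =>
    Finset.sum_congr rfl fun c _ => ?_
  rw [mul_comm b a]

theorem tripleSum_swap' (f : ℕ → ℝ) (x : ℕ) (P : ℕ → ℕ → ℕ → Prop) :
    tripleSum f x P = tripleSum f x (fun a b c => P a c b) := by
  unfold tripleSum
  refine Finset.sum_congr rfl fun a _ => ?_
  rw [Finset.sum_comm]
  refine Finset.sum_congr rfl fun b _ => Finset.sum_congr rfl fun c _ => ?_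
  rw [mul_right_comm]

theorem sum_d3_mul (f : ℕ → ℝ) (x : ℕ) :
    ∑ n ∈ Finset.Icc 1 x, (d3 n : ℝ) * f n = tripleSum f x (fun _ _ _ => True) := by
  classical
  set B := Finset.Icc 1 x ×ˢ Finset.Icc 1 x ×ˢ Finset.Icc 1 x with hB
  have h1 : ∀ n ∈ Finset.Icc 1 x, (d3 n : ℝ) * f n =
      ∑ p ∈ B, if p.1 * p.2.1 * p.2.2 = n then f n else 0 := by
    intro n hn
    rw [← Finset.sum_filter, Finset.sum_const, nsmul_eq_mul]
    congr 2
    unfold d3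
    congr 1
    ext ⟨a, b, c⟩
    simp only [Finset.mem_filter, Finset.mem_product, Finset.mem_Icc, hB] at hn ⊢
    constructor
    · rintro ⟨h, h'⟩
      exact ⟨by omega, h'⟩
    · rintro ⟨h, h'⟩
      have ha : a ∣ n := ⟨b * c, by rw [← h']; ring⟩
      have hb : b ∣ n := ⟨a * c, by rw [← h']; ring⟩
      have hc : c ∣ n := ⟨a * b, by rw [← h']; ring⟩
      have := Nat.le_of_dvd (by omega) ha
      have := Nat.le_of_dvd (by omega) hb
      have := Nat.le_of_dvd (by omega) hc
      exact ⟨by omega, h'⟩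
  rw [Finset.sum_congr rfl h1, Finset.sum_comm, hB, Finset.sum_product]
  unfold tripleSum
  refine Finset.sum_congr rfl fun a ha => ?_
  rw [Finset.sum_product]
  refine Finset.sum_congr rfl fun b hb => Finset.sum_congr rfl fun c hc => ?_
  simp only [and_true]
  rw [Finset.sum_ite_eq]
  simp only [Finset.mem_Icc] at *
  have : 1 ≤ a * b * c := Nat.mul_pos (Nat.mul_pos (by omega) (by omega)) (by omega)
  simp [this]

theorem sum_Icc_le_eq {m x : ℕ} (h : m ≤ x) (g : ℕ → ℝ) :
    ∑ n ∈ Finset.Icc 1 m, g n = ∑ n ∈ Finset.Icc 1 x, if n ≤ m then g n else 0 := by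
  rw [← Finset.sum_filter]
  congr 1
  ext n
  simp only [Finset.mem_filter, Finset.mem_Icc]; omega

theorem tripleSum_two (f : ℕ → ℝ) {x Z : ℕ} (c : ℕ → ℕ) (hZ : Z ≤ x) (hc : ∀ a, c a ≤ x) :
    tripleSum f x (fun a b _ => a ≤ Z ∧ b ≤ c a) =
      ∑ n1 ∈ Finset.Icc 1 Z, ∑ n2 ∈ Finset.Icc 1 (c n1),
        ∑ n3 ∈ Finset.Icc 1 (x / (n1 * n2)), f (n1 * n2 * n3) := by
  unfold tripleSum
  rw [sum_Icc_le_eq hZ]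
  refine Finset.sum_congr rfl fun a ha => ?_
  split_ifs with haZ
  · rw [sum_Icc_le_eq (hc a)]
    refine Finset.sum_congr rfl fun b hb => ?_
    split_ifs with hbc
    · rw [sum_Icc_le_eq (Nat.div_le_self x _)]
      refine Finset.sum_congr rfl fun n hn => ?_
      simp only [Finset.mem_Icc] at *
      have h1 : 0 < a * b := Nat.mul_pos (by omega) (by omega)
      have h2 : n ≤ x / (a * b) ↔ a * b * n ≤ x := by
        rw [Nat.le_div_iff_mul_le h1, mul_comm]
      simp [h2, haZ, hbc]
    · refine Finset.sum_eq_zero fun n _ => ?_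
      simp [hbc]
  · refine Finset.sum_eq_zero fun b _ => Finset.sum_eq_zero fun n _ => ?_
    simp [haZ]

theorem tripleSum_three (f : ℕ → ℝ) {x Z : ℕ} (c κ : ℕ → ℕ) (hZ : Z ≤ x) (hc : ∀ a, c a ≤ x)
    (hκ : ∀ a, κ a ≤ x) (h : ∀ a ≤ Z, a * c a * κ a ≤ x) :
    tripleSum f x (fun a b n => a ≤ Z ∧ b ≤ c a ∧ n ≤ κ a) =
      ∑ n1 ∈ Finset.Icc 1 Z, ∑ n2 ∈ Finset.Icc 1 (c n1),
        ∑ n3 ∈ Finset.Icc 1 (κ n1), f (n1 * n2 * n3) := by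
  unfold tripleSum
  rw [sum_Icc_le_eq hZ]
  refine Finset.sum_congr rfl fun a ha => ?_
  split_ifs with haZ
  · rw [sum_Icc_le_eq (hc a)]
    refine Finset.sum_congr rfl fun b hb => ?_
    split_ifs with hbc
    · rw [sum_Icc_le_eq (hκ a)]
      refine Finset.sum_congr rfl fun n hn => ?_
      by_cases hn : n ≤ κ a
      · have : a * b * n ≤ x := le_trans (by gcongr) (h a haZ)
        simp [this, haZ, hbc, hn]
      · simp [hn]
    · refine Finset.sum_eq_zero fun n _ => ?_
      simp [hbc]
  · refine Finset.sum_eq_zero fun b _ => Finset.sum_eq_zero fun n _ => ?_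
    simp [haZ]

/-- the hyperbola method for `d₃` -/
theorem sum_d3_eq (f : ℕ → ℝ) {x Z : ℕ} (hZ : Z ^ 3 ≤ x) (hZ' : x < (Z + 1) ^ 3) :
    ∑ n ∈ Finset.Icc 1 x, (d3 n : ℝ) * f n =
      3 * (2 * ∑ n1 ∈ Finset.Icc 1 Z, ∑ n2 ∈ Finset.Icc 1 (Nat.sqrt (x / n1)),
            ∑ n3 ∈ Finset.Icc 1 (x / (n1 * n2)), f (n1 * n2 * n3) -
          ∑ n1 ∈ Finset.Icc 1 Z, ∑ n2 ∈ Finset.Icc 1 (Nat.sqrt (x / n1)),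
            ∑ n3 ∈ Finset.Icc 1 (Nat.sqrt (x / n1)), f (n1 * n2 * n3)) -
        3 * ∑ n1 ∈ Finset.Icc 1 Z, ∑ n2 ∈ Finset.Icc 1 Z,
            ∑ n3 ∈ Finset.Icc 1 (x / (n1 * n2)), f (n1 * n2 * n3) +
        ∑ n1 ∈ Finset.Icc 1 Z, ∑ n2 ∈ Finset.Icc 1 Z,
            ∑ n3 ∈ Finset.Icc 1 Z, f (n1 * n2 * n3) := by
  classical
  have hZx : Z ≤ x := le_trans (Nat.le_self_pow (by norm_num) Z) hZ
  have hs : ∀ a, Nat.sqrt (x / a) ≤ x := fun a => (Nat.sqrt_le_self _).trans (Nat.div_le_self _ _)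
  have hss : ∀ a ≤ Z, a * Nat.sqrt (x / a) * Nat.sqrt (x / a) ≤ x := by
    intro a _
    rw [mul_assoc]
    exact (Nat.mul_le_mul_left _ (Nat.sqrt_le _)).trans (Nat.mul_div_le x a)
  rw [sum_d3_mul, ← tripleSum_two f (fun n => Nat.sqrt (x / n)) hZx hs,
    ← tripleSum_two f (fun _ => Z) hZx (fun _ => hZx),
    ← tripleSum_three f (fun n => Nat.sqrt (x / n)) (fun n => Nat.sqrt (x / n)) hZx hs hs hss,
    ← tripleSum_three f (fun _ => Z) (fun _ => Z) hZx (fun _ => hZx) (fun _ => hZx)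
      (fun a ha => le_trans (by rw [pow_three']; gcongr) hZ)]
  have e1 : tripleSum f x (fun _ _ _ => True) =
      tripleSum f x (fun a _ _ => a ≤ Z) + tripleSum f x (fun _ b _ => b ≤ Z) +
      tripleSum f x (fun _ _ c => c ≤ Z) - tripleSum f x (fun a b _ => a ≤ Z ∧ b ≤ Z) -
      tripleSum f x (fun a _ c => a ≤ Z ∧ c ≤ Z) - tripleSum f x (fun _ b c => b ≤ Z ∧ c ≤ Z) +
      tripleSum f x (fun a b c => a ≤ Z ∧ b ≤ Z ∧ c ≤ Z) := by
    unfold tripleSum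
    simp only [← Finset.sum_add_distrib, ← Finset.sum_sub_distrib]
    refine Finset.sum_congr rfl fun a _ => Finset.sum_congr rfl fun b _ =>
      Finset.sum_congr rfl fun c _ => ?_
    by_cases h : a * b * c ≤ x
    · have : a ≤ Z ∨ b ≤ Z ∨ c ≤ Z := by
        by_contra! hcon
        have : (Z + 1) ^ 3 ≤ a * b * c := by
          rw [pow_three']; gcongr <;> omega
        omega
      by_cases ha : a ≤ Z <;> by_cases hb : b ≤ Z <;> by_cases hc : c ≤ Z <;>
        first | (exfalso; tauto) | (simp only [h, ha, hb, hc, and_self, and_true, and_false, if_true, if_false]; ring)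
    · simp [h]
  have e2 : tripleSum f x (fun a _ _ => a ≤ Z) =
      tripleSum f x (fun a b _ => a ≤ Z ∧ b ≤ Nat.sqrt (x / a)) +
      tripleSum f x (fun a _ c => a ≤ Z ∧ c ≤ Nat.sqrt (x / a)) -
      tripleSum f x (fun a b c => a ≤ Z ∧ b ≤ Nat.sqrt (x / a) ∧ c ≤ Nat.sqrt (x / a)) := by
    unfold tripleSum
    simp only [← Finset.sum_add_distrib, ← Finset.sum_sub_distrib]
    refine Finset.sum_congr rfl fun a ha1 => Finset.sum_congr rfl fun b _ =>
      Finset.sum_congr rfl fun c _ => ?_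
    by_cases h : a * b * c ≤ x
    · have : b ≤ Nat.sqrt (x / a) ∨ c ≤ Nat.sqrt (x / a) := by
        by_contra! hcon
        have h1 : x / a < b * c := lt_of_lt_of_le (Nat.lt_succ_sqrt (x / a))
          (Nat.mul_le_mul hcon.1 hcon.2)
        rw [Nat.div_lt_iff_lt_mul (Finset.mem_Icc.mp ha1).1] at h1
        have : b * c * a = a * b * c := by ring
        omega
      by_cases ha : a ≤ Z <;> by_cases hb : b ≤ Nat.sqrt (x / a) <;>
        by_cases hc : c ≤ Nat.sqrt (x / a) <;>
        first | (exfalso; tauto) | (simp only [h, ha, hb, hc, and_self, and_true, and_false, if_true, if_false]; ring)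
    · simp [h]
  have s1 := tripleSum_swap f x (fun _ b _ => b ≤ Z)
  have s2 := tripleSum_swap' f x (fun _ _ c => c ≤ Z)
  have s3 := tripleSum_swap' f x (fun a _ c => a ≤ Z ∧ c ≤ Z)
  have s4 := tripleSum_swap f x (fun _ b c => b ≤ Z ∧ c ≤ Z)
  have s5 := tripleSum_swap' f x (fun a _ c => a ≤ Z ∧ c ≤ Nat.sqrt (x / a))
  rw [e1, s4, s3, s2, s1, e2, s5]
  ring

theorem d3_le_sq (n : ℕ) : d3 n ≤ n.divisors.card ^ 2 := by
  classical
  rcases Nat.eq_zero_or_pos n with rfl | hn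
  · simp [d3]
  rw [sq, ← Finset.card_product]
  unfold d3
  refine Finset.card_le_card_of_injOn (fun p => (p.1, p.2.1)) ?_ ?_
  · rintro ⟨a, b, c⟩ h
    simp only [Finset.coe_filter, Set.mem_ofPred_eq, Finset.coe_product, Set.mem_prod,
      Finset.mem_coe, Nat.mem_divisors] at h ⊢
    exact ⟨⟨⟨b * c, by rw [← h.2]; ring⟩, hn.ne'⟩, ⟨⟨a * c, by rw [← h.2]; ring⟩, hn.ne'⟩⟩
  · rintro ⟨a, b, c⟩ h ⟨a', b', c'⟩ h' heq
    simp only [Finset.coe_filter, Set.mem_ofPred_eq, Finset.mem_product, Finset.mem_Icc] at h h'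
    simp only [Prod.mk.injEq] at heq
    obtain ⟨rfl, rfl⟩ := heq
    have : a * b * c = a * b * c' := by rw [h.2, h'.2]
    have := Nat.eq_of_mul_eq_mul_left (Nat.mul_pos (by omega) (by omega)) this
    rw [this]

theorem d3_le_rpow {ε : ℝ} (hε : 0 < ε) : ∃ C : ℝ, 1 ≤ C ∧ ∀ n : ℕ, (d3 n : ℝ) ≤ C * (n : ℝ) ^ ε := by
  obtain ⟨C, hC, h⟩ := card_divisors_le_rpow (half_pos hε)
  refine ⟨C ^ 2, one_le_pow₀ hC, fun n => ?_⟩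
  rcases Nat.eq_zero_or_pos n with rfl | hn
  · simp [d3, hε.ne']
  calc (d3 n : ℝ) ≤ (n.divisors.card : ℝ) ^ 2 := by exact_mod_cast d3_le_sq n
    _ ≤ (C * (n : ℝ) ^ (ε / 2)) ^ 2 := by gcongr; exact h n hn.ne'
    _ = C ^ 2 * (n : ℝ) ^ ε := by
      rw [mul_pow, ← Real.rpow_natCast ((n : ℝ) ^ (ε / 2)), ← Real.rpow_mul (by positivity)]
      norm_num

theorem hypRegion_one {x Z : ℕ} {c : ℕ → ℕ} (hx : 1 ≤ x)
    (hl : ∀ n1 ∈ Finset.Icc 1 Z, n1 ^ 2 * c n1 ≤ x) (hr : ∀ n1 ∈ Finset.Icc 1 Z, n1 * c n1 ^ 2 ≤ x) :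
    HypRegion x Z c (fun _ => 0) (x + 1 / 2) := by
  have hx' : (1 : ℝ) ≤ x := by exact_mod_cast hx
  have hl' : ∀ n1 ∈ Finset.Icc 1 Z, ∀ n2 ∈ Finset.Icc 1 (c n1), n1 ^ 2 * n2 ≤ x := fun n1 h1 n2 h2 =>
    le_trans (Nat.mul_le_mul_left _ (Finset.mem_Icc.mp h2).2) (hl n1 h1)
  have hm : ∀ n1 ∈ Finset.Icc 1 Z, ∀ n2 ∈ Finset.Icc 1 (c n1), 0 < n1 * n2 ∧ n1 * n2 ≤ x := by
    intro n1 h1 n2 h2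
    have := hl' n1 h1 n2 h2
    simp only [Finset.mem_Icc] at h1 h2
    refine ⟨Nat.mul_pos (by omega) (by omega), le_trans ?_ this⟩
    gcongr; exact Nat.le_self_pow (by norm_num) _
  refine ⟨hx', by positivity, by linarith, ?_, ?_, ?_, ?_, ?_⟩
  · intro n1 h1 n2 h2; exact_mod_cast hl' n1 h1 n2 h2
  · intro n1 h1 n2 h2
    have : n1 * n2 ^ 2 ≤ x := le_trans (by gcongr; exact (Finset.mem_Icc.mp h2).2) (hr n1 h1)
    exact_mod_cast this
  · intro n1 h1 n2 h2
    obtain ⟨a, b⟩ := hm n1 h1 n2 h2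
    have a' : (0 : ℝ) < n1 * n2 := by exact_mod_cast a
    have b' : (n1 : ℝ) * n2 ≤ x := by exact_mod_cast b
    rw [zero_add, div_le_div_iff₀ (by norm_num) a']; linarith
  · intro n1 h1 n2 h2
    have a' : (0 : ℝ) < n1 * n2 := by exact_mod_cast (hm n1 h1 n2 h2).1
    rw [zero_add, div_mul_cancel₀ _ a'.ne']; linarith
  · intro n1 h1 n2 h2 k
    obtain ⟨a, b⟩ := hm n1 h1 n2 h2
    have a' : (0 : ℝ) < n1 * n2 := by exact_mod_cast a
    have b' : (n1 : ℝ) * n2 ≤ x := by exact_mod_cast b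
    have h3 : (0 : ℝ) + (x + 1 / 2) / (n1 * n2) - k =
        ((2 * x + 1 - 2 * (n1 * n2) * k : ℤ) : ℝ) / (2 * (n1 * n2)) := by
      rw [eq_div_iff (by positivity), sub_mul, zero_add, div_mul_eq_mul_div, mul_comm 2 ((n1 : ℝ) * n2),
        ← mul_assoc, mul_div_right_comm, mul_div_assoc _ ((n1 : ℝ) * n2), div_self a'.ne']
      push_cast; ring
    have h4 : (1 : ℝ) ≤ |((2 * x + 1 - 2 * (n1 * n2) * k : ℤ) : ℝ)| := by
      rw [← Int.cast_abs]
      have : (1 : ℤ) ≤ |2 * (x : ℤ) + 1 - 2 * (n1 * n2) * k| := by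
        refine Int.one_le_abs fun h => ?_
        have h5 : 2 * ((n1 * n2) * k - (x : ℤ)) = 1 := by linarith
        omega
      exact_mod_cast this
    rw [h3, abs_div, abs_of_pos (by positivity : (0 : ℝ) < 2 * (n1 * n2))]
    gcongr

theorem hypRegion_two {x Z : ℕ} {c κ : ℕ → ℕ} (hx : 1 ≤ x)
    (hl : ∀ n1 ∈ Finset.Icc 1 Z, n1 ^ 2 * c n1 ≤ x) (hr : ∀ n1 ∈ Finset.Icc 1 Z, n1 * c n1 ^ 2 ≤ x)
    (hκ : ∀ n1 ∈ Finset.Icc 1 Z, n1 * c n1 * κ n1 ≤ x) :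
    HypRegion x Z c (fun n => κ n + 1 / 2) 0 := by
  have hx' : (1 : ℝ) ≤ x := by exact_mod_cast hx
  have h1 := hypRegion_one hx hl hr
  refine ⟨hx', le_rfl, by linarith, h1.left, h1.right, ?_, ?_, ?_⟩
  · intro n1 h1 n2 h2
    simp
  · intro n1 g1 n2 g2
    have a := h1.left n1 g1 n2 g2
    have b : n1 * n2 * κ n1 ≤ x := le_trans (by gcongr; exact (Finset.mem_Icc.mp g2).2) (hκ n1 g1)
    have b' : (n1 : ℝ) * n2 * κ n1 ≤ x := by exact_mod_cast b
    have c1 : (1 : ℝ) ≤ n1 := by exact_mod_cast (Finset.mem_Icc.mp g1).1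
    have c2 : (1 : ℝ) ≤ n2 := by exact_mod_cast (Finset.mem_Icc.mp g2).1
    have : (n1 : ℝ) * n2 ≤ n1 ^ 2 * n2 := by gcongr; nlinarith
    rw [zero_div, add_zero]
    nlinarith
  · intro n1 g1 n2 g2 k
    rw [zero_div, add_zero]
    have h3 : (κ n1 : ℝ) + 1 / 2 - k = ((2 * κ n1 + 1 - 2 * k : ℤ) : ℝ) / 2 := by
      push_cast; ring
    have h4 : (1 : ℝ) ≤ |((2 * κ n1 + 1 - 2 * k : ℤ) : ℝ)| := by
      rw [← Int.cast_abs]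
      have : (1 : ℤ) ≤ |2 * (κ n1 : ℤ) + 1 - 2 * k| := Int.one_le_abs (by omega)
      exact_mod_cast this
    rw [h3, abs_div, abs_of_pos (by positivity : (0 : ℝ) < 2)]
    rw [div_le_div_iff₀ (by positivity) (by positivity)]
    nlinarith

theorem exists_levelBound {ε : ℝ} (hε : 0 < ε) : ∃ C : ℝ, 1 ≤ C ∧ ∀ x : ℕ, 1 ≤ x →
    ∃ J L : ℕ, 0 < J ∧ x + 1 < 2 ^ L ∧ (4 : ℝ) ^ L ≤ 36 * x ^ 2 ∧ (1000 * x ^ 7 : ℝ) ≤ 2 ^ J - 1 ∧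
      LevelBound (C * (x : ℝ) ^ ε) J L := by
  obtain ⟨C0, hC0, h⟩ := card_divisors_le_rpow (ε := ε / 8) (by positivity)
  set C1 := C0 + 2 * (1 + 8 / ε) with hC1
  have hC11 : 1 ≤ C1 := by have : 0 ≤ 8 / ε := by positivity
                           linarith
  have h40 : (1 : ℝ) ≤ 4096 ^ (ε / 8) := Real.one_le_rpow (by norm_num) (by positivity)
  have h60 : (1 : ℝ) ≤ 6 ^ ε := Real.one_le_rpow (by norm_num) hε.le
  refine ⟨C1 * 4096 ^ (ε / 8) * 6 ^ ε, one_le_mul_of_one_le_of_one_le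
    (one_le_mul_of_one_le_of_one_le hC11 h40) h60, fun x hx => ?_⟩
  have hx' : (1 : ℝ) ≤ x := by exact_mod_cast hx
  set L := Nat.clog 2 (x + 2) with hL
  have hL1 : x + 2 ≤ 2 ^ L := Nat.le_pow_clog (by norm_num) _
  have hL0 : L ≠ 0 := by
    intro h0; rw [h0] at hL1; omega
  have hL2 : 2 ^ L ≤ 6 * x := by
    have h1 := Nat.pow_pred_clog_lt_self (b := 2) (by norm_num) (show 1 < x + 2 by omega)
    have h2 : 2 ^ L = 2 * 2 ^ (L - 1) := by rw [mul_comm, ← pow_succ, Nat.sub_add_cancel (Nat.pos_of_ne_zero hL0)]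
    rw [← hL, Nat.pred_eq_sub_one] at h1
    omega
  have hX1 : (x : ℝ) ≤ 2 ^ L := by
    have : x ≤ 2 ^ L := by omega
    exact_mod_cast this
  have hX2 : (2 : ℝ) ^ L ≤ 6 * x := by exact_mod_cast hL2
  set y : ℝ := 4 * 2 ^ (10 + 7 * L) * 2 ^ L with hy
  have hyX : y = 4096 * (2 ^ L) ^ 8 := by
    rw [hy, pow_add, pow_mul']; norm_num; ring
  have hy1 : 1 ≤ y := by
    rw [hyX]
    have : (1 : ℝ) ≤ (2 ^ L) ^ 8 := one_le_pow₀ (one_le_pow₀ (by norm_num))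
    linarith
  have hye : y ^ (ε / 8) ≤ 4096 ^ (ε / 8) * 6 ^ ε * (x : ℝ) ^ ε := by
    rw [hyX, Real.mul_rpow (by norm_num) (by positivity), ← Real.rpow_natCast _ 8,
      ← Real.rpow_mul (by positivity), mul_assoc, ← Real.mul_rpow (by norm_num) (by positivity)]
    have : ((8 : ℕ) : ℝ) * (ε / 8) = ε := by push_cast; ring
    rw [this]
    gcongr
  have hlog : 1 + Real.log y ≤ (1 + 8 / ε) * y ^ (ε / 8) := by
    have h1 := Real.log_le_rpow_div (by positivity : (0 : ℝ) ≤ y) (by positivity : 0 < ε / 8)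
    have h2 : (1 : ℝ) ≤ y ^ (ε / 8) := Real.one_le_rpow hy1 (by positivity)
    have : y ^ (ε / 8) / (ε / 8) = 8 / ε * y ^ (ε / 8) := by field_simp
    rw [this] at h1
    linarith
  have hBge : C1 * y ^ (ε / 8) ≤ C1 * 4096 ^ (ε / 8) * 6 ^ ε * (x : ℝ) ^ ε := by
    rw [mul_assoc C1, mul_assoc C1]
    gcongr
  have hy0 : 0 ≤ y ^ (ε / 8) := by positivity
  have h8 : 0 ≤ 8 / ε := by positivity
  have hlen : ((12 + 8 * L : ℕ) : ℝ) ≤ C1 * y ^ (ε / 8) := by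
    have h1 : Real.log y = (12 + 8 * L : ℕ) * Real.log 2 := by
      rw [← Real.log_pow, hyX]
      congr 1
      rw [pow_add, pow_mul']; norm_num
    have h2 : (1 / 2 : ℝ) ≤ Real.log 2 := by linarith [Real.log_two_gt_d9]
    have h3 : (12 + 8 * L : ℕ) * (1 / 2 : ℝ) ≤ Real.log y := by rw [h1]; gcongr
    nlinarith
  refine ⟨10 + 7 * L, L, by omega, by omega, ?_, ?_, ⟨?_, ?_, ?_, ?_⟩⟩
  · calc (4 : ℝ) ^ L = (2 ^ L) ^ 2 := by rw [← pow_mul, mul_comm, pow_mul]; norm_num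
      _ ≤ (6 * x) ^ 2 := by gcongr
      _ = _ := by ring
  · have h1 : (2 : ℝ) ^ (10 + 7 * L) = 1024 * (2 ^ L) ^ 7 := by
      rw [pow_add, pow_mul']; norm_num
    have h2 : (x : ℝ) ^ 7 ≤ (2 ^ L) ^ 7 := by gcongr
    have h3 : (1 : ℝ) ≤ x ^ 7 := one_le_pow₀ hx'
    rw [h1]; linarith
  · intro m h0 hm
    refine (h m h0.ne').trans (le_trans ?_ hBge)
    have : (m : ℝ) ≤ y := by
      rw [hy]; exact_mod_cast hm.le
    have : (m : ℝ) ^ (ε / 8) ≤ y ^ (ε / 8) := by gcongr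
    have : C0 ≤ C1 := by linarith
    gcongr
  · refine le_trans ?_ hBge
    refine hlog.trans ?_
    gcongr
    linarith
  · refine le_trans ?_ (hlen.trans hBge)
    push_cast; linarith [Nat.cast_nonneg (α := ℝ) L]
  · refine le_trans ?_ (hlen.trans hBge)
    push_cast; linarith [Nat.cast_nonneg (α := ℝ) L]

theorem floor_add_half_div (x m : ℕ) : ⌊((x : ℝ) + 1 / 2) / m⌋₊ = x / m := by
  rw [Nat.floor_div_natCast]
  congr 1
  rw [Nat.floor_eq_iff (by positivity)]
  constructor <;> linarith

theorem exists_cbrt (x : ℕ) : ∃ Z : ℕ, Z ^ 3 ≤ x ∧ x < (Z + 1) ^ 3 := by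
  classical
  have hex : ∃ Z, x < (Z + 1) ^ 3 := ⟨x, lt_of_lt_of_le (Nat.lt_succ_self x) (Nat.le_self_pow (by norm_num) _)⟩
  refine ⟨Nat.find hex, ?_, Nat.find_spec hex⟩
  rcases h : Nat.find hex with _ | k
  · simp
  · have := Nat.find_min hex (m := k) (by omega)
    omega

theorem sqrt_region {x Z : ℕ} (hZ : Z ^ 3 ≤ x) : ∀ n1 ∈ Finset.Icc 1 Z,
    n1 * Nat.sqrt (x / n1) ^ 2 ≤ x ∧ n1 ^ 2 * Nat.sqrt (x / n1) ≤ x ∧ Nat.sqrt (x / n1) ≤ x := by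
  intro n1 h1
  have h2 : n1 * Nat.sqrt (x / n1) ^ 2 ≤ x := by
    rw [sq]
    exact (Nat.mul_le_mul_left _ (Nat.sqrt_le _)).trans (Nat.mul_div_le x n1)
  refine ⟨h2, ?_, (Nat.sqrt_le_self _).trans (Nat.div_le_self _ _)⟩
  have h3 : n1 ^ 3 ≤ x := le_trans (by gcongr; exact (Finset.mem_Icc.mp h1).2) hZ
  have : (n1 ^ 2 * Nat.sqrt (x / n1)) ^ 2 ≤ x ^ 2 := by
    calc (n1 ^ 2 * Nat.sqrt (x / n1)) ^ 2 = n1 ^ 3 * (n1 * Nat.sqrt (x / n1) ^ 2) := by ring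
      _ ≤ x * x := Nat.mul_le_mul h3 h2
      _ = x ^ 2 := by ring
  exact (Nat.pow_le_pow_iff_left (by norm_num)).mp this

theorem pvConst_pos {q : ℕ} (hq : 0 < q) : 0 < pvConst q := by
  have h1 : (1 : ℝ) ≤ q := by exact_mod_cast hq
  have h2 : 0 < q.divisors.card := Finset.card_pos.mpr ⟨1, Nat.one_mem_divisors.mpr hq.ne'⟩
  have := Real.log_nonneg h1
  unfold pvConst
  positivity

theorem sqrt_pvConst_le {q : ℕ} {x B : ℝ} (hB : 0 ≤ B) (hx : 0 ≤ x)
    (h1 : (q.divisors.card : ℝ) ≤ B) (h2 : 1 + Real.log q ≤ B) :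
    Real.sqrt (q * pvConst q * x) ≤ B * ((q : ℝ) ^ ((3 : ℝ) / 4) * x ^ ((1 : ℝ) / 2)) := by
  have hq : (0 : ℝ) ≤ q := Nat.cast_nonneg q
  refine Real.sqrt_le_iff.mpr ⟨by positivity, ?_⟩
  have e1 : ((q : ℝ) ^ ((3 : ℝ) / 4)) ^ 2 = q * Real.sqrt q := by
    rcases hq.eq_or_lt with h | h
    · rw [← h, Real.zero_rpow (by norm_num)]; simp
    · rw [← Real.rpow_natCast, ← Real.rpow_mul hq, Real.sqrt_eq_rpow, ← Real.rpow_one_add' hq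
        (by norm_num)]
      norm_num
  have e2 : (x ^ ((1 : ℝ) / 2)) ^ 2 = x := by
    rw [← Real.sqrt_eq_rpow, Real.sq_sqrt hx]
  rw [mul_pow, mul_pow, e1, e2]
  unfold pvConst
  have hlog : 0 ≤ Real.log q := Real.log_natCast_nonneg q
  have : (q.divisors.card : ℝ) * (1 + Real.log q) ≤ B * B := by gcongr
  calc _ = q * Real.sqrt q * x * ((q.divisors.card : ℝ) * (1 + Real.log q)) := by ring
    _ ≤ q * Real.sqrt q * x * (B * B) := by gcongr
    _ = _ := by ring

/-- the combination of the four sums in the hyperbola method -/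
theorem abs_sum_d3_mul_le {q : ℕ} [NeZero q] {x : ℕ} (hx : 1 ≤ x) (hqx : q ≤ x) (θ : ZMod q → ℝ)
    (hθ1 : ∀ b, |θ b| ≤ 1) (hθ0 : ∀ b, ¬ IsUnit b → θ b = 0) (hθs : ∑ b, θ b = 0) {B : ℝ}
    {J L : ℕ} (hB1 : 1 ≤ B) (hJ : 0 < J) (hL : x + 1 < 2 ^ L) (hL4 : (4 : ℝ) ^ L ≤ 36 * x ^ 2)
    (hJ7 : (1000 * x ^ 7 : ℝ) ≤ 2 ^ J - 1) (hB : LevelBound B J L) :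
    |∑ n ∈ Finset.Icc 1 x, (d3 n : ℝ) * θ n| ≤
      13 * (121 * B ^ 6 * ((q : ℝ) ^ ((3 : ℝ) / 4) * (x : ℝ) ^ ((1 : ℝ) / 2))) := by
  obtain ⟨Z, hZ, hZ'⟩ := exists_cbrt x
  have hx' : (1 : ℝ) ≤ x := by exact_mod_cast hx
  have hq : 0 < q := Nat.pos_of_ne_zero (NeZero.ne q)
  have hq1 : (1 : ℝ) ≤ q := by exact_mod_cast hq
  have hqx' : (q : ℝ) ≤ x := by exact_mod_cast hqx
  have hQ : 0 < (q : ℝ) * pvConst q := by have := pvConst_pos hq; positivity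
  have hZx : Z ≤ x := le_trans (Nat.le_self_pow (by norm_num) Z) hZ
  have hZL : Z < 2 ^ L := by omega
  have hreg := sqrt_region hZ
  have hZr : ∀ n1 ∈ Finset.Icc 1 Z, n1 * Z ^ 2 ≤ x ∧ n1 ^ 2 * Z ≤ x := by
    intro n1 h1
    have h2 := (Finset.mem_Icc.mp h1).2
    constructor
    · calc n1 * Z ^ 2 ≤ Z * Z ^ 2 := by gcongr
        _ = Z ^ 3 := by ring
        _ ≤ x := hZ
    · calc n1 ^ 2 * Z ≤ Z ^ 2 * Z := by gcongr
        _ = Z ^ 3 := by ring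
        _ ≤ x := hZ
  have hK : 120 * B ^ 5 * Real.sqrt (q * pvConst q * x) + 8 * q ^ 3 * x ^ 2 * 4 ^ L / (2 ^ J - 1) ≤
      121 * B ^ 6 * ((q : ℝ) ^ ((3 : ℝ) / 4) * (x : ℝ) ^ ((1 : ℝ) / 2)) := by
    have hqL : q < 4 * 2 ^ J * 2 ^ L := by
      have : 1 ≤ 2 ^ J := Nat.one_le_two_pow
      nlinarith
    have h1 : Real.sqrt (q * pvConst q * x) ≤
        B * ((q : ℝ) ^ ((3 : ℝ) / 4) * (x : ℝ) ^ ((1 : ℝ) / 2)) := by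
      refine sqrt_pvConst_le (by linarith) (by linarith) (hB.tau q hq hqL) (le_trans ?_ hB.log)
      gcongr
      exact_mod_cast hqL.le
    have h2 : 8 * (q : ℝ) ^ 3 * x ^ 2 * 4 ^ L / (2 ^ J - 1) ≤ 1 := by
      have h7 : (0 : ℝ) < 2 ^ J - 1 := lt_of_lt_of_le (by positivity) hJ7
      rw [div_le_one h7]
      refine le_trans ?_ hJ7
      calc 8 * (q : ℝ) ^ 3 * (x : ℝ) ^ 2 * (4 : ℝ) ^ L
          ≤ 8 * (x : ℝ) ^ 3 * (x : ℝ) ^ 2 * (36 * (x : ℝ) ^ 2) := by gcongr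
        _ = 288 * (x : ℝ) ^ 7 := by ring
        _ ≤ _ := by nlinarith [pow_pos (by linarith : (0 : ℝ) < x) 7]
    have h3 : 1 ≤ (q : ℝ) ^ ((3 : ℝ) / 4) * (x : ℝ) ^ ((1 : ℝ) / 2) :=
      one_le_mul_of_one_le_of_one_le (Real.one_le_rpow hq1 (by norm_num))
        (Real.one_le_rpow hx' (by norm_num))
    have h4 : 1 ≤ B ^ 6 := one_le_pow₀ hB1
    have h5 := mul_le_mul_of_nonneg_left h1 (by positivity : 0 ≤ 120 * B ^ 5)
    nlinarith [one_le_mul_of_one_le_of_one_le h4 h3]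
  set K := 121 * B ^ 6 * ((q : ℝ) ^ ((3 : ℝ) / 4) * (x : ℝ) ^ ((1 : ℝ) / 2)) with hKdef
  have hcs : ∀ n1 ∈ Finset.Icc 1 Z, Nat.sqrt (x / n1) + 1 < 2 ^ L := fun n1 h1 => by
    have := (hreg n1 h1).2.2
    omega
  have hcZ : ∀ n1 ∈ Finset.Icc 1 Z, Z + 1 < 2 ^ L := fun n1 h1 => by omega
  have f1 : ∀ n1 n2 : ℕ, ⌊(0 : ℝ) + (x + 1 / 2) / (n1 * n2)⌋₊ = x / (n1 * n2) := by
    intro n1 n2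
    rw [zero_add]; exact_mod_cast floor_add_half_div x (n1 * n2)
  have f2 : ∀ (k : ℕ) (m : ℝ), ⌊(k : ℝ) + 1 / 2 + 0 / m⌋₊ = k := by
    intro k m
    rw [zero_div, add_zero, Nat.floor_eq_iff (by positivity)]
    constructor <;> linarith
  have r1 := (abs_sum_theta_le (hypRegion_one hx (fun n h => (hreg n h).2.1)
    (fun n h => (hreg n h).1)) θ hθ1 hθ0 hθs hQ hJ hB hZL hcs).trans hK
  have r2 := (abs_sum_theta_le (hypRegion_two (κ := fun n => Nat.sqrt (x / n)) hx
    (fun n h => (hreg n h).2.1) (fun n h => (hreg n h).1)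
    (fun n h => by have := (hreg n h).1; rw [sq, ← mul_assoc] at this; exact this))
    θ hθ1 hθ0 hθs hQ hJ hB hZL hcs).trans hK
  have r3 := (abs_sum_theta_le (hypRegion_one (c := fun _ => Z) hx (fun n h => (hZr n h).2)
    (fun n h => (hZr n h).1)) θ hθ1 hθ0 hθs hQ hJ hB hZL hcZ).trans hK
  have r4 := (abs_sum_theta_le (hypRegion_two (c := fun _ => Z) (κ := fun _ => Z) hx
    (fun n h => (hZr n h).2) (fun n h => (hZr n h).1)
    (fun n h => by have := (hZr n h).1; rw [sq, ← mul_assoc] at this; exact this))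
    θ hθ1 hθ0 hθs hQ hJ hB hZL hcZ).trans hK
  simp_rw [f1] at r1 r3
  simp_rw [f2] at r2 r4
  rw [sum_d3_eq (fun n => θ n) hZ hZ', abs_le]
  rw [abs_le] at r1 r2 r3 r4
  constructor <;> linarith [r1.1, r1.2, r2.1, r2.2, r3.1, r3.2, r4.1, r4.2]

theorem abs_sum_d3_theta_le {ε : ℝ} (hε : 0 < ε) : ∃ C : ℝ, 1 ≤ C ∧ ∀ (q : ℕ) [NeZero q] (y : ℝ),
    0 < y → ∀ θ : ZMod q → ℝ, (∀ b, |θ b| ≤ 1) → (∀ b, ¬ IsUnit b → θ b = 0) → ∑ b, θ b = 0 →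
    |∑ n ∈ Finset.Icc 1 ⌊y⌋₊, (d3 n : ℝ) * θ n| ≤
      C * (y ^ ((1 : ℝ) / 2 + ε) * (q : ℝ) ^ ((3 : ℝ) / 4)) := by
  obtain ⟨C1, hC1, h1⟩ := exists_levelBound (ε := ε / 6) (by positivity)
  obtain ⟨C2, hC2, h2⟩ := d3_le_rpow hε
  refine ⟨1573 * C1 ^ 6 + C2, by have := one_le_pow₀ hC1 (n := 6); linarith, ?_⟩
  intro q _ y hy θ hθ1 hθ0 hθs
  set x := ⌊y⌋₊ with hxdef
  have hxy : (x : ℝ) ≤ y := Nat.floor_le hy.le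
  rcases Nat.eq_zero_or_pos x with h0 | hx
  · rw [h0]; simp; positivity
  have hx' : (1 : ℝ) ≤ x := by exact_mod_cast hx
  have hmono : (x : ℝ) ^ ((1 : ℝ) / 2 + ε) ≤ y ^ ((1 : ℝ) / 2 + ε) := by gcongr
  have hP : 0 ≤ (x : ℝ) ^ ((1 : ℝ) / 2 + ε) * (q : ℝ) ^ ((3 : ℝ) / 4) := by positivity
  suffices h : |∑ n ∈ Finset.Icc 1 x, (d3 n : ℝ) * θ n| ≤
      (1573 * C1 ^ 6 + C2) * ((x : ℝ) ^ ((1 : ℝ) / 2 + ε) * (q : ℝ) ^ ((3 : ℝ) / 4)) by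
    refine h.trans ?_
    gcongr
  rcases le_or_gt q x with hqx | hqx
  · obtain ⟨J, L, hJ, hL, hL4, hJ7, hB⟩ := h1 x hx
    have hB1 : 1 ≤ C1 * (x : ℝ) ^ (ε / 6) :=
      one_le_mul_of_one_le_of_one_le hC1 (Real.one_le_rpow hx' (by positivity))
    refine (abs_sum_d3_mul_le hx hqx θ hθ1 hθ0 hθs hB1 hJ hL hL4 hJ7 hB).trans ?_
    have e : ((x : ℝ) ^ (ε / 6)) ^ 6 * (x : ℝ) ^ ((1 : ℝ) / 2) = (x : ℝ) ^ ((1 : ℝ) / 2 + ε) := by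
      rw [← Real.rpow_natCast, ← Real.rpow_mul (by positivity), ← Real.rpow_add (by positivity)]
      congr 1; push_cast; ring
    calc _ = 1573 * C1 ^ 6 * ((((x : ℝ) ^ (ε / 6)) ^ 6 * (x : ℝ) ^ ((1 : ℝ) / 2)) *
          (q : ℝ) ^ ((3 : ℝ) / 4)) := by ring
      _ = 1573 * C1 ^ 6 * ((x : ℝ) ^ ((1 : ℝ) / 2 + ε) * (q : ℝ) ^ ((3 : ℝ) / 4)) := by rw [e]
      _ ≤ _ := by gcongr; linarith
  · have hq1 : (x : ℝ) ≤ q := by exact_mod_cast hqx.le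
    calc |∑ n ∈ Finset.Icc 1 x, (d3 n : ℝ) * θ n| ≤ ∑ n ∈ Finset.Icc 1 x, C2 * (x : ℝ) ^ ε := by
          refine (Finset.abs_sum_le_sum_abs _ _).trans (Finset.sum_le_sum fun n hn => ?_)
          rw [abs_mul, Nat.abs_cast]
          have hnx : (n : ℝ) ≤ x := by exact_mod_cast (Finset.mem_Icc.mp hn).2
          calc (d3 n : ℝ) * |θ n| ≤ (C2 * (n : ℝ) ^ ε) * 1 := by gcongr; exacts [h2 n, hθ1 _]
            _ ≤ _ := by rw [mul_one]; gcongr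
      _ = C2 * ((x : ℝ) ^ ε * x) := by rw [Finset.sum_const, Nat.card_Icc, nsmul_eq_mul]; simp; ring
      _ = C2 * ((x : ℝ) ^ ((1 : ℝ) / 2 + ε) * (x : ℝ) ^ ((1 : ℝ) / 2)) := by
          rw [← Real.rpow_add (by positivity), ← Real.rpow_add_one (by positivity)]
          congr 2; ring
      _ ≤ C2 * ((x : ℝ) ^ ((1 : ℝ) / 2 + ε) * (q : ℝ) ^ ((3 : ℝ) / 4)) := by
          gcongr 2
          calc (x : ℝ) ^ ((1 : ℝ) / 2) ≤ (x : ℝ) ^ ((3 : ℝ) / 4) :=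
                Real.rpow_le_rpow_of_exponent_le hx' (by norm_num)
            _ ≤ _ := by gcongr
      _ ≤ _ := by
          gcongr
          have : 0 ≤ C1 ^ 6 := by positivity
          linarith

theorem exists_limit_of_telescoping (a b : ℕ → ℝ) (hb : ∀ k, 1 ≤ k → 0 ≤ b k)
    (h : ∀ k, 1 ≤ k → |a (k + 1) - a k| ≤ b k - b (k + 1)) :
    ∃ l : ℝ, ∀ k, 1 ≤ k → |a k - l| ≤ b k := by
  have hmono : Monotone fun k => a (k + 1) - b (k + 1) :=
    monotone_nat_of_le_succ fun k => by
      have := (abs_le.mp (h (k + 1) (by omega))).1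
      linarith
  have hanti : Antitone fun k => a (k + 1) + b (k + 1) :=
    antitone_nat_of_succ_le fun k => by
      have := (abs_le.mp (h (k + 1) (by omega))).2
      linarith
  have hle : ∀ j k, a (j + 1) - b (j + 1) ≤ a (k + 1) + b (k + 1) := by
    intro j k
    have h1 := hmono (le_max_left j k)
    have h2 := hanti (le_max_right j k)
    have h3 := hb (max j k + 1) (by omega)
    simp only at h1 h2
    linarith
  refine ⟨⨆ k, (a (k + 1) - b (k + 1)), fun k hk => ?_⟩
  obtain ⟨k, rfl⟩ : ∃ j, k = j + 1 := ⟨k - 1, by omega⟩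
  have h1 : a (k + 1) - b (k + 1) ≤ ⨆ k, (a (k + 1) - b (k + 1)) :=
    le_ciSup (f := fun k => a (k + 1) - b (k + 1)) ⟨a 1 + b 1, by rintro _ ⟨j, rfl⟩; exact hle j 0⟩ k
  have h2 : ⨆ k, (a (k + 1) - b (k + 1)) ≤ a (k + 1) + b (k + 1) := ciSup_le fun j => hle j k
  rw [abs_le]; constructor <;> linarith

theorem abs_log_ratio_sub_le {k : ℝ} (hk : 1 ≤ k) :
    |Real.log (k + 1 / 2) - Real.log (k - 1 / 2) - 1 / k| ≤ 1 / k ^ 3 := by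
  have h0 : 0 < k := by linarith
  set v := 1 / (2 * k) with hv
  have hv0 : 0 < v := by positivity
  have hv2 : v ≤ 1 / 2 := by rw [hv, div_le_div_iff₀ (by positivity) (by norm_num)]; linarith
  have e1 : k + 1 / 2 = k * (1 + v) := by rw [hv]; field_simp
  have e2 : k - 1 / 2 = k * (1 - v) := by rw [hv]; field_simp
  have h1 := Real.abs_log_sub_add_sum_range_le (x := v) (by rw [abs_of_pos hv0]; linarith) 2
  have h2 := Real.abs_log_sub_add_sum_range_le (x := -v) (by rw [abs_neg, abs_of_pos hv0]; linarith) 2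
  rw [abs_neg] at h2
  rw [abs_of_pos hv0] at h1 h2
  have h3 : v ^ (2 + 1) / (1 - v) ≤ 2 * v ^ 3 := by
    rw [div_le_iff₀ (by linarith)]
    have : 0 ≤ v ^ 3 * (1 - 2 * v) := mul_nonneg (by positivity) (by linarith)
    linarith [this, show v ^ 3 * (1 - 2 * v) = 2 * v ^ 3 * (1 - v) - v ^ (2 + 1) by ring]
  have h1' := h1.trans h3
  have h2' := h2.trans h3
  simp only [Finset.sum_range_succ, Finset.sum_range_zero, sub_neg_eq_add] at h1' h2'
  rw [e1, e2, Real.log_mul h0.ne' (by linarith), Real.log_mul h0.ne' (by linarith)]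
  have e3 : 1 / k = 2 * v := by rw [hv]; field_simp
  have e4 : 1 / k ^ 3 = 8 * v ^ 3 := by rw [hv]; field_simp; norm_num
  rw [e3, e4]
  have := pow_pos hv0 3
  rw [abs_le] at *
  norm_num at h1' h2'
  constructor <;> nlinarith [h1'.1, h1'.2, h2'.1, h2'.2]

theorem abs_log_add_log_sub_le {k : ℝ} (hk : 1 ≤ k) :
    |Real.log (k + 1 / 2) + Real.log (k - 1 / 2) - 2 * Real.log k| ≤ 1 / k ^ 2 := by
  have h0 : 0 < k := by linarith
  set v := (1 / (2 * k)) ^ 2 with hv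
  have hv0 : 0 < v := by positivity
  have hv2 : v ≤ 1 / 4 := by
    have : 1 / (2 * k) ≤ 1 / 2 := by
      rw [div_le_div_iff₀ (by positivity) (by norm_num)]; linarith
    calc v ≤ (1 / 2) ^ 2 := by rw [hv]; gcongr
      _ = 1 / 4 := by norm_num
  have h1 := Real.abs_log_sub_add_sum_range_le (x := v) (by rw [abs_of_pos hv0]; linarith) 0
  rw [abs_of_pos hv0] at h1
  have h3 : v ^ (0 + 1) / (1 - v) ≤ 2 * v := by
    rw [div_le_iff₀ (by linarith), zero_add, pow_one]
    nlinarith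
  have h1' := h1.trans h3
  simp only [Finset.sum_range_zero, zero_add] at h1'
  have e : Real.log (k + 1 / 2) + Real.log (k - 1 / 2) - 2 * Real.log k = Real.log (1 - v) := by
    have : 1 - v = (k + 1 / 2) * (k - 1 / 2) / (k * k) := by rw [hv]; field_simp; ring
    rw [this, Real.log_div (by nlinarith) (by positivity), Real.log_mul (by linarith) (by linarith),
      Real.log_mul h0.ne' h0.ne']
    ring
  rw [e]
  have e4 : 1 / k ^ 2 = 4 * v := by rw [hv]; field_simp; norm_num
  linarith

theorem harmonic_asymp : ∃ γ : ℝ, ∀ k : ℕ, 1 ≤ k →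
    |∑ n ∈ Finset.Icc 1 k, (1 : ℝ) / n - (Real.log (k + 1 / 2) + γ)| ≤ 1 / (k : ℝ) ^ 2 := by
  obtain ⟨γ, hγ⟩ := exists_limit_of_telescoping
    (fun k => ∑ n ∈ Finset.Icc 1 k, (1 : ℝ) / n - Real.log (k + 1 / 2)) (fun k => 1 / (k : ℝ) ^ 2)
    (fun k _ => by positivity) (by
      intro k hk
      have hk' : (1 : ℝ) ≤ k := by exact_mod_cast hk
      have h := abs_log_ratio_sub_le (k := (k : ℝ) + 1) (by linarith)
      have e : (k : ℝ) + 1 - 1 / 2 = k + 1 / 2 := by ring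
      rw [e] at h
      rw [Finset.sum_Icc_succ_top (by omega)]
      push_cast
      have h2 : 1 / ((k : ℝ) + 1) ^ 3 ≤ 1 / (k : ℝ) ^ 2 - 1 / ((k : ℝ) + 1) ^ 2 := by
        rw [div_sub_div _ _ (by positivity) (by positivity),
          div_le_div_iff₀ (by positivity) (by positivity)]
        have : ((1 : ℝ) * (k + 1) ^ 2 - k ^ 2 * 1) * (k + 1) ^ 3 - 1 * (k ^ 2 * (k + 1) ^ 2) =
            (k + 1) ^ 2 * (k ^ 2 + 3 * k + 1) := by ring
        have : (0 : ℝ) ≤ (k + 1) ^ 2 * (k ^ 2 + 3 * k + 1) := by positivity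
        linarith
      refine le_trans ?_ (h.trans h2)
      rw [← abs_neg]
      refine le_of_eq (congrArg _ ?_)
      ring)
  refine ⟨γ, fun k hk => ?_⟩
  have := hγ k hk
  rwa [sub_sub] at this

theorem sum_log_div_asymp : ∃ γ : ℝ, ∀ k : ℕ, 1 ≤ k →
    |∑ n ∈ Finset.Icc 1 k, Real.log n / n - (1 / 2 * Real.log (k + 1 / 2) ^ 2 + γ)| ≤
      4 / (Real.sqrt k) ^ 3 := by
  obtain ⟨γ, hγ⟩ := exists_limit_of_telescoping
    (fun k => ∑ n ∈ Finset.Icc 1 k, Real.log n / n - 1 / 2 * Real.log (k + 1 / 2) ^ 2)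
    (fun k => 4 / (Real.sqrt k) ^ 3)
    (fun k _ => by positivity) (by
      intro k hk
      have hk' : (1 : ℝ) ≤ k := by exact_mod_cast hk
      have h := abs_log_ratio_sub_le (k := (k : ℝ) + 1) (by linarith)
      have h' := abs_log_add_log_sub_le (k := (k : ℝ) + 1) (by linarith)
      have e : (k : ℝ) + 1 - 1 / 2 = k + 1 / 2 := by ring
      rw [e] at h h'
      rw [Finset.sum_Icc_succ_top (by omega)]
      push_cast
      set n : ℝ := (k : ℝ) + 1 with hn
      have hn1 : 1 ≤ n := by linarith
      have hn0 : 0 < n := by linarith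
      set A := Real.log (n + 1 / 2) with hA
      set A' := Real.log ((k : ℝ) + 1 / 2) with hA'
      set ell := Real.log n with hell
      have hell0 : 0 ≤ ell := Real.log_nonneg hn1
      have hell2 : ell ≤ 2 * Real.sqrt n := by
        have := Real.log_le_rpow_div hn0.le (by norm_num : (0 : ℝ) < 1 / 2)
        rw [← Real.sqrt_eq_rpow] at this
        linarith
      set e1 := A - A' - 1 / n with he1
      set e2 := A + A' - 2 * ell with he2
      have key : ∑ m ∈ Finset.Icc 1 k, Real.log m / m + ell / n - 1 / 2 * A ^ 2 -
          (∑ m ∈ Finset.Icc 1 k, Real.log m / m - 1 / 2 * A' ^ 2) =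
          -(e2 / (2 * n)) - e1 * ell - e1 * e2 / 2 := by
        have : A = (e1 + 1 / n + e2 + 2 * ell) / 2 := by rw [he1, he2]; ring
        have h2 : A' = (e2 + 2 * ell - e1 - 1 / n) / 2 := by rw [he1, he2]; ring
        rw [this, h2]
        field_simp
        ring
      rw [key]
      have hsq : Real.sqrt n ^ 2 = n := Real.sq_sqrt hn0.le
      have hs1 : 1 ≤ Real.sqrt n := Real.one_le_sqrt.mpr hn1
      have hs0 : 0 < Real.sqrt n := by linarith
      have hb : |-(e2 / (2 * n)) - e1 * ell - e1 * e2 / 2| ≤ 4 * (1 / Real.sqrt n) ^ 5 := by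
        have b1 : |e2 / (2 * n)| ≤ 1 / n ^ 3 := by
          rw [abs_div, abs_of_pos (by positivity : 0 < 2 * n)]
          calc |e2| / (2 * n) ≤ (1 / n ^ 2) / (2 * n) := by gcongr
            _ = 1 / n ^ 3 / 2 := by field_simp
            _ ≤ _ := by have : 0 ≤ 1 / n ^ 3 := by positivity
                        linarith
        have b2 : |e1 * ell| ≤ 1 / n ^ 3 * (2 * Real.sqrt n) := by
          rw [abs_mul, abs_of_nonneg hell0]; gcongr
        have b3 : |e1 * e2 / 2| ≤ 1 / n ^ 3 := by
          rw [abs_div, abs_mul, abs_of_pos (by norm_num : (0 : ℝ) < 2)]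
          have : 1 / n ^ 2 ≤ 1 := by
            rw [div_le_one (by positivity)]; exact one_le_pow₀ hn1
          calc |e1| * |e2| / 2 ≤ 1 / n ^ 3 * 1 / 2 := by gcongr; exact h'.trans this
            _ ≤ _ := by have : 0 ≤ 1 / n ^ 3 := by positivity
                        linarith
        have b4 : 1 / n ^ 3 * Real.sqrt n = (1 / Real.sqrt n) ^ 5 := by
          rw [← hsq]
          simp only [Real.sqrt_sq hs0.le]
          field_simp
        have b5 : 1 / n ^ 3 ≤ 1 / n ^ 3 * Real.sqrt n := le_mul_of_one_le_right (by positivity) hs1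
        rw [← b4]
        have b1' := abs_le.mp b1
        have b2' := abs_le.mp b2
        have b3' := abs_le.mp b3
        rw [abs_le]
        constructor <;> linarith [b1'.1, b1'.2, b2'.1, b2'.2, b3'.1, b3'.2]
      refine hb.trans ?_
      have hk0 : 0 < Real.sqrt k := Real.sqrt_pos.mpr (by linarith)
      set s := 1 / Real.sqrt k with hs
      set t := 1 / Real.sqrt n with ht
      have hst : t ≤ s := by
        rw [hs, ht]; gcongr; linarith
      have ht0 : 0 < t := by positivity
      have hd : t ^ 4 ≤ s ^ 2 - t ^ 2 := by
        have a1 : s ^ 2 = 1 / k := by rw [hs, div_pow, Real.sq_sqrt (by linarith)]; simp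
        have a2 : t ^ 2 = 1 / n := by rw [ht, div_pow, hsq]; simp
        have : t ^ 4 = (t ^ 2) ^ 2 := by ring
        rw [this, a1, a2, div_sub_div _ _ (by linarith) hn0.ne', div_pow,
          div_le_div_iff₀ (by positivity) (by positivity), hn]
        nlinarith
      have e5 : 4 / Real.sqrt k ^ 3 - 4 / Real.sqrt n ^ 3 = 4 * (s ^ 3 - t ^ 3) := by
        rw [hs, ht]; field_simp
      rw [e5]
      have : t ^ 5 ≤ s ^ 3 - t ^ 3 := by
        calc t ^ 5 = t ^ 4 * t := by ring
          _ ≤ (s ^ 2 - t ^ 2) * t := by gcongr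
          _ ≤ s ^ 3 - t ^ 3 := by
            have : 0 ≤ (s - t) * s ^ 2 := mul_nonneg (by linarith) (by positivity)
            nlinarith
      linarith)
  refine ⟨γ, fun k hk => ?_⟩
  have := hγ k hk
  rwa [sub_sub] at this

theorem sub_one_sub_log_bounds {r : ℝ} (hr : 0 < r) :
    0 ≤ r - 1 - Real.log r ∧ r - 1 - Real.log r ≤ (r - 1) ^ 2 / r := by
  have h1 := Real.log_le_sub_one_of_pos hr
  have h2 := Real.one_sub_inv_le_log_of_pos hr
  refine ⟨by linarith, ?_⟩
  have : (r - 1) ^ 2 / r = r - 2 + r⁻¹ := by field_simp; ring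
  rw [this]; linarith

theorem hyperbola_term {γ : ℝ} (hγ : ∀ k : ℕ, 1 ≤ k →
    |∑ n ∈ Finset.Icc 1 k, (1 : ℝ) / n - (Real.log (k + 1 / 2) + γ)| ≤ 1 / (k : ℝ) ^ 2)
    {u : ℝ} {s : ℕ} (hs : 1 ≤ s) (h1 : (s : ℝ) ^ 2 ≤ u) (h2 : u ≤ (s + 1) ^ 2) :
    |2 * u * ∑ n ∈ Finset.Icc 1 s, (1 : ℝ) / n - s - s ^ 2 - (u * Real.log u + (2 * γ - 1) * u)| ≤
      12 := by
  have hs' : (1 : ℝ) ≤ s := by exact_mod_cast hs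
  have hu : 0 < u := lt_of_lt_of_le (by positivity) h1
  have h := hγ s hs
  set H := ∑ n ∈ Finset.Icc 1 s, (1 : ℝ) / n
  set e := H - (Real.log (s + 1 / 2) + γ) with he
  have hH : H = Real.log (s + 1 / 2) + γ + e := by rw [he]; ring
  set t : ℝ := (s + 1 / 2) ^ 2 with ht
  have ht0 : 0 < t := by positivity
  have hlt : Real.log t = 2 * Real.log (s + 1 / 2) := by rw [ht, Real.log_pow]; norm_num
  have hr := sub_one_sub_log_bounds (r := t / u) (by positivity)
  rw [Real.log_div ht0.ne' hu.ne'] at hr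
  have hu1 : |u * e| ≤ 4 := by
    rw [abs_mul, abs_of_pos hu]
    calc u * |e| ≤ (2 * s) ^ 2 * (1 / (s : ℝ) ^ 2) := by
          gcongr
          refine h2.trans ?_
          gcongr
          linarith
      _ = 4 := by field_simp; norm_num
  have hb : u * (t / u - 1 - (Real.log t - Real.log u)) ≤ 3 := by
    calc u * (t / u - 1 - (Real.log t - Real.log u)) ≤ u * ((t / u - 1) ^ 2 / (t / u)) := by
          gcongr; exact hr.2
      _ = (t - u) ^ 2 / t := by field_simp
      _ ≤ 3 := by
          rw [div_le_iff₀ ht0]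
          have : |t - u| ≤ s + 1 := by
            rw [abs_le]; constructor <;> nlinarith
          calc (t - u) ^ 2 = |t - u| ^ 2 := (sq_abs _).symm
            _ ≤ (s + 1) ^ 2 := by gcongr
            _ ≤ _ := by nlinarith
  have hb0 : 0 ≤ u * (t / u - 1 - (Real.log t - Real.log u)) := mul_nonneg hu.le hr.1
  have e1 : u * (t / u - 1 - (Real.log t - Real.log u)) = t - u - u * Real.log t + u * Real.log u := by
    field_simp; ring
  rw [e1] at hb hb0
  have key : 2 * u * H - s - s ^ 2 - (u * Real.log u + (2 * γ - 1) * u) =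
      -(t - u - u * Real.log t + u * Real.log u) + 2 * (u * e) + 1 / 4 := by
    rw [hH, hlt, ht]; ring
  rw [key]
  have := abs_le.mp hu1
  rw [abs_le]; constructor <;> linarith

theorem cubic_expansion {X z : ℝ} (hz : 1 ≤ z) (h1 : z ^ 3 ≤ X) (h2 : X ≤ (z + 1) ^ 3) :
    |(z + 1 / 2) ^ 3 - X - X * Real.log ((z + 1 / 2) ^ 3 / X) -
      X / 2 * Real.log ((z + 1 / 2) ^ 3 / X) ^ 2| ≤ 300 * z := by
  have hz0 : 0 < z := by linarith
  have hX : 0 < X := lt_of_lt_of_le (by positivity) h1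
  set P := (z + 1 / 2) ^ 3 with hP
  have hP0 : 0 < P := by positivity
  have hPz : z ^ 3 ≤ P := by rw [hP]; gcongr; linarith
  have hX8 : X ≤ 8 * z ^ 3 := by
    calc X ≤ (z + 1) ^ 3 := h2
      _ ≤ (2 * z) ^ 3 := by gcongr; linarith
      _ = _ := by ring
  have hd : (P - X) ^ 2 ≤ 25 * z ^ 4 := by
    have : |P - X| ≤ 5 * z ^ 2 := by
      rw [hP, abs_le]; constructor <;> nlinarith
    calc (P - X) ^ 2 = |P - X| ^ 2 := (sq_abs _).symm
      _ ≤ (5 * z ^ 2) ^ 2 := by gcongr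
      _ = _ := by ring
  have hr := sub_one_sub_log_bounds (r := P / X) (by positivity)
  have hr' := sub_one_sub_log_bounds (r := X / P) (by positivity)
  have hinv : Real.log (X / P) = -Real.log (P / X) := by
    rw [← Real.log_inv, inv_div]
  rw [hinv] at hr'
  set ell := Real.log (P / X) with hell
  have a1 : X * (P / X - 1 - ell) ≤ 25 * z := by
    calc X * (P / X - 1 - ell) ≤ X * ((P / X - 1) ^ 2 / (P / X)) := by gcongr; exact hr.2
      _ = (P - X) ^ 2 / P := by field_simp
      _ ≤ 25 * z ^ 4 / z ^ 3 := by gcongr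
      _ = 25 * z := by field_simp
  have a0 : 0 ≤ X * (P / X - 1 - ell) := mul_nonneg hX.le hr.1
  have e1 : X * (P / X - 1 - ell) = P - X - X * ell := by field_simp
  rw [e1] at a1 a0
  have b1 : X * ell ^ 2 ≤ 225 * z := by
    have c1 : ell ≤ P / X - 1 := by linarith [hr.1]
    have c2 : -ell ≤ X / P - 1 := by linarith [hr'.1]
    have c3 : ell ^ 2 ≤ (P / X - 1) ^ 2 + (X / P - 1) ^ 2 := by
      rcases le_total 0 ell with h | h
      · nlinarith [sq_nonneg (X / P - 1)]
      · nlinarith [sq_nonneg (P / X - 1)]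
    calc X * ell ^ 2 ≤ X * ((P / X - 1) ^ 2 + (X / P - 1) ^ 2) := by gcongr
      _ = (P - X) ^ 2 / X + X * (P - X) ^ 2 / P ^ 2 := by field_simp; ring
      _ ≤ 25 * z ^ 4 / z ^ 3 + 8 * z ^ 3 * (25 * z ^ 4) / (z ^ 3) ^ 2 := by gcongr
      _ = 225 * z := by field_simp; norm_num
  have b0 : 0 ≤ X * ell ^ 2 := by positivity
  rw [abs_le]; constructor <;> linarith

/-- the polynomial appearing in the main term of `∑ d₃(n)` -/
noncomputable def mainPoly (γ γ1 L : ℝ) : ℝ :=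
  3 * ((L + 2 * γ - 1) * (L / 3 + γ) - L ^ 2 / 18 - γ1 - (L / 3 + γ) ^ 2) + 1

theorem log_le_six_rpow {X : ℝ} (hX : 0 ≤ X) : Real.log X ≤ 6 * X ^ ((1 : ℝ) / 6) := by
  have := Real.log_le_rpow_div hX (by norm_num : (0 : ℝ) < 1 / 6)
  linarith

set_option maxHeartbeats 1000000 in
theorem main_terms {γ γ1 : ℝ} (hγ : ∀ k : ℕ, 1 ≤ k →
    |∑ n ∈ Finset.Icc 1 k, (1 : ℝ) / n - (Real.log (k + 1 / 2) + γ)| ≤ 1 / (k : ℝ) ^ 2)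
    (hγ1 : ∀ k : ℕ, 1 ≤ k →
    |∑ n ∈ Finset.Icc 1 k, Real.log n / n - (1 / 2 * Real.log (k + 1 / 2) ^ 2 + γ1)| ≤
      4 / (Real.sqrt k) ^ 3) : ∃ C : ℝ, 0 ≤ C ∧ ∀ x Z : ℕ, 1 ≤ x → Z ^ 3 ≤ x → x < (Z + 1) ^ 3 →
    |3 * ∑ n ∈ Finset.Icc 1 Z, (2 * (((x : ℝ) + 1 / 2) / n) *
        ∑ m ∈ Finset.Icc 1 (Nat.sqrt (x / n)), (1 : ℝ) / m - (Nat.sqrt (x / n) : ℝ) -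
          (Nat.sqrt (x / n) : ℝ) ^ 2) - 3 * (((x : ℝ) + 1 / 2) * (∑ n ∈ Finset.Icc 1 Z, (1 : ℝ) / n) ^ 2 -
          (Z : ℝ) ^ 2 / 2) + (Z : ℝ) ^ 3 -
        ((x : ℝ) + 1 / 2) * mainPoly γ γ1 (Real.log ((x : ℝ) + 1 / 2))| ≤
      C * Real.sqrt ((x : ℝ) + 1 / 2) := by
  refine ⟨400 + 3 * (160 + 8 * (3 + |2 * γ - 1| + 2 * |γ|)), by positivity, ?_⟩
  intro x Z hx hZ hZ'
  set X : ℝ := (x : ℝ) + 1 / 2 with hXdef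
  have hx' : (1 : ℝ) ≤ x := by exact_mod_cast hx
  have hX1 : 1 ≤ X := by linarith
  have hX0 : 0 < X := by linarith
  have hZ1 : 1 ≤ Z := by
    rcases Nat.eq_zero_or_pos Z with h | h
    · subst h; omega
    · exact h
  set z : ℝ := (Z : ℝ) with hz
  have hz1 : 1 ≤ z := by rw [hz]; exact_mod_cast hZ1
  have hz0 : 0 < z := by linarith
  have hzX : z ^ 3 ≤ X := by
    have : z ^ 3 ≤ x := by rw [hz]; exact_mod_cast hZ
    linarith
  have hXz : X ≤ (z + 1) ^ 3 := by
    have : (x : ℝ) + 1 ≤ (z + 1) ^ 3 := by rw [hz]; exact_mod_cast hZ'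
    linarith
  have hX8 : X ≤ 8 * z ^ 3 := by
    calc X ≤ (z + 1) ^ 3 := hXz
      _ ≤ (2 * z) ^ 3 := by gcongr; linarith
      _ = _ := by ring
  set R := Real.sqrt X with hR
  have hR1 : 1 ≤ R := Real.one_le_sqrt.mpr hX1
  have hRR : R ^ 2 = X := Real.sq_sqrt hX0.le
  set L := Real.log X with hL
  have hL0 : 0 ≤ L := Real.log_nonneg hX1
  have hzthird : z ≤ X ^ ((1 : ℝ) / 3) := by
    have : z = (z ^ 3) ^ ((1 : ℝ) / 3) := by
      rw [← Real.rpow_natCast, ← Real.rpow_mul hz0.le]; norm_num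
    rw [this]; gcongr
  have hzL : z * L ≤ 6 * R := by
    calc z * L ≤ X ^ ((1 : ℝ) / 3) * (6 * X ^ ((1 : ℝ) / 6)) := by
          gcongr; exact log_le_six_rpow hX0.le
      _ = 6 * R := by
          rw [hR, Real.sqrt_eq_rpow, mul_left_comm, ← Real.rpow_add hX0]; norm_num
  have hzR : z ≤ R := by
    refine hzthird.trans ?_
    rw [hR, Real.sqrt_eq_rpow]
    exact Real.rpow_le_rpow_of_exponent_le hX1 (by norm_num)
  set w := Real.log (z + 1 / 2) with hw
  have hw0 : 0 ≤ w := Real.log_nonneg (by linarith)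
  have hwL : w ≤ L := by
    refine Real.log_le_log (by linarith) ?_
    have : z ≤ z ^ 3 := le_self_pow₀ hz1 (by norm_num)
    have h2 : z ^ 3 ≤ x := by rw [hz]; exact_mod_cast hZ
    linarith
  set h := ∑ n ∈ Finset.Icc 1 Z, (1 : ℝ) / n with hh
  set g := ∑ n ∈ Finset.Icc 1 Z, Real.log n / n with hg
  set eh := h - (w + γ) with heh
  set eg := g - (1 / 2 * w ^ 2 + γ1) with heg
  have hehb : |eh| ≤ 1 / z ^ 2 := hγ Z hZ1
  have hegb : |eg| ≤ 4 / Real.sqrt z ^ 3 := hγ1 Z hZ1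
  -- the terms over the diagonal
  have hA : |∑ n ∈ Finset.Icc 1 Z, (2 * (X / n) *
        ∑ m ∈ Finset.Icc 1 (Nat.sqrt (x / n)), (1 : ℝ) / m - (Nat.sqrt (x / n) : ℝ) -
          (Nat.sqrt (x / n) : ℝ) ^ 2) - X * ((L + 2 * γ - 1) * h - g)| ≤ 12 * z := by
    have e : X * ((L + 2 * γ - 1) * h - g) = ∑ n ∈ Finset.Icc 1 Z,
        (X / n * Real.log (X / n) + (2 * γ - 1) * (X / n)) := by
      rw [hh, hg, Finset.mul_sum, ← Finset.sum_sub_distrib, Finset.mul_sum]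
      refine Finset.sum_congr rfl fun n hn => ?_
      have hn0 : (n : ℝ) ≠ 0 := by
        have := (Finset.mem_Icc.mp hn).1
        exact_mod_cast (by omega : n ≠ 0)
      rw [Real.log_div hX0.ne' hn0]
      ring
    rw [e, ← Finset.sum_sub_distrib]
    calc _ ≤ ∑ n ∈ Finset.Icc 1 Z, (12 : ℝ) := by
          refine (Finset.abs_sum_le_sum_abs _ _).trans (Finset.sum_le_sum fun n hn => ?_)
          obtain ⟨hn1, hnZ⟩ := Finset.mem_Icc.mp hn
          have hnx : n ≤ x := hnZ.trans (le_trans (Nat.le_self_pow (by norm_num) Z) hZ)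
          have hn0 : (0 : ℝ) < n := by exact_mod_cast hn1
          have hs1 : 1 ≤ Nat.sqrt (x / n) := by
            rw [Nat.le_sqrt]; exact Nat.div_pos hnx hn1
          refine hyperbola_term hγ hs1 ?_ ?_
          · rw [le_div_iff₀ hn0]
            have : Nat.sqrt (x / n) ^ 2 * n ≤ x := by
              rw [sq]
              exact (Nat.mul_le_mul_right _ (Nat.sqrt_le _)).trans (Nat.div_mul_le_self x n)
            have : ((Nat.sqrt (x / n) : ℝ)) ^ 2 * n ≤ x := by exact_mod_cast this
            linarith
          · rw [div_le_iff₀ hn0]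
            have : x < (Nat.sqrt (x / n) + 1) ^ 2 * n := by
              rw [← Nat.div_lt_iff_lt_mul hn1, sq]
              exact Nat.lt_succ_sqrt _
            have : (x : ℝ) + 1 ≤ ((Nat.sqrt (x / n) : ℝ) + 1) ^ 2 * n := by exact_mod_cast this
            linarith
      _ = 12 * z := by rw [Finset.sum_const, Nat.card_Icc, nsmul_eq_mul, hz]; simp; ring
  have hB := cubic_expansion hz1 hzX hXz
  have hlogP : Real.log ((z + 1 / 2) ^ 3 / X) = 3 * w - L := by
    rw [Real.log_div (by positivity) hX0.ne', Real.log_pow]; norm_num; rfl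
  rw [hlogP] at hB
  -- errors from replacing `h`, `g` by their asymptotic values
  have hXeh : X * |eh| ≤ 8 * z := by
    calc X * |eh| ≤ 8 * z ^ 3 * (1 / z ^ 2) := by gcongr
      _ = 8 * z := by field_simp
  have hXeg : X * |eg| ≤ 12 * R := by
    have hq0 : 0 < Real.sqrt z := Real.sqrt_pos.mpr hz0
    have h3 : R ≤ 3 * Real.sqrt z ^ 3 := by
      refine Real.sqrt_le_iff.mpr ⟨by positivity, hX8.trans ?_⟩
      have : (3 * Real.sqrt z ^ 3) ^ 2 = 9 * (Real.sqrt z ^ 2) ^ 3 := by ring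
      rw [this, Real.sq_sqrt hz0.le]
      nlinarith [pow_pos hz0 3]
    calc X * |eg| ≤ R ^ 2 * (4 / Real.sqrt z ^ 3) := by rw [hRR]; gcongr
      _ = R * (R * 4 / Real.sqrt z ^ 3) := by ring
      _ ≤ R * 12 := by
          gcongr
          rw [div_le_iff₀ (by positivity)]; linarith
      _ = 12 * R := by ring
  have hD : |X * ((L + 2 * γ - 1) * eh - eg - 2 * (w + γ) * eh - eh ^ 2)| ≤
      (160 + 8 * (3 + |2 * γ - 1| + 2 * |γ|)) * R := by
    have hehsmall : |eh| ≤ 1 := hehb.trans (by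
      rw [div_le_one (by positivity)]; exact one_le_pow₀ hz1)
    have e : X * ((L + 2 * γ - 1) * eh - eg - 2 * (w + γ) * eh - eh ^ 2) =
      X * eh * (L + (2 * γ - 1) - 2 * w - 2 * γ - eh) - X * eg := by ring
    rw [e]
    have h1 : |X * eh * (L + (2 * γ - 1) - 2 * w - 2 * γ - eh)| ≤
        8 * z * (3 * L + (|2 * γ - 1| + 2 * |γ| + 1)) := by
      rw [abs_mul, abs_mul, abs_of_pos hX0]
      gcongr
      have t1 := abs_le.mp hehsmall
      have t2 := neg_abs_le (2 * γ - 1)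
      have t3 := le_abs_self (2 * γ - 1)
      have t4 := neg_abs_le γ
      have t5 := le_abs_self γ
      rw [abs_le]; constructor <;> linarith
    have h2 : |X * eg| ≤ 12 * R := by rw [abs_mul, abs_of_pos hX0]; exact hXeg
    have h3 : 8 * z * (3 * L + (|2 * γ - 1| + 2 * |γ| + 1)) ≤
        144 * R + 8 * (|2 * γ - 1| + 2 * |γ| + 1) * R := by
      have k0 : 0 ≤ |2 * γ - 1| + 2 * |γ| + 1 := by positivity
      have k1 := mul_le_mul_of_nonneg_left hzR k0
      linarith
    refine (abs_sub _ _).trans ((add_le_add (h1.trans h3) h2).trans ?_)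
    have k2 : 0 ≤ (|2 * γ - 1| + 2 * |γ| + 1) * R := by positivity
    linarith
  have key : 3 * ∑ n ∈ Finset.Icc 1 Z, (2 * (X / n) *
        ∑ m ∈ Finset.Icc 1 (Nat.sqrt (x / n)), (1 : ℝ) / m - (Nat.sqrt (x / n) : ℝ) -
          (Nat.sqrt (x / n) : ℝ) ^ 2) - 3 * (X * h ^ 2 - z ^ 2 / 2) + z ^ 3 -
        X * mainPoly γ γ1 L =
      3 * (∑ n ∈ Finset.Icc 1 Z, (2 * (X / n) *
        ∑ m ∈ Finset.Icc 1 (Nat.sqrt (x / n)), (1 : ℝ) / m - (Nat.sqrt (x / n) : ℝ) -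
          (Nat.sqrt (x / n) : ℝ) ^ 2) - X * ((L + 2 * γ - 1) * h - g)) +
      3 * (X * ((L + 2 * γ - 1) * eh - eg - 2 * (w + γ) * eh - eh ^ 2)) +
      ((z + 1 / 2) ^ 3 - X - X * (3 * w - L) - X / 2 * (3 * w - L) ^ 2) - (3 / 4 * z + 1 / 8) := by
    have e1 : h = w + γ + eh := by rw [heh]; ring
    have e2 : g = 1 / 2 * w ^ 2 + γ1 + eg := by rw [heg]; ring
    rw [e1, e2]
    unfold mainPoly
    ring
  rw [key]
  generalize 160 + 8 * (3 + |2 * γ - 1| + 2 * |γ|) = K at hD ⊢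
  rw [abs_le] at hA hB hD ⊢
  constructor <;> linarith [hA.1, hA.2, hB.1, hB.2, hD.1, hD.2]

theorem abs_sum_floor_add_half_le {x Z : ℕ} {c : ℕ → ℕ} (hx : 1 ≤ x)
    (hl : ∀ n1 ∈ Finset.Icc 1 Z, n1 ^ 2 * c n1 ≤ x) (hr : ∀ n1 ∈ Finset.Icc 1 Z, n1 * c n1 ^ 2 ≤ x)
    (hZx : Z ≤ x) (hcx : ∀ n1 ∈ Finset.Icc 1 Z, c n1 ≤ x) {B : ℝ} {J L : ℕ} (hB1 : 1 ≤ B)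
    (hJ : 0 < J) (hL : x + 1 < 2 ^ L) (hL4 : (4 : ℝ) ^ L ≤ 36 * x ^ 2)
    (hJ7 : (1000 * x ^ 7 : ℝ) ≤ 2 ^ J - 1) (hB : LevelBound B J L) :
    |∑ n1 ∈ Finset.Icc 1 Z, ∑ n2 ∈ Finset.Icc 1 (c n1),
      (((x / (n1 * n2) : ℕ) : ℝ) - ((x : ℝ) + 1 / 2) / (n1 * n2) + 1 / 2)| ≤
      61 * B ^ 5 * Real.sqrt x := by
  have hx' : (1 : ℝ) ≤ x := by exact_mod_cast hx
  have h := abs_sum_floor_sub_le (hypRegion_one hx hl hr) hJ hB (by omega)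
    (fun n1 h1 => by have := hcx n1 h1; omega)
  have f1 : ∀ n1 n2 : ℕ, ⌊((x : ℝ) + 1 / 2) / (n1 * n2)⌋₊ = x / (n1 * n2) := by
    intro n1 n2
    exact_mod_cast floor_add_half_div x (n1 * n2)
  simp_rw [f1] at h
  refine h.trans ?_
  have h2 : 8 * (x : ℝ) ^ 2 * 4 ^ L / (2 ^ J - 1) ≤ 1 := by
    have h7 : (0 : ℝ) < 2 ^ J - 1 := lt_of_lt_of_le (by positivity) hJ7
    rw [div_le_one h7]
    refine le_trans ?_ hJ7
    calc 8 * (x : ℝ) ^ 2 * (4 : ℝ) ^ L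
        ≤ 8 * (x : ℝ) ^ 2 * (36 * (x : ℝ) ^ 2) := by gcongr
      _ = 288 * (x : ℝ) ^ 4 := by ring
      _ ≤ 1000 * (x : ℝ) ^ 7 := by
        gcongr
        · norm_num
        · norm_num
  have h3 : Real.sqrt (2 * x) ≤ 2 * Real.sqrt x := by
    rw [Real.sqrt_mul (by norm_num)]
    gcongr
    rw [Real.sqrt_le_left (by norm_num)]; norm_num
  have h4 : 1 ≤ B ^ 5 * Real.sqrt x :=
    one_le_mul_of_one_le_of_one_le (one_le_pow₀ hB1) (Real.one_le_sqrt.mpr hx')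
  have h5 := mul_le_mul_of_nonneg_left h3 (by positivity : 0 ≤ 30 * B ^ 5)
  linarith

theorem sum_d3_nat_asymp {γ γ1 : ℝ} (hγ : ∀ k : ℕ, 1 ≤ k →
    |∑ n ∈ Finset.Icc 1 k, (1 : ℝ) / n - (Real.log (k + 1 / 2) + γ)| ≤ 1 / (k : ℝ) ^ 2)
    (hγ1 : ∀ k : ℕ, 1 ≤ k →
    |∑ n ∈ Finset.Icc 1 k, Real.log n / n - (1 / 2 * Real.log (k + 1 / 2) ^ 2 + γ1)| ≤
      4 / (Real.sqrt k) ^ 3) {ε : ℝ} (hε : 0 < ε) : ∃ C : ℝ, 0 ≤ C ∧ ∀ x : ℕ, 1 ≤ x →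
    |∑ n ∈ Finset.Icc 1 x, (d3 n : ℝ) -
      ((x : ℝ) + 1 / 2) * mainPoly γ γ1 (Real.log ((x : ℝ) + 1 / 2))| ≤
      C * (x : ℝ) ^ ((1 : ℝ) / 2 + ε) := by
  obtain ⟨C1, hC1, h1⟩ := exists_levelBound (ε := ε / 5) (by positivity)
  obtain ⟨C2, hC2, h2⟩ := main_terms hγ hγ1
  refine ⟨549 * C1 ^ 5 + 2 * C2, by positivity, ?_⟩
  intro x hx
  have hx' : (1 : ℝ) ≤ x := by exact_mod_cast hx
  obtain ⟨J, L, hJ, hL, hL4, hJ7, hB⟩ := h1 x hx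
  set B := C1 * (x : ℝ) ^ (ε / 5) with hBdef
  have hB1 : 1 ≤ B :=
    one_le_mul_of_one_le_of_one_le hC1 (Real.one_le_rpow hx' (by positivity))
  obtain ⟨Z, hZ, hZ'⟩ := exists_cbrt x
  have hZx : Z ≤ x := le_trans (Nat.le_self_pow (by norm_num) Z) hZ
  have hreg := sqrt_region hZ
  have hZr : ∀ n1 ∈ Finset.Icc 1 Z, n1 * Z ^ 2 ≤ x ∧ n1 ^ 2 * Z ≤ x := by
    intro n1 h1
    have h2 := (Finset.mem_Icc.mp h1).2
    constructor
    · calc n1 * Z ^ 2 ≤ Z * Z ^ 2 := by gcongr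
        _ = Z ^ 3 := by ring
        _ ≤ x := hZ
    · calc n1 ^ 2 * Z ≤ Z ^ 2 * Z := by gcongr
        _ = Z ^ 3 := by ring
        _ ≤ x := hZ
  have r1 := abs_sum_floor_add_half_le hx (fun n h => (hreg n h).2.1)
    (fun n h => (hreg n h).1) hZx (fun n h => (hreg n h).2.2) hB1 hJ hL hL4 hJ7 hB
  have r2 := abs_sum_floor_add_half_le (c := fun _ => Z) hx (fun n h => (hZr n h).2)
    (fun n h => (hZr n h).1) hZx (fun n h => hZx) hB1 hJ hL hL4 hJ7 hB
  have r3 := h2 x Z hx hZ hZ'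
  have hs := sum_d3_eq (fun _ => 1) hZ hZ'
  simp only [mul_one, Finset.sum_const, Nat.card_Icc, nsmul_eq_mul, add_tsub_cancel_right] at hs
  rw [hs]
  set X : ℝ := (x : ℝ) + 1 / 2 with hX
  set E1 := ∑ n1 ∈ Finset.Icc 1 Z, ∑ n2 ∈ Finset.Icc 1 (Nat.sqrt (x / n1)),
      (((x / (n1 * n2) : ℕ) : ℝ) - X / (n1 * n2) + 1 / 2) with hE1
  set E2 := ∑ n1 ∈ Finset.Icc 1 Z, ∑ n2 ∈ Finset.Icc 1 Z,
      (((x / (n1 * n2) : ℕ) : ℝ) - X / (n1 * n2) + 1 / 2) with hE2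
  set T := ∑ n ∈ Finset.Icc 1 Z, (2 * (X / n) *
        ∑ m ∈ Finset.Icc 1 (Nat.sqrt (x / n)), (1 : ℝ) / m - (Nat.sqrt (x / n) : ℝ) -
          (Nat.sqrt (x / n) : ℝ) ^ 2) with hT
  have e1 : 2 * ∑ n1 ∈ Finset.Icc 1 Z, ∑ n2 ∈ Finset.Icc 1 (Nat.sqrt (x / n1)),
        ((x / (n1 * n2) : ℕ) : ℝ) -
      ∑ n1 ∈ Finset.Icc 1 Z, (Nat.sqrt (x / n1) : ℝ) * (Nat.sqrt (x / n1) : ℝ) = T + 2 * E1 := by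
    rw [hT, hE1, Finset.mul_sum, Finset.mul_sum, ← Finset.sum_sub_distrib, ← Finset.sum_add_distrib]
    refine Finset.sum_congr rfl fun n _ => ?_
    rw [Finset.sum_add_distrib, Finset.sum_sub_distrib, Finset.sum_const, Nat.card_Icc]
    have : ∑ m ∈ Finset.Icc 1 (Nat.sqrt (x / n)), X / ((n : ℝ) * m) =
        X / n * ∑ m ∈ Finset.Icc 1 (Nat.sqrt (x / n)), (1 : ℝ) / m := by
      rw [Finset.mul_sum]
      exact Finset.sum_congr rfl fun m _ => by ring
    rw [this]
    simp only [nsmul_eq_mul, add_tsub_cancel_right]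
    ring
  have e2 : ∑ n1 ∈ Finset.Icc 1 Z, ∑ n2 ∈ Finset.Icc 1 Z, ((x / (n1 * n2) : ℕ) : ℝ) =
      X * (∑ n ∈ Finset.Icc 1 Z, (1 : ℝ) / n) ^ 2 - (Z : ℝ) ^ 2 / 2 + E2 := by
    have : E2 = ∑ n1 ∈ Finset.Icc 1 Z, ∑ n2 ∈ Finset.Icc 1 Z, ((x / (n1 * n2) : ℕ) : ℝ) -
        ∑ n1 ∈ Finset.Icc 1 Z, ∑ n2 ∈ Finset.Icc 1 Z, X * ((1 / (n1 : ℝ)) * (1 / n2)) +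
        ∑ n1 ∈ Finset.Icc 1 Z, ∑ n2 ∈ Finset.Icc 1 Z, (1 / 2 : ℝ) := by
      simp only [← Finset.sum_sub_distrib, ← Finset.sum_add_distrib, hE2]
      refine Finset.sum_congr rfl fun n1 _ => Finset.sum_congr rfl fun n2 _ => by ring
    rw [this]
    simp_rw [← Finset.mul_sum]
    rw [← Finset.sum_mul, Finset.sum_const, Finset.sum_const, Nat.card_Icc]
    simp only [nsmul_eq_mul, add_tsub_cancel_right]
    ring
  have hR : Real.sqrt X ≤ 2 * Real.sqrt x := by
    rw [show (2 : ℝ) = Real.sqrt 4 by rw [show (4 : ℝ) = 2 ^ 2 by norm_num]; simp,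
      ← Real.sqrt_mul (by norm_num)]
    exact Real.sqrt_le_sqrt (by linarith)
  have hb : B ^ 5 * Real.sqrt x = C1 ^ 5 * (x : ℝ) ^ ((1 : ℝ) / 2 + ε) := by
    rw [hBdef, mul_pow, mul_assoc, ← Real.rpow_natCast ((x : ℝ) ^ (ε / 5)),
      ← Real.rpow_mul (by positivity), Real.sqrt_eq_rpow, ← Real.rpow_add (by positivity)]
    congr 2; push_cast; ring
  have hb2 : Real.sqrt x ≤ (x : ℝ) ^ ((1 : ℝ) / 2 + ε) := by
    rw [Real.sqrt_eq_rpow]; exact Real.rpow_le_rpow_of_exponent_le hx' (by linarith)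
  have r3' := r3.trans (mul_le_mul_of_nonneg_left (hR.trans
    (mul_le_mul_of_nonneg_left hb2 (by norm_num : (0 : ℝ) ≤ 2))) hC2)
  rw [mul_assoc, hb] at r1 r2
  rw [e1, e2]
  rw [abs_le] at r1 r2 r3' ⊢
  constructor <;> linarith [r1.1, r1.2, r2.1, r2.2, r3'.1, r3'.2]

theorem abs_mul_log_poly_sub_le (c0 c1 c2 : ℝ) {X y : ℝ} (hX : 1 ≤ X) (hy : 1 ≤ y)
    (h : |X - y| ≤ 1 / 2) :
    |X * (c0 + c1 * Real.log X + c2 * Real.log X ^ 2) -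
      y * (c0 + c1 * Real.log y + c2 * Real.log y ^ 2)| ≤
    30 * (|c0| + |c1| + |c2|) * Real.sqrt y := by
  have hy0 : 0 < y := by linarith
  have hX0 : 0 < X := by linarith
  obtain ⟨ha, hb⟩ := abs_le.mp h
  set l := Real.log X
  set m := Real.log y
  have hm0 : 0 ≤ m := Real.log_nonneg hy
  have hl0 : 0 ≤ l := Real.log_nonneg hX
  have u1 : y * (l - m) ≤ 1 := by
    have : l - m ≤ X / y - 1 := by
      rw [← Real.log_div hX0.ne' hy0.ne']; exact Real.log_le_sub_one_of_pos (by positivity)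
    calc y * (l - m) ≤ y * (X / y - 1) := by gcongr
      _ = X - y := by field_simp
      _ ≤ 1 := by linarith
  have u2 : -1 ≤ y * (l - m) := by
    have : m - l ≤ y / X - 1 := by
      rw [← Real.log_div hy0.ne' hX0.ne']; exact Real.log_le_sub_one_of_pos (by positivity)
    have : X * (m - l) ≤ 1 / 2 := by
      calc X * (m - l) ≤ X * (y / X - 1) := by gcongr
        _ = y - X := by field_simp
        _ ≤ 1 / 2 := by linarith
    rcases le_total m l with h' | h'
    · have := mul_nonneg hy0.le (sub_nonneg.mpr h'); linarith
    · nlinarith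
  have hd : |y * (l - m)| ≤ 1 := abs_le.mpr ⟨u2, u1⟩
  have hlm : l ≤ m + 1 := by
    by_contra hc
    push Not at hc
    nlinarith
  have hR1 : 1 ≤ Real.sqrt y := Real.one_le_sqrt.mpr hy
  have hs1 : 1 ≤ Real.sqrt (Real.sqrt y) := Real.one_le_sqrt.mpr hR1
  have hs2 : Real.sqrt (Real.sqrt y) ^ 2 = Real.sqrt y := Real.sq_sqrt (by positivity)
  have hm : m ≤ 4 * Real.sqrt (Real.sqrt y) := by
    have := Real.log_le_rpow_div hy0.le (by norm_num : (0 : ℝ) < 1 / 4)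
    rw [Real.sqrt_eq_rpow, Real.sqrt_eq_rpow, ← Real.rpow_mul hy0.le]
    norm_num at this ⊢
    linarith
  rw [← hs2]
  set s := Real.sqrt (Real.sqrt y)
  have e : X * (c0 + c1 * l + c2 * l ^ 2) - y * (c0 + c1 * m + c2 * m ^ 2) =
    c0 * (X - y) + c1 * ((X - y) * l + y * (l - m)) +
      c2 * ((X - y) * l ^ 2 + y * (l - m) * (l + m)) := by ring
  rw [e]
  have hl5 : l ≤ 5 * s := by linarith
  have hss : s ≤ s ^ 2 := le_self_pow₀ hs1 (by norm_num)
  have k0 : |X - y| ≤ 30 * s ^ 2 := by nlinarith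
  have k1 : |(X - y) * l + y * (l - m)| ≤ 30 * s ^ 2 := by
    calc _ ≤ |(X - y) * l| + |y * (l - m)| := abs_add_le _ _
      _ = |X - y| * l + |y * (l - m)| := by rw [abs_mul, abs_of_nonneg hl0]
      _ ≤ 1 / 2 * (5 * s) + 1 := by gcongr
      _ ≤ _ := by nlinarith
  have k2 : |(X - y) * l ^ 2 + y * (l - m) * (l + m)| ≤ 30 * s ^ 2 := by
    calc _ ≤ |(X - y) * l ^ 2| + |y * (l - m) * (l + m)| := abs_add_le _ _
      _ = |X - y| * l ^ 2 + |y * (l - m)| * (l + m) := by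
        rw [abs_mul, abs_mul (y * (l - m)), abs_of_nonneg (by positivity : 0 ≤ l ^ 2),
          abs_of_nonneg (by positivity : 0 ≤ l + m)]
      _ ≤ 1 / 2 * (5 * s) ^ 2 + 1 * (5 * s + 4 * s) := by gcongr
      _ ≤ _ := by nlinarith
  refine (abs_add_three _ _ _).trans ?_
  rw [abs_mul, abs_mul, abs_mul]
  have := mul_le_mul_of_nonneg_left k0 (abs_nonneg c0)
  have := mul_le_mul_of_nonneg_left k1 (abs_nonneg c1)
  have := mul_le_mul_of_nonneg_left k2 (abs_nonneg c2)
  linarith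

theorem abs_mul_log_poly_le (c0 c1 c2 : ℝ) {y : ℝ} (hy : 0 < y) (hy1 : y ≤ 1) :
    |y * (c0 + c1 * Real.log y + c2 * Real.log y ^ 2)| ≤
      64 * (|c0| + |c1| + |c2|) * y ^ ((3 : ℝ) / 4) := by
  have h := (Real.abs_log_mul_self_rpow_lt y (1 / 8) hy hy1 (by norm_num)).le
  set a := y ^ ((1 : ℝ) / 8) with ha
  have ha0 : 0 < a := by positivity
  have ha1 : a ≤ 1 := Real.rpow_le_one hy.le hy1 (by norm_num)
  have hya : y = y ^ ((3 : ℝ) / 4) * a ^ 2 := by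
    rw [ha, ← Real.rpow_natCast, ← Real.rpow_mul hy.le, ← Real.rpow_add hy]; norm_num
  have hp : 0 < y ^ ((3 : ℝ) / 4) := by positivity
  have e : y * (c0 + c1 * Real.log y + c2 * Real.log y ^ 2) = y ^ ((3 : ℝ) / 4) *
      (c0 * a ^ 2 + c1 * (Real.log y * a * a) + c2 * (Real.log y * a) ^ 2) := by
    calc _ = y ^ ((3 : ℝ) / 4) * a ^ 2 * (c0 + c1 * Real.log y + c2 * Real.log y ^ 2) := by rw [← hya]
      _ = _ := by ring
  rw [e, abs_mul, abs_of_pos hp, mul_comm]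
  replace h : |Real.log y * a| ≤ 8 := h.trans (by norm_num)
  gcongr
  refine (abs_add_three _ _ _).trans ?_
  rw [abs_mul c0, abs_mul c1, abs_mul c2]
  have k0 : |a ^ 2| ≤ 64 := by
    rw [abs_of_pos (by positivity)]; nlinarith
  have k1 : |Real.log y * a * a| ≤ 64 := by
    rw [abs_mul (Real.log y * a), abs_of_pos ha0]; nlinarith [abs_nonneg (Real.log y * a)]
  have k2 : |(Real.log y * a) ^ 2| ≤ 64 := by
    rw [abs_pow]; nlinarith [abs_nonneg (Real.log y * a)]
  have := mul_le_mul_of_nonneg_left k0 (abs_nonneg c0)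
  have := mul_le_mul_of_nonneg_left k1 (abs_nonneg c1)
  have := mul_le_mul_of_nonneg_left k2 (abs_nonneg c2)
  linarith

theorem sum_d3_asymp : ∃ c0 c1 c2 : ℝ, ∀ ε : ℝ, 0 < ε → ε ≤ 1 / 4 → ∃ C : ℝ, 1 ≤ C ∧ ∀ y : ℝ, 0 < y →
    |∑ n ∈ Finset.Icc 1 ⌊y⌋₊, (d3 n : ℝ) -
      y * (c0 + c1 * Real.log y + c2 * Real.log y ^ 2)| ≤ C * y ^ ((1 : ℝ) / 2 + ε) := by
  obtain ⟨γ, hγ⟩ := harmonic_asymp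
  obtain ⟨γ1, hγ1⟩ := sum_log_div_asymp
  obtain ⟨c0, c1, c2, hc⟩ : ∃ c0 c1 c2 : ℝ, ∀ L, mainPoly γ γ1 L = c0 + c1 * L + c2 * L ^ 2 :=
    ⟨3 * ((2 * γ - 1) * γ - γ1 - γ ^ 2) + 1, 3 * (γ + (2 * γ - 1) / 3 - 2 / 3 * γ),
      3 * (1 / 3 - 1 / 18 - 1 / 9), fun L => by unfold mainPoly; ring⟩
  refine ⟨c0, c1, c2, fun ε hε hε4 => ?_⟩
  obtain ⟨C, hC, h⟩ := sum_d3_nat_asymp hγ hγ1 hε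
  refine ⟨C + 64 * (|c0| + |c1| + |c2|) + 1, by have : 0 ≤ |c0| + |c1| + |c2| := by positivity
                                                linarith, ?_⟩
  intro y hy
  set S := |c0| + |c1| + |c2| with hS
  have hS0 : 0 ≤ S := by positivity
  rcases lt_or_ge y 1 with h1 | h1
  · rw [Nat.floor_eq_zero.mpr h1]
    simp only [zero_lt_one, Finset.Icc_eq_empty_of_lt, Finset.sum_empty, zero_sub, abs_neg]
    refine (abs_mul_log_poly_le c0 c1 c2 hy h1.le).trans ?_
    rw [← hS]
    gcongr ?_ * ?_
    · linarith
    · exact Real.rpow_le_rpow_of_exponent_ge hy h1.le (by linarith)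
  · have hx : 1 ≤ ⌊y⌋₊ := Nat.one_le_floor_iff y |>.mpr h1
    have hxy := Nat.floor_le hy.le
    have hyx := Nat.lt_floor_add_one y
    have a1 := h _ hx
    rw [hc] at a1
    have hx' : (1 : ℝ) ≤ ⌊y⌋₊ := by exact_mod_cast hx
    have a2 := abs_mul_log_poly_sub_le c0 c1 c2 (X := (⌊y⌋₊ : ℝ) + 1 / 2) (by linarith) h1
      (by rw [abs_le]; constructor <;> linarith)
    have a3 : (⌊y⌋₊ : ℝ) ^ ((1 : ℝ) / 2 + ε) ≤ y ^ ((1 : ℝ) / 2 + ε) := by gcongr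
    have a4 : Real.sqrt y ≤ y ^ ((1 : ℝ) / 2 + ε) := by
      rw [Real.sqrt_eq_rpow]; exact Real.rpow_le_rpow_of_exponent_le h1 (by linarith)
    have a5 := mul_le_mul_of_nonneg_left a3 hC
    have a6 := mul_le_mul_of_nonneg_left a4 hS0
    rw [← hS] at a2
    have a7 : 0 ≤ y ^ ((1 : ℝ) / 2 + ε) := by positivity
    have a8 := mul_nonneg hS0 a7
    rw [abs_le] at a1 a2 ⊢
    constructor <;> linarith [a1.1, a1.2, a2.1, a2.2]

/-- the indicator function of the integers coprime to `m` -/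
noncomputable def copZeta (m : ℕ) : ArithmeticFunction ℝ :=
  ⟨fun n => if n ≠ 0 ∧ n.Coprime m then 1 else 0, by simp⟩

/-- the Möbius function restricted to the divisors of `m` -/
noncomputable def copMu (m : ℕ) : ArithmeticFunction ℝ :=
  ⟨fun n => if n ∣ m then (ArithmeticFunction.moebius n : ℝ) else 0, by simp⟩

/-- `d₃` as an arithmetic function -/
noncomputable def d3Fun : ArithmeticFunction ℝ := copZeta 1 * (copZeta 1 * copZeta 1)

/-- the function `n ↦ H (δ * n)` restricted to the integers coprime to `r` -/
noncomputable def dilate (δ r : ℕ) (H : ArithmeticFunction ℝ) : ArithmeticFunction ℝ :=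
  ⟨fun n => if n.Coprime r then H (δ * n) else 0, by simp⟩

theorem copZeta_apply (m n : ℕ) : copZeta m n = if n ≠ 0 ∧ n.Coprime m then 1 else 0 := rfl

theorem copMu_apply (m n : ℕ) :
    copMu m n = if n ∣ m then (ArithmeticFunction.moebius n : ℝ) else 0 := rfl

theorem dilate_apply (δ r : ℕ) (H : ArithmeticFunction ℝ) (n : ℕ) :
    dilate δ r H n = if n.Coprime r then H (δ * n) else 0 := rfl

theorem mul_apply_divisors (F G : ArithmeticFunction ℝ) (n : ℕ) :
    (F * G) n = ∑ d ∈ n.divisors, F d * G (n / d) := by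
  rw [ArithmeticFunction.mul_apply, Nat.sum_divisorsAntidiagonal (fun i j => F i * G j)]

theorem copZeta_eq_mul (m : ℕ) : copZeta m = copMu m * copZeta 1 := by
  classical
  ext n
  rw [mul_apply_divisors, copZeta_apply]
  rcases eq_or_ne n 0 with rfl | hn
  · simp
  have h1 : ∀ d ∈ n.divisors, copMu m d * copZeta 1 (n / d) =
      if d ∣ m then (ArithmeticFunction.moebius d : ℝ) else 0 := by
    intro d hd
    have hdn := Nat.dvd_of_mem_divisors hd
    have : n / d ≠ 0 := by
      rw [Nat.div_ne_zero_iff_of_dvd hdn]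
      exact ⟨hn, fun h => by subst h; simp at hd⟩
    have h1 : copZeta 1 (n / d) = 1 := if_pos ⟨this, Nat.coprime_one_right _⟩
    rw [h1, copMu_apply, mul_one]
  rw [Finset.sum_congr rfl h1, ← Finset.sum_filter]
  have h2 : n.divisors.filter (fun d => d ∣ m) = (n.gcd m).divisors := by
    ext d
    simp only [Finset.mem_filter, Nat.mem_divisors, Nat.dvd_gcd_iff]
    have : n.gcd m ≠ 0 := by simp [Nat.gcd_eq_zero_iff, hn]
    tauto
  rw [h2]
  have h3 := ArithmeticFunction.coe_zeta_mul_moebius ▸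
    ArithmeticFunction.coe_zeta_mul_apply (f := ArithmeticFunction.moebius) (x := n.gcd m)
  rw [ArithmeticFunction.one_apply] at h3
  rw [← Int.cast_sum, ← h3]
  simp [hn, Nat.Coprime]

theorem d3Fun_apply (n : ℕ) : d3Fun n = d3 n := by
  classical
  have h1 : ∀ m : ℕ, (copZeta 1 * copZeta 1) m = (m.divisorsAntidiagonal.card : ℝ) := by
    intro m
    rw [ArithmeticFunction.mul_apply, Finset.card_eq_sum_ones, Nat.cast_sum]
    refine Finset.sum_congr rfl fun p hp => ?_
    obtain ⟨h, h0⟩ := Nat.mem_divisorsAntidiagonal.mp hp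
    have ha : p.1 ≠ 0 := by rintro h'; rw [h', zero_mul] at h; exact h0 h.symm
    have hb : p.2 ≠ 0 := by rintro h'; rw [h', mul_zero] at h; exact h0 h.symm
    simp [copZeta_apply, ha, hb]
  have h2 : d3Fun n = ((∑ p ∈ n.divisorsAntidiagonal, p.2.divisorsAntidiagonal.card : ℕ) : ℝ) := by
    rw [d3Fun, ArithmeticFunction.mul_apply, Nat.cast_sum]
    refine Finset.sum_congr rfl fun p hp => ?_
    obtain ⟨h, h0⟩ := Nat.mem_divisorsAntidiagonal.mp hp
    have ha : p.1 ≠ 0 := by rintro h'; rw [h', zero_mul] at h; exact h0 h.symm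
    rw [h1]
    simp [copZeta_apply, ha]
  rw [h2, ← Finset.card_sigma]
  congr 1
  unfold d3
  refine Finset.card_bij' (fun p _ => (p.1.1, p.2.1, p.2.2))
    (fun p _ => ⟨(p.1, p.2.1 * p.2.2), (p.2.1, p.2.2)⟩) ?_ ?_ ?_ ?_
  · rintro ⟨⟨a, m⟩, ⟨b, c⟩⟩ h
    simp only [Finset.mem_sigma, Nat.mem_divisorsAntidiagonal] at h
    obtain ⟨⟨h1, h0⟩, h2, h3⟩ := h
    subst h2
    have hn : a * b * c = n := by rw [← h1]; ring
    have ha : a ∣ n := ⟨b * c, by rw [← hn]; ring⟩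
    have hb : b ∣ n := ⟨a * c, by rw [← hn]; ring⟩
    have hc : c ∣ n := ⟨a * b, by rw [← hn]; ring⟩
    have hpos := Nat.pos_of_ne_zero h0
    simp only [Finset.mem_filter, Finset.mem_product, Finset.mem_Icc]
    exact ⟨⟨⟨Nat.pos_of_dvd_of_pos ha hpos, Nat.le_of_dvd hpos ha⟩,
      ⟨Nat.pos_of_dvd_of_pos hb hpos, Nat.le_of_dvd hpos hb⟩,
      ⟨Nat.pos_of_dvd_of_pos hc hpos, Nat.le_of_dvd hpos hc⟩⟩, hn⟩
  · rintro ⟨a, b, c⟩ h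
    simp only [Finset.mem_filter, Finset.mem_product, Finset.mem_Icc] at h
    simp only [Finset.mem_sigma, Nat.mem_divisorsAntidiagonal]
    obtain ⟨⟨ha, hb, hc⟩, h⟩ := h
    refine ⟨⟨by rw [← h]; ring, by omega⟩, trivial, ?_⟩
    exact Nat.mul_ne_zero (by omega) (by omega)
  · rintro ⟨⟨a, m⟩, ⟨b, c⟩⟩ h
    simp only [Finset.mem_sigma, Nat.mem_divisorsAntidiagonal] at h
    obtain ⟨_, h2, _⟩ := h
    subst h2
    rfl
  · rintro ⟨a, b, c⟩ _
    rfl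

theorem sum_divisors_mul {δ n : ℕ} (hδ : δ ≠ 0) (hn : n ≠ 0) (f : ℕ → ℝ) :
    ∑ a ∈ (δ * n).divisors, f (δ * n / a) = ∑ g ∈ δ.divisors,
      ∑ a ∈ n.divisors.filter (fun a => a.Coprime (δ / g)), f (δ / g * (n / a)) := by
  rw [Finset.sum_sigma']
  refine Finset.sum_bij' (fun a _ => ⟨a.gcd δ, a / a.gcd δ⟩) (fun p _ => p.1 * p.2) ?_ ?_ ?_ ?_ ?_
  · intro a ha
    have had := Nat.dvd_of_mem_divisors ha
    have ha0 : 0 < a := Nat.pos_of_mem_divisors ha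
    have hg : 0 < a.gcd δ := Nat.gcd_pos_of_pos_left _ ha0
    have hc := Nat.coprime_div_gcd_div_gcd hg
    simp only [Finset.mem_sigma, Nat.mem_divisors, Finset.mem_filter]
    refine ⟨⟨Nat.gcd_dvd_right _ _, hδ⟩, ⟨?_, hn⟩, hc⟩
    refine hc.dvd_of_dvd_mul_left ?_
    refine Nat.dvd_of_mul_dvd_mul_left hg ?_
    rwa [Nat.mul_div_cancel' (Nat.gcd_dvd_left _ _), ← mul_assoc,
      Nat.mul_div_cancel' (Nat.gcd_dvd_right _ _)]
  · rintro ⟨g, a⟩ h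
    simp only [Finset.mem_sigma, Nat.mem_divisors, Finset.mem_filter] at h
    exact Nat.mem_divisors.mpr ⟨Nat.mul_dvd_mul h.1.1 h.2.1.1, Nat.mul_ne_zero hδ hn⟩
  · intro a ha
    exact Nat.mul_div_cancel' (Nat.gcd_dvd_left _ _)
  · rintro ⟨g, a⟩ h
    simp only [Finset.mem_sigma, Nat.mem_divisors, Finset.mem_filter] at h
    have hg : (g * a).gcd δ = g := by
      conv_lhs => rw [← Nat.mul_div_cancel' h.1.1]
      rw [Nat.gcd_mul_left, h.2.2, mul_one]
    have hg0 : 0 < g := Nat.pos_of_dvd_of_pos h.1.1 (Nat.pos_of_ne_zero hδ)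
    simp only [hg, Nat.mul_div_cancel_left _ hg0]
  · intro a ha
    have had := Nat.dvd_of_mem_divisors ha
    have ha0 : 0 < a := Nat.pos_of_mem_divisors ha
    have hg : 0 < a.gcd δ := Nat.gcd_pos_of_pos_left _ ha0
    have hc := Nat.coprime_div_gcd_div_gcd hg
    have hdn : a / a.gcd δ ∣ n := by
      refine hc.dvd_of_dvd_mul_left ?_
      refine Nat.dvd_of_mul_dvd_mul_left hg ?_
      rwa [Nat.mul_div_cancel' (Nat.gcd_dvd_left _ _), ← mul_assoc,
        Nat.mul_div_cancel' (Nat.gcd_dvd_right _ _)]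
    congr 1
    rw [Nat.div_mul_div_comm (Nat.gcd_dvd_right _ _) hdn, Nat.mul_div_cancel' (Nat.gcd_dvd_left _ _)]

theorem dilate_copZeta_mul {δ : ℕ} (hδ : δ ≠ 0) (r : ℕ) (H : ArithmeticFunction ℝ) :
    dilate δ r (copZeta 1 * H) =
      ∑ g ∈ δ.divisors, copZeta (δ / g * r) * dilate (δ / g) r H := by
  classical
  have hsum : ∀ (s : Finset ℕ) (F : ℕ → ArithmeticFunction ℝ) (n : ℕ),
      (∑ g ∈ s, F g) n = ∑ g ∈ s, F g n := by
    intro s F n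
    induction s using Finset.induction_on with
    | empty => simp
    | insert a s ha ih => rw [Finset.sum_insert ha, Finset.sum_insert ha, ArithmeticFunction.add_apply, ih]
  ext n
  rw [hsum]
  rcases eq_or_ne n 0 with rfl | hn
  · simp
  rw [dilate_apply]
  have h1 : ∀ g ∈ δ.divisors, (copZeta (δ / g * r) * dilate (δ / g) r H) n =
      if n.Coprime r then
        ∑ a ∈ n.divisors.filter (fun a => a.Coprime (δ / g)), H (δ / g * (n / a)) else 0 := by
    intro g hg
    rw [mul_apply_divisors]
    have h2 : ∀ a ∈ n.divisors, copZeta (δ / g * r) a * dilate (δ / g) r H (n / a) =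
        if n.Coprime r then (if a.Coprime (δ / g) then H (δ / g * (n / a)) else 0) else 0 := by
      intro a ha
      have had := Nat.dvd_of_mem_divisors ha
      have ha0 : a ≠ 0 := (Nat.pos_of_mem_divisors ha).ne'
      rw [copZeta_apply, dilate_apply]
      have hcop : n.Coprime r ↔ a.Coprime r ∧ (n / a).Coprime r := by
        conv_lhs => rw [← Nat.mul_div_cancel' had]
        exact Nat.coprime_mul_iff_left
      simp only [Nat.coprime_mul_iff_right, hcop]
      split_ifs <;> first | (exfalso; tauto) | ring
    rw [Finset.sum_congr rfl h2]
    split_ifs with h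
    · rw [Finset.sum_filter]
    · simp
  rw [Finset.sum_congr rfl h1]
  split_ifs with h
  · rw [← sum_divisors_mul hδ hn, mul_apply_divisors]
    refine Finset.sum_congr rfl fun a ha => ?_
    rw [copZeta_apply, if_pos ⟨(Nat.pos_of_mem_divisors ha).ne', Nat.coprime_one_right _⟩, one_mul]
  · simp

theorem dilate_copZeta {δ : ℕ} (hδ : δ ≠ 0) (r : ℕ) : dilate δ r (copZeta 1) = copZeta r := by
  ext n
  rw [dilate_apply, copZeta_apply, copZeta_apply]
  by_cases h : n.Coprime r <;> by_cases hn : n = 0 <;> simp [h, hn, hδ]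

/-- `F` is a combination of at most `T` dilates of `d₃`, with coefficients in `[-1, 1]` -/
def IsD3Comb (F : ArithmeticFunction ℝ) (T : ℕ) : Prop :=
  ∃ (ι : Type) (_ : Fintype ι) (k : ι → ℝ) (e : ι → ℕ), Fintype.card ι ≤ T ∧ (∀ i, |k i| ≤ 1) ∧
    (∀ i, e i ≠ 0) ∧ ∀ n, n ≠ 0 → F n = ∑ i, if e i ∣ n then k i * d3 (n / e i) else 0

theorem isD3Comb_d3Fun : IsD3Comb d3Fun 1 :=
  ⟨Unit, inferInstance, fun _ => 1, fun _ => 1, by simp, by simp, by simp,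
    fun n _ => by simp [d3Fun_apply]⟩

theorem IsD3Comb.mono {F : ArithmeticFunction ℝ} {T T' : ℕ} (h : IsD3Comb F T) (hT : T ≤ T') :
    IsD3Comb F T' := by
  obtain ⟨ι, hι, k, e, h1, h2⟩ := h
  exact ⟨ι, hι, k, e, h1.trans hT, h2⟩

theorem IsD3Comb.copMu_mul {F : ArithmeticFunction ℝ} {T m : ℕ} (h : IsD3Comb F T) (hm : m ≠ 0) :
    IsD3Comb (copMu m * F) (m.divisors.card * T) := by
  classical
  obtain ⟨ι, hι, k, e, h1, h2, h3, h4⟩ := h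
  refine ⟨{d // d ∈ m.divisors} × ι, inferInstance,
    fun p => (ArithmeticFunction.moebius p.1.1 : ℝ) * k p.2, fun p => p.1.1 * e p.2, ?_, ?_, ?_, ?_⟩
  · rw [Fintype.card_prod, Fintype.card_coe]; gcongr
  · intro p
    rw [abs_mul]
    refine mul_le_one₀ ?_ (abs_nonneg _) (h2 _)
    exact_mod_cast ArithmeticFunction.abs_moebius_le_one
  · intro p
    exact Nat.mul_ne_zero (Nat.pos_of_mem_divisors p.1.2).ne' (h3 _)
  · intro n hn
    rw [mul_apply_divisors, Fintype.sum_prod_type]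
    have e1 : ∑ d ∈ n.divisors, copMu m d * F (n / d) = ∑ d ∈ m.divisors,
        if d ∣ n then (ArithmeticFunction.moebius d : ℝ) * F (n / d) else 0 := by
      rw [← Finset.sum_filter]
      simp_rw [copMu_apply, ite_mul, zero_mul]
      rw [← Finset.sum_filter]
      refine Finset.sum_congr ?_ fun _ _ => rfl
      ext d
      simp only [Finset.mem_filter, Nat.mem_divisors]
      tauto
    rw [e1, ← Finset.sum_coe_sort]
    refine Finset.sum_congr rfl fun d _ => ?_
    have hd0 : 0 < d.1 := Nat.pos_of_mem_divisors d.2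
    split_ifs with hd
    · have hnd : n / d.1 ≠ 0 := by
        rw [Nat.div_ne_zero_iff_of_dvd hd]; exact ⟨hn, hd0.ne'⟩
      rw [h4 _ hnd, Finset.mul_sum]
      refine Finset.sum_congr rfl fun i _ => ?_
      simp only [Nat.dvd_div_iff_mul_dvd hd, Nat.div_div_eq_div_mul, mul_ite, mul_zero, mul_assoc]
    · symm
      refine Finset.sum_eq_zero fun i _ => if_neg fun h => hd (dvd_of_mul_right_dvd h)

theorem IsD3Comb.copZeta_mul {F : ArithmeticFunction ℝ} {T m : ℕ}
    (h : IsD3Comb (copZeta 1 * F) T) (hm : m ≠ 0) :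
    IsD3Comb (copZeta m * F) (m.divisors.card * T) := by
  rw [copZeta_eq_mul, mul_assoc]
  exact h.copMu_mul hm

theorem sum_arithmeticFunction_apply (s : Finset ℕ) (F : ℕ → ArithmeticFunction ℝ) (n : ℕ) :
    (∑ g ∈ s, F g) n = ∑ g ∈ s, F g n := by
  classical
  induction s using Finset.induction_on with
  | empty => simp
  | insert a s ha ih =>
    rw [Finset.sum_insert ha, Finset.sum_insert ha, ArithmeticFunction.add_apply, ih]

theorem IsD3Comb.sum {S : Finset ℕ} {F : ℕ → ArithmeticFunction ℝ} {T : ℕ}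
    (h : ∀ g ∈ S, IsD3Comb (F g) T) : IsD3Comb (∑ g ∈ S, F g) (S.card * T) := by
  classical
  choose ι hι k e h1 h2 h3 h4 using fun g : {g // g ∈ S} => h g.1 g.2
  refine ⟨Σ g : {g // g ∈ S}, ι g, inferInstance, fun p => k p.1 p.2, fun p => e p.1 p.2,
    ?_, fun p => h2 _ _, fun p => h3 _ _, fun n hn => ?_⟩
  · rw [Fintype.card_sigma]
    refine (Finset.sum_le_card_nsmul _ _ T fun g _ => h1 g).trans ?_
    simp
  · rw [sum_arithmeticFunction_apply, Fintype.sum_sigma, ← Finset.sum_coe_sort]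
    exact Finset.sum_congr rfl fun g _ => h4 g n hn

theorem isD3Comb_dilate {δ r : ℕ} (hδ : δ ≠ 0) (hr : r ≠ 0) :
    IsD3Comb (dilate δ r d3Fun) ((δ * r).divisors.card ^ 5) := by
  have hN : δ * r ≠ 0 := Nat.mul_ne_zero hδ hr
  have hcard : ∀ m, m ∣ δ * r → m.divisors.card ≤ (δ * r).divisors.card := fun m hm =>
    Finset.card_le_card (Nat.divisors_subset_of_dvd hN hm)
  set t := (δ * r).divisors.card with ht
  have e1 : dilate δ r d3Fun = ∑ g ∈ δ.divisors, copZeta (δ / g * r) *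
      ∑ g' ∈ (δ / g).divisors, copZeta (δ / g / g' * r) * copZeta r := by
    rw [d3Fun, dilate_copZeta_mul hδ]
    refine Finset.sum_congr rfl fun g hg => ?_
    have hg0 : δ / g ≠ 0 := by
      have hgd := Nat.dvd_of_mem_divisors hg
      rw [Nat.div_ne_zero_iff_of_dvd hgd]
      exact ⟨hδ, (Nat.pos_of_mem_divisors hg).ne'⟩
    congr 1
    rw [dilate_copZeta_mul hg0]
    refine Finset.sum_congr rfl fun g' hg' => ?_
    rw [dilate_copZeta]
    rw [Nat.div_ne_zero_iff_of_dvd (Nat.dvd_of_mem_divisors hg')]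
    exact ⟨hg0, (Nat.pos_of_mem_divisors hg').ne'⟩
  rw [e1]
  have hcr : IsD3Comb (copZeta r * (copZeta 1 * copZeta 1)) t :=
    (isD3Comb_d3Fun.copZeta_mul hr).mono (by
      rw [mul_one]; exact hcard r (Dvd.intro_left δ rfl))
  refine (IsD3Comb.sum (T := t ^ 4) fun g hg => ?_).mono ?_
  · have hgd := Nat.dvd_of_mem_divisors hg
    have hg0 : δ / g ≠ 0 := by
      rw [Nat.div_ne_zero_iff_of_dvd hgd]
      exact ⟨hδ, (Nat.pos_of_mem_divisors hg).ne'⟩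
    have hgN : δ / g ∣ δ * r := (Nat.div_dvd_of_dvd hgd).mul_right r
    rw [Finset.mul_sum]
    refine (IsD3Comb.sum (T := t ^ 3) fun g' hg' => ?_).mono ?_
    · have hgd' := Nat.dvd_of_mem_divisors hg'
      have hg0' : δ / g / g' ≠ 0 := by
        rw [Nat.div_ne_zero_iff_of_dvd hgd']
        exact ⟨hg0, (Nat.pos_of_mem_divisors hg').ne'⟩
      have d1 : δ / g * r ∣ δ * r := Nat.mul_dvd_mul_right (Nat.div_dvd_of_dvd hgd) r
      have d2 : δ / g / g' * r ∣ δ * r :=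
        Nat.mul_dvd_mul_right ((Nat.div_dvd_of_dvd hgd').trans (Nat.div_dvd_of_dvd hgd)) r
      have c1 : IsD3Comb (copZeta (δ / g / g' * r) * (copZeta r * copZeta 1)) (t * t) := by
        refine (IsD3Comb.copZeta_mul (T := t) ?_ (Nat.mul_ne_zero hg0' hr)).mono
          (Nat.mul_le_mul_right _ (hcard _ d2))
        rw [show copZeta 1 * (copZeta r * copZeta 1) = copZeta r * (copZeta 1 * copZeta 1) by ring]
        exact hcr
      refine (IsD3Comb.copZeta_mul (T := t * t) ?_ (Nat.mul_ne_zero hg0 hr)).mono ?_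
      · rw [show copZeta 1 * (copZeta (δ / g / g' * r) * copZeta r) =
          copZeta (δ / g / g' * r) * (copZeta r * copZeta 1) by ring]
        exact c1
      · calc _ ≤ t * (t * t) := Nat.mul_le_mul_right _ (hcard _ d1)
          _ = t ^ 3 := by ring
    · calc _ ≤ t * t ^ 3 := Nat.mul_le_mul_right _ (hcard _ hgN)
        _ = t ^ 4 := by ring
  · calc _ ≤ t * t ^ 4 := Nat.mul_le_mul_right _ (hcard _ (Dvd.intro r rfl))
      _ = t ^ 5 := by ring

theorem sum_comb_mul {F : ℕ → ℝ} {ι : Type} [Fintype ι] {k : ι → ℝ} {e : ι → ℕ}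
    (he : ∀ i, e i ≠ 0)
    (hF : ∀ n, n ≠ 0 → F n = ∑ i, if e i ∣ n then k i * (d3 (n / e i) : ℝ) else 0)
    (y : ℝ) (f : ℕ → ℝ) :
    ∑ n ∈ Finset.Icc 1 ⌊y⌋₊, F n * f n =
      ∑ i, k i * ∑ m ∈ Finset.Icc 1 ⌊y / e i⌋₊, (d3 m : ℝ) * f (e i * m) := by
  have h1 : ∀ n ∈ Finset.Icc 1 ⌊y⌋₊, F n * f n =
      ∑ i, (if e i ∣ n then k i * ((d3 (n / e i) : ℝ) * f n) else 0) := by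
    intro n hn
    rw [hF n (by have := (Finset.mem_Icc.mp hn).1; omega), Finset.sum_mul]
    refine Finset.sum_congr rfl fun i _ => ?_
    split_ifs <;> ring
  rw [Finset.sum_congr rfl h1, Finset.sum_comm]
  refine Finset.sum_congr rfl fun i _ => ?_
  have hi : 0 < e i := Nat.pos_of_ne_zero (he i)
  rw [← Finset.sum_filter, Finset.mul_sum, Nat.floor_div_natCast]
  refine Finset.sum_bij' (fun n _ => n / e i) (fun m _ => e i * m) ?_ ?_ ?_ ?_ ?_
  · intro n hn
    obtain ⟨h, hd⟩ := Finset.mem_filter.mp hn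
    obtain ⟨h2, h3⟩ := Finset.mem_Icc.mp h
    exact Finset.mem_Icc.mpr ⟨Nat.div_pos (Nat.le_of_dvd (by omega) hd) hi,
      Nat.div_le_div_right h3⟩
  · intro m hm
    obtain ⟨h2, h3⟩ := Finset.mem_Icc.mp hm
    refine Finset.mem_filter.mpr ⟨Finset.mem_Icc.mpr ⟨Nat.mul_pos hi h2, ?_⟩, Dvd.intro _ rfl⟩
    rw [mul_comm]
    exact (Nat.le_div_iff_mul_le hi).mp h3
  · intro n hn
    exact Nat.mul_div_cancel' (Finset.mem_filter.mp hn).2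
  · intro m hm
    exact Nat.mul_div_cancel_left _ hi
  · intro n hn
    rw [Nat.mul_div_cancel' (Finset.mem_filter.mp hn).2]

theorem abs_sum_dilate_theta_le {ε : ℝ} (hε : 0 < ε) : ∃ C : ℝ, 1 ≤ C ∧
    ∀ (δ : ℕ), δ ≠ 0 → ∀ (q : ℕ) [NeZero q] (y : ℝ), 0 < y → ∀ θ : ZMod q → ℝ,
      (∀ b, |θ b| ≤ 1) → (∀ b, ¬IsUnit b → θ b = 0) → ∑ b, θ b = 0 →
      |∑ n ∈ Finset.Icc 1 ⌊y⌋₊, (d3 (δ * n) : ℝ) * θ n| ≤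
        (δ.divisors.card : ℝ) ^ 5 * (C * (y ^ ((1 : ℝ) / 2 + ε) * (q : ℝ) ^ ((3 : ℝ) / 4))) := by
  obtain ⟨C, hC, hV⟩ := abs_sum_d3_theta_le hε
  refine ⟨C, hC, ?_⟩
  intro δ hδ q _ y hy θ h1 hu h0
  obtain ⟨ι, _, k, e, hcard, hk, he, hF⟩ := isD3Comb_dilate hδ one_ne_zero
  rw [mul_one] at hcard
  have hF' : ∀ n, n ≠ 0 → (fun n => (d3 (δ * n) : ℝ)) n =
      ∑ i, if e i ∣ n then k i * (d3 (n / e i) : ℝ) else 0 := by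
    intro n hn
    rw [← hF n hn, dilate_apply, if_pos (Nat.coprime_one_right _), d3Fun_apply]
  rw [sum_comb_mul he hF' y fun n => θ n]
  set B := C * (y ^ ((1 : ℝ) / 2 + ε) * (q : ℝ) ^ ((3 : ℝ) / 4)) with hB
  have hB0 : 0 ≤ B := by positivity
  have hterm : ∀ i, |k i * ∑ m ∈ Finset.Icc 1 ⌊y / e i⌋₊,
      (d3 m : ℝ) * θ ((e i * m : ℕ) : ZMod q)| ≤ B := by
    intro i
    have hi : (1 : ℝ) ≤ e i := by exact_mod_cast Nat.pos_of_ne_zero (he i)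
    rw [abs_mul]
    refine (mul_le_of_le_one_left (abs_nonneg _) (hk i)).trans ?_
    simp only [Nat.cast_mul]
    by_cases hiu : IsUnit ((e i : ℕ) : ZMod q)
    · obtain ⟨u, hu'⟩ := hiu
      have h := hV q (y / e i) (by positivity) (fun b => θ (u * b)) (fun b => h1 _)
        (fun b hb => hu _ (by simpa using hb))
        (by rw [← h0]; exact Equiv.sum_comp (Units.mulLeft u) θ)
      rw [← hu']
      refine h.trans ?_
      rw [hB]
      gcongr
      exact div_le_self hy.le hi
    · have : ∀ m ∈ Finset.Icc 1 ⌊y / e i⌋₊, (d3 m : ℝ) * θ ((e i : ZMod q) * m) = 0 := by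
        intro m _
        rw [hu _ (fun h => hiu (isUnit_of_mul_isUnit_left h)), mul_zero]
      rw [Finset.sum_congr rfl this]
      simpa using hB0
  refine (Finset.abs_sum_le_sum_abs _ _).trans ((Finset.sum_le_sum fun i _ => hterm i).trans ?_)
  rw [Finset.sum_const, nsmul_eq_mul, Finset.card_univ]
  refine mul_le_mul_of_nonneg_right ?_ hB0
  exact_mod_cast hcard

/-- `t` times a quadratic polynomial in `log t`, for positive `t` -/
def IsLogQuad (R : ℝ → ℝ) : Prop :=
  ∃ c0 c1 c2 : ℝ, ∀ t, 0 < t → R t = t * (c0 + c1 * Real.log t + c2 * Real.log t ^ 2)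

theorem IsLogQuad.comp_div {R : ℝ → ℝ} (hR : IsLogQuad R) {e : ℝ} (he : 0 < e) :
    IsLogQuad fun t => R (t / e) := by
  obtain ⟨c0, c1, c2, h⟩ := hR
  refine ⟨(c0 - c1 * Real.log e + c2 * Real.log e ^ 2) / e, (c1 - 2 * c2 * Real.log e) / e,
    c2 / e, fun t ht => ?_⟩
  simp only
  rw [h _ (div_pos ht he), Real.log_div ht.ne' he.ne']
  field_simp
  ring

theorem IsLogQuad.sum {ι : Type} [Fintype ι] {R : ι → ℝ → ℝ} (k : ι → ℝ)
    (hR : ∀ i, IsLogQuad (R i)) : IsLogQuad fun t => ∑ i, k i * R i t := by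
  choose c0 c1 c2 h using hR
  refine ⟨∑ i, k i * c0 i, ∑ i, k i * c1 i, ∑ i, k i * c2 i, fun t ht => ?_⟩
  rw [Finset.sum_mul, Finset.sum_mul, ← Finset.sum_add_distrib, ← Finset.sum_add_distrib,
    Finset.mul_sum]
  refine Finset.sum_congr rfl fun i _ => ?_
  rw [h i t ht]
  ring

theorem sum_dilate_asymp {ε : ℝ} (hε : 0 < ε) (hε4 : ε ≤ 1 / 4) : ∃ C : ℝ, 1 ≤ C ∧
    ∀ δ r : ℕ, δ ≠ 0 → r ≠ 0 → ∃ R : ℝ → ℝ, IsLogQuad R ∧ ∀ y : ℝ, 0 < y →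
      |∑ n ∈ Finset.Icc 1 ⌊y⌋₊, (if n.Coprime r then (d3 (δ * n) : ℝ) else 0) - R y| ≤
        ((δ * r).divisors.card : ℝ) ^ 5 * (C * y ^ ((1 : ℝ) / 2 + ε)) := by
  obtain ⟨c0, c1, c2, hP⟩ := sum_d3_asymp
  obtain ⟨C, hC, hP⟩ := hP ε hε hε4
  refine ⟨C, hC, fun δ r hδ hr => ?_⟩
  obtain ⟨ι, _, k, e, hcard, hk, he, hF⟩ := isD3Comb_dilate hδ hr
  have hF' : ∀ n, n ≠ 0 → (fun n => if n.Coprime r then (d3 (δ * n) : ℝ) else 0) n =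
      ∑ i, if e i ∣ n then k i * (d3 (n / e i) : ℝ) else 0 := by
    intro n hn
    rw [← hF n hn, dilate_apply, d3Fun_apply]
  set P : ℝ → ℝ := fun y => y * (c0 + c1 * Real.log y + c2 * Real.log y ^ 2) with hPdef
  have hPq : IsLogQuad P := ⟨c0, c1, c2, fun t _ => rfl⟩
  have hi : ∀ i, (1 : ℝ) ≤ e i := fun i => by exact_mod_cast Nat.pos_of_ne_zero (he i)
  refine ⟨fun t => ∑ i, k i * P (t / e i), IsLogQuad.sum (R := fun i t => P (t / e i)) k fun i =>
    hPq.comp_div (zero_lt_one.trans_le (hi i)), fun y hy => ?_⟩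
  have h1 := sum_comb_mul he hF' y fun _ => 1
  simp only [mul_one] at h1
  rw [h1, ← Finset.sum_sub_distrib]
  have hterm : ∀ i, |k i * ∑ m ∈ Finset.Icc 1 ⌊y / e i⌋₊, (d3 m : ℝ) - k i * P (y / e i)| ≤
      C * y ^ ((1 : ℝ) / 2 + ε) := by
    intro i
    have hi' := hi i
    rw [← mul_sub, abs_mul]
    refine (mul_le_of_le_one_left (abs_nonneg _) (hk i)).trans ?_
    refine (hP (y / e i) (by positivity)).trans ?_
    gcongr
    exact div_le_self hy.le (hi i)
  refine (Finset.abs_sum_le_sum_abs _ _).trans ((Finset.sum_le_sum fun i _ => hterm i).trans ?_)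
  rw [Finset.sum_const, nsmul_eq_mul, Finset.card_univ]
  refine mul_le_mul_of_nonneg_right ?_ (by positivity)
  exact_mod_cast hcard

theorem sum_units_abs_sub_le {q : ℕ} [NeZero q] (F : ℕ → ℝ) (s : Finset ℕ) (m B : ℝ)
    (hV : ∀ θ : ZMod q → ℝ, (∀ b, |θ b| ≤ 1) → (∀ b, ¬IsUnit b → θ b = 0) → ∑ b, θ b = 0 →
      |∑ n ∈ s, F n * θ n| ≤ B) :
    ∑ u : (ZMod q)ˣ, |∑ n ∈ s.filter (fun n : ℕ => (n : ZMod q) = u), F n - m / q.totient| ≤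
      2 * B + |∑ n ∈ s, (if n.Coprime q then F n else 0) - m| := by
  classical
  set A : (ZMod q)ˣ → ℝ := fun u => ∑ n ∈ s.filter (fun n : ℕ => (n : ZMod q) = u), F n with hA
  set φ : ℝ := (q.totient : ℝ) with hφ
  have hφ0 : 0 < φ := by
    rw [hφ]; exact_mod_cast Nat.totient_pos.mpr (NeZero.pos q)
  set σ : (ZMod q)ˣ → ℝ := fun u => SignType.sign (A u - m / φ) with hσ
  have hσ1 : ∀ u, |σ u| ≤ 1 := by
    intro u
    simp only [hσ]
    rcases SignType.sign (A u - m / φ) with _ | _ | _ <;> simp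
  have hcard : (Fintype.card (ZMod q)ˣ : ℝ) = φ := by rw [ZMod.card_units_eq_totient]
  set σm : ℝ := (∑ u, σ u) / φ with hσm
  have hσm1 : |σm| ≤ 1 := by
    rw [hσm, abs_div, abs_of_pos hφ0, div_le_one hφ0]
    refine (Finset.abs_sum_le_sum_abs _ _).trans ((Finset.sum_le_sum fun u _ => hσ1 u).trans ?_)
    rw [Finset.sum_const, nsmul_eq_mul, Finset.card_univ, hcard, mul_one]
  set θ : ZMod q → ℝ := fun b => if h : IsUnit b then (σ h.unit - σm) / 2 else 0 with hθ
  have hθu : ∀ u : (ZMod q)ˣ, θ u = (σ u - σm) / 2 := by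
    intro u
    simp only [hθ]
    rw [dif_pos u.isUnit]
    congr 3
    ext; rfl
  have hsumU : ∀ g : ZMod q → ℝ, (∀ b, ¬IsUnit b → g b = 0) → ∑ b, g b = ∑ u : (ZMod q)ˣ, g u := by
    intro g hg
    symm
    refine Finset.sum_of_injOn (fun u : (ZMod q)ˣ => (u : ZMod q)) (fun _ _ _ _ h => Units.ext h)
      (fun _ _ => Finset.mem_coe.mpr (Finset.mem_univ _)) ?_ (fun _ _ => rfl)
    intro b _ hb
    refine hg b fun hu => hb ?_
    exact ⟨hu.unit, by simp, rfl⟩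
  have hθ0 : ∀ b, ¬IsUnit b → θ b = 0 := fun b hb => dif_neg hb
  have hB := hV θ (by
    intro b
    by_cases hb : IsUnit b
    · obtain ⟨u, rfl⟩ := hb
      rw [hθu, abs_div, abs_of_pos (two_pos : (0 : ℝ) < 2), div_le_one two_pos]
      refine (abs_sub _ _).trans ?_
      linarith [hσ1 u]
    · rw [hθ0 b hb]; simp) hθ0 (by
    rw [hsumU θ hθ0]
    simp only [hθu]
    rw [← Finset.sum_div, Finset.sum_sub_distrib, Finset.sum_const, nsmul_eq_mul,
      Finset.card_univ, hcard, hσm, mul_div_cancel₀ _ hφ0.ne']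
    simp)
  have hswap : ∀ g : ZMod q → ℝ, (∀ b, ¬IsUnit b → g b = 0) →
      ∑ n ∈ s, F n * g n = ∑ u : (ZMod q)ˣ, g u * A u := by
    intro g hg
    simp only [hA, Finset.mul_sum]
    have : ∀ u : (ZMod q)ˣ, ∑ n ∈ s.filter (fun n : ℕ => (n : ZMod q) = u), g u * F n =
        ∑ n ∈ s, if (n : ZMod q) = u then g u * F n else 0 := fun u => Finset.sum_filter _ _
    rw [Finset.sum_congr rfl fun u _ => this u, Finset.sum_comm]
    refine Finset.sum_congr rfl fun n _ => ?_
    rw [← hsumU (fun b => if (n : ZMod q) = b then g b * F n else 0)]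
    · rw [Finset.sum_ite_eq]
      simp [mul_comm]
    · intro b hb
      rw [hg b hb]; simp
  have hcop := hswap (fun b => if IsUnit b then 1 else 0) (fun b hb => if_neg hb)
  have hcop' : ∑ n ∈ s, (if n.Coprime q then F n else 0) = ∑ u, A u := by
    calc _ = ∑ n ∈ s, F n * (if IsUnit (n : ZMod q) then 1 else 0) := by
          refine Finset.sum_congr rfl fun n _ => ?_
          have := ZMod.isUnit_iff_coprime n q
          by_cases h : n.Coprime q <;> simp [this, h]
      _ = _ := by rw [hcop]; simp
  have habs : ∀ u, |A u - m / φ| = 2 * (θ u * A u) + σm * (A u) - σ u * (m / φ) := by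
    intro u
    rw [hθu, ← sign_mul_self]
    simp only [hσ]
    ring
  calc ∑ u, |A u - m / φ| = 2 * ∑ u : (ZMod q)ˣ, θ u * A u + σm * (∑ u, A u - m) := by
        rw [Finset.sum_congr rfl fun u _ => habs u, Finset.sum_sub_distrib,
          Finset.sum_add_distrib, ← Finset.mul_sum, ← Finset.mul_sum, ← Finset.sum_mul, hσm]
        field_simp
        ring
    _ ≤ 2 * B + |∑ n ∈ s, (if n.Coprime q then F n else 0) - m| := by
        rw [← hswap θ hθ0, hcop']
        refine add_le_add (mul_le_mul_of_nonneg_left ((le_abs_self _).trans hB) two_pos.le) ?_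
        refine (le_abs_self _).trans ?_
        rw [abs_mul]
        exact mul_le_of_le_one_left (abs_nonneg _) hσm1

theorem sum_gcd_eq {δ q : ℕ} (hq : q ≠ 0) (hδ : δ ∣ q) (t : ℝ) (f : ℕ → ℝ) :
    ∑ n ∈ Finset.Icc 1 ⌊t⌋₊, (if n.gcd q = δ then f n else 0) =
      ∑ m ∈ Finset.Icc 1 ⌊t / δ⌋₊, (if m.Coprime (q / δ) then f (δ * m) else 0) := by
  have hδ0 : 0 < δ := Nat.pos_of_dvd_of_pos hδ (Nat.pos_of_ne_zero hq)
  have hg : ∀ m, (δ * m).gcd q = δ ↔ m.Coprime (q / δ) := by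
    intro m
    conv_lhs => rw [← Nat.mul_div_cancel' hδ, Nat.gcd_mul_left]
    exact Nat.mul_eq_left hδ0.ne'
  rw [← Finset.sum_filter, ← Finset.sum_filter, Nat.floor_div_natCast]
  refine Finset.sum_bij' (fun n _ => n / δ) (fun m _ => δ * m) ?_ ?_ ?_ ?_ ?_
  · intro n hn
    obtain ⟨h, hd⟩ := Finset.mem_filter.mp hn
    obtain ⟨h2, h3⟩ := Finset.mem_Icc.mp h
    have hdn : δ ∣ n := hd ▸ Nat.gcd_dvd_left n q
    refine Finset.mem_filter.mpr ⟨Finset.mem_Icc.mpr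
      ⟨Nat.div_pos (Nat.le_of_dvd (by omega) hdn) hδ0, Nat.div_le_div_right h3⟩, ?_⟩
    rw [← hg, Nat.mul_div_cancel' hdn, hd]
  · intro m hm
    obtain ⟨h, hd⟩ := Finset.mem_filter.mp hm
    obtain ⟨h2, h3⟩ := Finset.mem_Icc.mp h
    refine Finset.mem_filter.mpr ⟨Finset.mem_Icc.mpr ⟨Nat.mul_pos hδ0 h2, ?_⟩, (hg m).mpr hd⟩
    rw [mul_comm]
    exact (Nat.le_div_iff_mul_le hδ0).mp h3
  · intro n hn
    exact Nat.mul_div_cancel' ((Finset.mem_filter.mp hn).2 ▸ Nat.gcd_dvd_left n q)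
  · intro m hm
    exact Nat.mul_div_cancel_left _ hδ0
  · intro n hn
    rw [Nat.mul_div_cancel' ((Finset.mem_filter.mp hn).2 ▸ Nat.gcd_dvd_left n q)]

theorem sum_residue_eq {δ q a : ℕ} (hq : q ≠ 0) (hδ : δ ∣ q) (ha : δ ∣ a) (t : ℝ) (f : ℕ → ℝ) :
    ∑ n ∈ (Finset.Icc 1 ⌊t⌋₊).filter (fun n => n % q = a % q), f n =
      ∑ m ∈ (Finset.Icc 1 ⌊t / δ⌋₊).filter
        (fun m : ℕ => (m : ZMod (q / δ)) = ((a / δ : ℕ) : ZMod (q / δ))), f (δ * m) := by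
  have hδ0 : 0 < δ := Nat.pos_of_dvd_of_pos hδ (Nat.pos_of_ne_zero hq)
  have hg : ∀ m : ℕ, (m : ZMod (q / δ)) = ((a / δ : ℕ) : ZMod (q / δ)) ↔
      δ * m ≡ a [MOD q] := by
    intro m
    rw [ZMod.natCast_eq_natCast_iff]
    conv_rhs => rw [← Nat.mul_div_cancel' ha, ← Nat.mul_div_cancel' hδ]
    exact ⟨fun h => Nat.ModEq.mul_left' δ h, fun h => Nat.ModEq.mul_left_cancel' hδ0.ne' h⟩
  have hdvd : ∀ n, n % q = a % q → δ ∣ n := fun n hn =>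
    ((Nat.ModEq.dvd_iff (show n ≡ a [MOD q] from hn) hδ)).mpr ha
  rw [Nat.floor_div_natCast]
  refine Finset.sum_bij' (fun n _ => n / δ) (fun m _ => δ * m) ?_ ?_ ?_ ?_ ?_
  · intro n hn
    obtain ⟨h, hd⟩ := Finset.mem_filter.mp hn
    obtain ⟨h2, h3⟩ := Finset.mem_Icc.mp h
    have hdn := hdvd n hd
    refine Finset.mem_filter.mpr ⟨Finset.mem_Icc.mpr
      ⟨Nat.div_pos (Nat.le_of_dvd (by omega) hdn) hδ0, Nat.div_le_div_right h3⟩, ?_⟩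
    rw [hg, Nat.mul_div_cancel' hdn]
    exact hd
  · intro m hm
    obtain ⟨h, hd⟩ := Finset.mem_filter.mp hm
    obtain ⟨h2, h3⟩ := Finset.mem_Icc.mp h
    refine Finset.mem_filter.mpr ⟨Finset.mem_Icc.mpr ⟨Nat.mul_pos hδ0 h2, ?_⟩, (hg m).mp hd⟩
    rw [mul_comm]
    exact (Nat.le_div_iff_mul_le hδ0).mp h3
  · intro n hn
    exact Nat.mul_div_cancel' (hdvd n (Finset.mem_filter.mp hn).2)
  · intro m hm
    exact Nat.mul_div_cancel_left _ hδ0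
  · intro n hn
    rw [Nat.mul_div_cancel' (hdvd n (Finset.mem_filter.mp hn).2)]

theorem sum_gcd_class_le {δ q : ℕ} [NeZero (q / δ)] (hq : q ≠ 0) (hδ : δ ∣ q) (t m : ℝ) (f : ℕ → ℝ) :
    ∑ a ∈ (Finset.Icc 1 q).filter (fun a => q.gcd a = δ),
      |∑ n ∈ (Finset.Icc 1 ⌊t⌋₊).filter (fun n => n % q = a % q), f n - m| ≤
    ∑ u : (ZMod (q / δ))ˣ, |∑ n ∈ (Finset.Icc 1 ⌊t / δ⌋₊).filter
      (fun n : ℕ => (n : ZMod (q / δ)) = u), f (δ * n) - m| := by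
  classical
  have hδ0 : 0 < δ := Nat.pos_of_dvd_of_pos hδ (Nat.pos_of_ne_zero hq)
  set i : ℕ → (ZMod (q / δ))ˣ := fun a =>
    if h : (a / δ).Coprime (q / δ) then ZMod.unitOfCoprime (a / δ) h else 1 with hi
  have hi' : ∀ a ∈ (Finset.Icc 1 q).filter (fun a => q.gcd a = δ),
      δ ∣ a ∧ ((i a : (ZMod (q / δ))ˣ) : ZMod (q / δ)) = ((a / δ : ℕ) : ZMod (q / δ)) := by
    intro a ha
    obtain ⟨h1, h2⟩ := Finset.mem_filter.mp ha
    have hda : δ ∣ a := h2 ▸ Nat.gcd_dvd_right q a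
    have hc : (a / δ).Coprime (q / δ) := by
      have := Nat.coprime_div_gcd_div_gcd (m := q) (n := a) (by rw [h2]; exact hδ0)
      rw [h2] at this
      exact this.symm
    refine ⟨hda, ?_⟩
    simp only [hi]
    rw [dif_pos hc, ZMod.coe_unitOfCoprime]
  have hinj : Set.InjOn i ((Finset.Icc 1 q).filter (fun a => q.gcd a = δ) : Finset ℕ) := by
    intro a ha b hb hab
    have ha' := hi' a ha
    have hb' := hi' b hb
    have h1 := ha'.2.symm.trans ((congrArg _ hab).trans hb'.2)
    rw [ZMod.natCast_eq_natCast_iff] at h1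
    have h2 := Nat.ModEq.mul_left' δ h1
    rw [Nat.mul_div_cancel' ha'.1, Nat.mul_div_cancel' hb'.1, Nat.mul_div_cancel' hδ] at h2
    have ha1 := Finset.mem_Icc.mp (Finset.mem_filter.mp ha).1
    have hb1 := Finset.mem_Icc.mp (Finset.mem_filter.mp hb).1
    have h3 : (a - 1) ≡ (b - 1) [MOD q] := by
      refine Nat.ModEq.add_right_cancel' 1 ?_
      rwa [Nat.sub_add_cancel ha1.1, Nat.sub_add_cancel hb1.1]
    have := Nat.ModEq.eq_of_lt_of_lt h3 (by omega) (by omega)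
    omega
  have hcongr : ∀ a ∈ (Finset.Icc 1 q).filter (fun a => q.gcd a = δ),
      |∑ n ∈ (Finset.Icc 1 ⌊t⌋₊).filter (fun n => n % q = a % q), f n - m| =
      |∑ n ∈ (Finset.Icc 1 ⌊t / δ⌋₊).filter
      (fun n : ℕ => (n : ZMod (q / δ)) = i a), f (δ * n) - m| := by
    intro a ha
    rw [sum_residue_eq hq hδ (hi' a ha).1, (hi' a ha).2]
  rw [Finset.sum_congr rfl hcongr,
    ← Finset.sum_image (f := fun u : (ZMod (q / δ))ˣ => |∑ n ∈ (Finset.Icc 1 ⌊t / δ⌋₊).filter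
      (fun n : ℕ => (n : ZMod (q / δ)) = u), f (δ * n) - m|) hinj]
  exact Finset.sum_le_sum_of_subset_of_nonneg (Finset.subset_univ _) fun _ _ _ => abs_nonneg _

theorem sum_abs_error_le {ε : ℝ} (hε : 0 < ε) (hε4 : ε ≤ 1 / 4) : ∃ C : ℝ, 1 ≤ C ∧
    ∀ q : ℕ, q ≠ 0 → ∃ R : ℕ → ℝ → ℝ,
      (∀ δ, δ ∣ q → IsLogQuad (R δ) ∧ ∃ K : ℝ, ∀ t : ℝ, 0 < t →
        |∑ n ∈ Finset.Icc 1 ⌊t⌋₊, (if n.gcd q = δ then (d3 n : ℝ) else 0) - R δ t| ≤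
          K * t ^ ((1 : ℝ) / 2 + ε)) ∧
      ∀ x : ℝ, 0 < x → ∑ a ∈ Finset.Icc 1 q,
        |∑ n ∈ (Finset.Icc 1 ⌊x⌋₊).filter (fun n => n % q = a % q), (d3 n : ℝ) -
          R (q.gcd a) x / (q / q.gcd a).totient| ≤
        C * x ^ ((1 : ℝ) / 2 + ε) * (q : ℝ) ^ ((3 : ℝ) / 4) := by
  classical
  obtain ⟨C1, hC1, hV⟩ := abs_sum_dilate_theta_le hε
  obtain ⟨C2, hC2, hD⟩ := sum_dilate_asymp hε hε4
  obtain ⟨C3, hC3, hτ⟩ := card_divisors_le_rpow (show (0 : ℝ) < 1 / 8 by norm_num)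
  obtain ⟨C4, hC4, hτ'⟩ := card_divisors_le_rpow (show (0 : ℝ) < 1 / 40 by norm_num)
  have hsumm : Summable fun n : ℕ => (n : ℝ) ^ (-(9 / 8) : ℝ) :=
    Real.summable_nat_rpow.mpr (by norm_num)
  set S : ℝ := ∑' n : ℕ, (n : ℝ) ^ (-(9 / 8) : ℝ) with hS
  have hS0 : 0 ≤ S := tsum_nonneg fun n => by positivity
  refine ⟨2 * (C4 ^ 5 * C1 * S) + C3 ^ 6 * C2, ?_, fun q hq => ?_⟩
  · have h1 : 1 ≤ C3 ^ 6 := one_le_pow₀ hC3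
    have h2 : 1 ≤ C3 ^ 6 * C2 := one_le_mul_of_one_le_of_one_le h1 hC2
    have h3 : 0 ≤ 2 * (C4 ^ 5 * C1 * S) := by positivity
    linarith
  have hδ0 : ∀ δ, δ ∣ q → δ ≠ 0 := fun δ h => (Nat.pos_of_dvd_of_pos h (Nat.pos_of_ne_zero hq)).ne'
  have hq'0 : ∀ δ, δ ∣ q → q / δ ≠ 0 := fun δ h => by
    rw [Nat.div_ne_zero_iff_of_dvd h]; exact ⟨hq, hδ0 δ h⟩
  have hR : ∀ δ, ∃ R : ℝ → ℝ, δ ∣ q → IsLogQuad R ∧ ∀ t : ℝ, 0 < t →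
      |∑ n ∈ Finset.Icc 1 ⌊t⌋₊, (if n.gcd q = δ then (d3 n : ℝ) else 0) - R t| ≤
        ((q.divisors.card : ℝ) ^ 5 * C2) * t ^ ((1 : ℝ) / 2 + ε) := by
    intro δ
    by_cases h : δ ∣ q
    swap
    · exact ⟨fun _ => 0, fun h' => absurd h' h⟩
    obtain ⟨R, hRq, hR⟩ := hD δ (q / δ) (hδ0 δ h) (hq'0 δ h)
    have hd1 : (1 : ℝ) ≤ δ := by exact_mod_cast Nat.pos_of_ne_zero (hδ0 δ h)
    refine ⟨fun t => R (t / δ), fun _ => ⟨hRq.comp_div (by positivity), fun t ht => ?_⟩⟩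
    rw [sum_gcd_eq hq h]
    refine (hR (t / δ) (by positivity)).trans ?_
    rw [Nat.mul_div_cancel' h, mul_assoc]
    gcongr
    exact div_le_self ht.le hd1
  choose R hR using hR
  refine ⟨R, fun δ h => ⟨(hR δ h).1, _, (hR δ h).2⟩, fun x hx => ?_⟩
  set X := x ^ ((1 : ℝ) / 2 + ε) with hX
  have hX0 : 0 < X := by positivity
  have hq0 : (0 : ℝ) < q := by exact_mod_cast Nat.pos_of_ne_zero hq
  have hmaps : ∀ a ∈ Finset.Icc 1 q, q.gcd a ∈ q.divisors := fun a _ =>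
    Nat.mem_divisors.mpr ⟨Nat.gcd_dvd_left q a, hq⟩
  rw [← Finset.sum_fiberwise_of_maps_to hmaps]
  have hterm : ∀ δ ∈ q.divisors, ∑ a ∈ (Finset.Icc 1 q).filter (fun a => q.gcd a = δ),
        |∑ n ∈ (Finset.Icc 1 ⌊x⌋₊).filter (fun n => n % q = a % q), (d3 n : ℝ) -
          R (q.gcd a) x / (q / q.gcd a).totient| ≤
      2 * (C4 ^ 5 * C1 * X * (q : ℝ) ^ ((3 : ℝ) / 4)) * (δ : ℝ) ^ (-(9 / 8) : ℝ) +
        (q.divisors.card : ℝ) ^ 5 * C2 * X := by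
    intro δ hδ
    have h := Nat.dvd_of_mem_divisors hδ
    have hd1 : (1 : ℝ) ≤ δ := by exact_mod_cast Nat.pos_of_ne_zero (hδ0 δ h)
    have hd0 : (0 : ℝ) < δ := by positivity
    have : NeZero (q / δ) := ⟨hq'0 δ h⟩
    have e1 : ∀ a ∈ (Finset.Icc 1 q).filter (fun a => q.gcd a = δ),
        |∑ n ∈ (Finset.Icc 1 ⌊x⌋₊).filter (fun n => n % q = a % q), (d3 n : ℝ) -
          R (q.gcd a) x / (q / q.gcd a).totient| =
        |∑ n ∈ (Finset.Icc 1 ⌊x⌋₊).filter (fun n => n % q = a % q), (d3 n : ℝ) -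
          R δ x / (q / δ).totient| := by
      intro a ha
      rw [(Finset.mem_filter.mp ha).2]
    rw [Finset.sum_congr rfl e1]
    refine (sum_gcd_class_le hq h x _ fun n => (d3 n : ℝ)).trans ?_
    refine (sum_units_abs_sub_le (fun n => (d3 (δ * n) : ℝ)) _ (R δ x) _
      (hV δ (hδ0 δ h) (q / δ) (x / δ) (by positivity))).trans ?_
    have e2 := (hR δ h).2 x hx
    rw [sum_gcd_eq hq h] at e2
    refine add_le_add ?_ e2
    have e3 : (δ.divisors.card : ℝ) ^ 5 ≤ C4 ^ 5 * (δ : ℝ) ^ (1 / 8 : ℝ) := by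
      calc (δ.divisors.card : ℝ) ^ 5 ≤ (C4 * (δ : ℝ) ^ (1 / 40 : ℝ)) ^ 5 := by
            gcongr; exact hτ' δ (hδ0 δ h)
        _ = _ := by
            rw [mul_pow, ← Real.rpow_natCast ((δ : ℝ) ^ (1 / 40 : ℝ)), ← Real.rpow_mul hd0.le]
            norm_num
    have e4 : (x / δ) ^ ((1 : ℝ) / 2 + ε) ≤ X * (δ : ℝ) ^ (-(1 / 2) : ℝ) := by
      rw [Real.div_rpow hx.le hd0.le, div_eq_mul_inv, ← Real.rpow_neg hd0.le]
      gcongr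
      linarith
    have e5 : ((q / δ : ℕ) : ℝ) ^ ((3 : ℝ) / 4) =
        (q : ℝ) ^ ((3 : ℝ) / 4) * (δ : ℝ) ^ (-(3 / 4) : ℝ) := by
      rw [Nat.cast_div h hd0.ne', Real.div_rpow hq0.le hd0.le, div_eq_mul_inv,
        ← Real.rpow_neg hd0.le]
    have e6 : (δ : ℝ) ^ (-(9 / 8) : ℝ) =
        (δ : ℝ) ^ (1 / 8 : ℝ) * ((δ : ℝ) ^ (-(1 / 2) : ℝ) * (δ : ℝ) ^ (-(3 / 4) : ℝ)) := by
      rw [← Real.rpow_add hd0, ← Real.rpow_add hd0]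
      norm_num
    calc 2 * ((δ.divisors.card : ℝ) ^ 5 * (C1 * ((x / δ) ^ ((1 : ℝ) / 2 + ε) *
          ((q / δ : ℕ) : ℝ) ^ ((3 : ℝ) / 4))))
        ≤ 2 * (C4 ^ 5 * (δ : ℝ) ^ (1 / 8 : ℝ) * (C1 * (X * (δ : ℝ) ^ (-(1 / 2) : ℝ) *
          ((q : ℝ) ^ ((3 : ℝ) / 4) * (δ : ℝ) ^ (-(3 / 4) : ℝ))))) := by
          rw [e5]
          gcongr
      _ = _ := by rw [e6]; ring
  refine (Finset.sum_le_sum hterm).trans ?_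
  rw [Finset.sum_add_distrib, ← Finset.mul_sum, Finset.sum_const, nsmul_eq_mul]
  have f1 : ∑ δ ∈ q.divisors, (δ : ℝ) ^ (-(9 / 8) : ℝ) ≤ S :=
    hsumm.sum_le_tsum _ fun n _ => by positivity
  have f2 : (q.divisors.card : ℝ) ^ 6 ≤ C3 ^ 6 * (q : ℝ) ^ ((3 : ℝ) / 4) := by
    calc (q.divisors.card : ℝ) ^ 6 ≤ (C3 * (q : ℝ) ^ (1 / 8 : ℝ)) ^ 6 := by
          gcongr; exact hτ q hq
      _ = _ := by
          rw [mul_pow, ← Real.rpow_natCast ((q : ℝ) ^ (1 / 8 : ℝ)), ← Real.rpow_mul hq0.le]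
          norm_num
  calc _ ≤ 2 * (C4 ^ 5 * C1 * X * (q : ℝ) ^ ((3 : ℝ) / 4)) * S +
        (q.divisors.card : ℝ) ^ 6 * (C2 * X) := by
        refine add_le_add (by gcongr) (le_of_eq (by ring))
    _ ≤ 2 * (C4 ^ 5 * C1 * X * (q : ℝ) ^ ((3 : ℝ) / 4)) * S +
        C3 ^ 6 * (q : ℝ) ^ ((3 : ℝ) / 4) * (C2 * X) := by gcongr
    _ = _ := by ring

open Filter in
theorem logQuad_isBigO (c0 c1 c2 : ℝ) {η : ℝ} (hη : 0 < η) :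
    (fun t : ℝ => c0 + c1 * Real.log t + c2 * Real.log t ^ 2) =O[atTop] fun t : ℝ => t ^ η := by
  have h0 : (fun _ : ℝ => c0) =O[atTop] fun t : ℝ => t ^ η := by
    refine Asymptotics.IsLittleO.isBigO (Asymptotics.isLittleO_const_left.mpr (Or.inr ?_))
    exact tendsto_abs_atTop_atTop.comp (tendsto_rpow_atTop hη)
  have h1 : (fun t : ℝ => c1 * Real.log t) =O[atTop] fun t : ℝ => t ^ η :=
    (isLittleO_log_rpow_atTop hη).isBigO.const_mul_left c1
  have h2 : (fun t : ℝ => c2 * Real.log t ^ 2) =O[atTop] fun t : ℝ => t ^ η := by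
    refine Asymptotics.IsBigO.const_mul_left ?_ c2
    refine ((isLittleO_log_rpow_atTop (half_pos hη)).isBigO.pow 2).trans_eventuallyEq ?_
    filter_upwards [eventually_gt_atTop 0] with t ht
    rw [← Real.rpow_natCast, ← Real.rpow_mul ht.le]
    norm_num
  exact (h0.add h1).add h2

open Filter in
theorem rpow_mul_logQuad_isBigO (c0 c1 c2 : ℝ) (s : ℝ) {η : ℝ} (hη : 0 < η) :
    (fun t : ℝ => t ^ s * (c0 + c1 * Real.log t + c2 * Real.log t ^ 2)) =O[atTop]
      fun t : ℝ => t ^ (s + η) := by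
  refine ((Asymptotics.isBigO_refl _ _).mul (logQuad_isBigO c0 c1 c2 hη)).trans_eventuallyEq ?_
  filter_upwards [eventually_gt_atTop 0] with t ht
  rw [Real.rpow_add ht]

theorem integrableOn_rpow_mul_logQuad (c0 c1 c2 : ℝ) {w : ℝ} (hw : 0 < w) :
    MeasureTheory.IntegrableOn
      (fun t : ℝ => t ^ (-1 - w) * (c0 + c1 * Real.log t + c2 * Real.log t ^ 2)) (Set.Ioi 1) := by
  have hcont : ContinuousOn
      (fun t : ℝ => t ^ (-1 - w) * (c0 + c1 * Real.log t + c2 * Real.log t ^ 2)) (Set.Ici 1) := by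
    have hne : ∀ t ∈ Set.Ici (1 : ℝ), t ≠ 0 := fun t ht => (zero_lt_one.trans_le ht).ne'
    have hl : ContinuousOn Real.log (Set.Ici 1) := Real.continuousOn_log.mono fun t ht => hne t ht
    refine ContinuousOn.mul (ContinuousOn.rpow_const continuousOn_id fun t ht => Or.inl (hne t ht)) ?_
    exact (continuousOn_const.add (continuousOn_const.mul hl)).add
      (continuousOn_const.mul (hl.pow 2))
  refine MeasureTheory.IntegrableOn.mono_set ?_ Set.Ioi_subset_Ici_self
  refine (hcont.locallyIntegrableOn measurableSet_Ici).integrableOn_of_isBigO_atTop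
    (rpow_mul_logQuad_isBigO c0 c1 c2 (-1 - w) (half_pos hw)) ?_
  rw [integrableAtFilter_rpow_atTop_iff]
  linarith

theorem integral_rpow_mul_logQuad (c0 c1 c2 : ℝ) {w : ℝ} (hw : 0 < w) :
    ∫ t in Set.Ioi (1 : ℝ), t ^ (-1 - w) * (c0 + c1 * Real.log t + c2 * Real.log t ^ 2) =
      c0 / w + c1 / w ^ 2 + 2 * c2 / w ^ 3 := by
  set a2 := c2 / w with ha2
  set a1 := (c1 + 2 * a2) / w with ha1
  set a0 := (c0 + a1) / w with ha0
  have h := MeasureTheory.integral_Ioi_of_hasDerivAt_of_tendsto' (a := (1 : ℝ)) (m := 0)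
    (f := fun t => -(t ^ (-w) * (a0 + a1 * Real.log t + a2 * Real.log t ^ 2)))
    (f' := fun t => t ^ (-1 - w) * (c0 + c1 * Real.log t + c2 * Real.log t ^ 2)) ?_
    (integrableOn_rpow_mul_logQuad c0 c1 c2 hw) ?_
  · rw [h, ha0, ha1, ha2]
    simp
    field_simp
    ring
  · intro t ht
    have ht0 : t ≠ 0 := (zero_lt_one.trans_le ht).ne'
    have hl := Real.hasDerivAt_log ht0
    have hr := Real.hasDerivAt_rpow_const (x := t) (p := -w) (Or.inl ht0)
    refine (hr.mul (((hasDerivAt_const t a0).add (hl.const_mul a1)).add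
      ((hl.pow 2).const_mul a2))).neg.congr_deriv ?_
    have e1 : t ^ (-w) = t ^ (-1 - w) * t := by
      rw [← Real.rpow_add_one ht0]; congr 1; ring
    rw [e1, show -w - 1 = -1 - w by ring]
    have e0 : a0 * w = c0 + a1 := by rw [ha0]; field_simp
    have e1 : a1 * w = c1 + 2 * a2 := by rw [ha1]; field_simp
    have e2 : a2 * w = c2 := by rw [ha2]; field_simp
    simp only [Pi.add_apply, Pi.pow_apply]
    field_simp
    simp only [Nat.cast_ofNat, Nat.add_one_sub_one, pow_one]
    linear_combination t ^ (-1 - w) * e0 + t ^ (-1 - w) * Real.log t * e1 +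
      t ^ (-1 - w) * Real.log t ^ 2 * e2
  · have h2 := (rpow_mul_logQuad_isBigO a0 a1 a2 (-w) (half_pos hw)).trans_tendsto (by
      rw [show -w + w / 2 = -(w / 2) by ring]
      exact tendsto_rpow_neg_atTop (half_pos hw))
    simpa using h2.neg

theorem integral_sum_sub_logQuad {f : ℕ → ℝ} {c0 c1 c2 K : ℝ}
    (hf : ∀ t : ℝ, 1 ≤ t → |∑ n ∈ Finset.Icc 1 ⌊t⌋₊, f n -
      t * (c0 + c1 * Real.log t + c2 * Real.log t ^ 2)| ≤ K * t ^ ((3 : ℝ) / 4))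
    {w : ℝ} (hw : 0 < w) :
    |(∫ t in Set.Ioi (1 : ℝ), (∑ n ∈ Finset.Icc 1 ⌊t⌋₊, f n) * t ^ (-2 - w)) -
      (c0 / w + c1 / w ^ 2 + 2 * c2 / w ^ 3)| ≤ 4 * K := by
  have hP := integrableOn_rpow_mul_logQuad c0 c1 c2 hw
  set P : ℝ → ℝ := fun t => t ^ (-1 - w) * (c0 + c1 * Real.log t + c2 * Real.log t ^ 2) with hPd
  set A : ℝ → ℝ := fun t => (∑ n ∈ Finset.Icc 1 ⌊t⌋₊, f n) * t ^ (-2 - w) with hAd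
  have hK : 0 ≤ K := by
    have := (abs_nonneg _).trans (hf 1 le_rfl)
    simpa using this
  have hPm : Measurable P := by
    have := Real.measurable_log
    fun_prop
  have hAm : Measurable A := by
    have h1 : Measurable fun t : ℝ => ∑ n ∈ Finset.Icc 1 ⌊t⌋₊, f n :=
      (measurable_from_top (f := fun N : ℕ => ∑ n ∈ Finset.Icc 1 N, f n)).comp Nat.measurable_floor
    exact h1.mul (by fun_prop)
  have hg : MeasureTheory.IntegrableOn (fun t : ℝ => K * t ^ (-(5 / 4) : ℝ)) (Set.Ioi 1) :=
    (integrableOn_Ioi_rpow_of_lt (by norm_num) zero_lt_one).const_mul K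
  have hbd : ∀ t ∈ Set.Ioi (1 : ℝ), ‖A t - P t‖ ≤ K * t ^ (-(5 / 4) : ℝ) := by
    intro t ht
    have ht0 : 0 < t := zero_lt_one.trans ht
    have e1 : A t - P t = (∑ n ∈ Finset.Icc 1 ⌊t⌋₊, f n -
      t * (c0 + c1 * Real.log t + c2 * Real.log t ^ 2)) * t ^ (-2 - w) := by
      simp only [hAd, hPd]
      rw [show -1 - w = (-2 - w) + 1 by ring, Real.rpow_add_one ht0.ne']
      ring
    rw [e1, Real.norm_eq_abs, abs_mul, abs_of_pos (Real.rpow_pos_of_pos ht0 (-2 - w))]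
    calc _ ≤ K * t ^ ((3 : ℝ) / 4) * t ^ (-2 - w) := by
          gcongr
          exact hf t (le_of_lt ht)
      _ = K * t ^ ((3 : ℝ) / 4 + (-2 - w)) := by rw [Real.rpow_add ht0]; ring
      _ ≤ K * t ^ (-(5 / 4) : ℝ) := by
          gcongr
          · exact le_of_lt ht
          · linarith
  have hAP : MeasureTheory.IntegrableOn (fun t => A t - P t) (Set.Ioi 1) := by
    refine MeasureTheory.Integrable.mono' hg (hAm.sub hPm).aestronglyMeasurable ?_
    exact (MeasureTheory.ae_restrict_iff' measurableSet_Ioi).mpr (MeasureTheory.ae_of_all _ hbd)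
  have hA : MeasureTheory.IntegrableOn A (Set.Ioi 1) := by
    refine (hAP.add hP).congr_fun (fun t _ => ?_) measurableSet_Ioi
    simp
  rw [← integral_rpow_mul_logQuad c0 c1 c2 hw, ← MeasureTheory.integral_sub hA hP]
  refine (MeasureTheory.norm_integral_le_of_norm_le hg
    ((MeasureTheory.ae_restrict_iff' measurableSet_Ioi).mpr (MeasureTheory.ae_of_all _ hbd))).trans ?_
  rw [MeasureTheory.integral_const_mul, integral_Ioi_rpow_of_lt (by norm_num) zero_lt_one]
  norm_num
  linarith

open Filter Topology in
theorem iteratedDeriv_two_eq_zero {h : ℂ → ℂ} (hh : AnalyticAt ℂ h 0) {K : ℝ}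
    (hK : ∀ᶠ w : ℝ in 𝓝[>] 0, ‖h w‖ ≤ K * w ^ 3) : iteratedDeriv 2 h 0 = 0 := by
  suffices H : ((3 : ℕ) : ℕ∞) ≤ analyticOrderAt h 0 from
    (natCast_le_analyticOrderAt_iff_iteratedDeriv_eq_zero hh).mp H 2 (by norm_num)
  by_contra hlt
  rw [not_le] at hlt
  obtain ⟨n, hn⟩ := ENat.ne_top_iff_exists.mp (ne_top_of_lt hlt)
  rw [← hn, Nat.cast_lt] at hlt
  obtain ⟨k, hk, hk0, hkh⟩ := hh.analyticOrderAt_eq_natCast.mp hn.symm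
  have hcast : Tendsto (fun w : ℝ => (w : ℂ)) (𝓝[>] 0) (𝓝 0) := by
    have := (Complex.continuous_ofReal.tendsto 0).mono_left (nhdsWithin_le_nhds (s := Set.Ioi 0))
    simpa using this
  have h1 : Tendsto (fun w : ℝ => ‖k w‖) (𝓝[>] 0) (𝓝 ‖k 0‖) :=
    (hk.continuousAt.tendsto.comp hcast).norm
  have h2 : Tendsto (fun w : ℝ => K * w ^ (3 - n)) (𝓝[>] 0) (𝓝 0) := by
    have : Continuous fun w : ℝ => K * w ^ (3 - n) := by fun_prop
    have := (this.tendsto 0).mono_left (nhdsWithin_le_nhds (s := Set.Ioi 0))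
    simpa [zero_pow (show 3 - n ≠ 0 by omega)] using this
  refine hk0 (norm_le_zero_iff.mp (le_of_tendsto_of_tendsto h1 h2 ?_))
  filter_upwards [hK, hcast.eventually hkh, self_mem_nhdsWithin] with w hw hw2 hw0
  have hw0' : (0 : ℝ) < w := hw0
  rw [hw2, sub_zero, norm_smul, norm_pow, Complex.norm_real, Real.norm_of_nonneg hw0'.le] at hw
  refine le_of_mul_le_mul_left ?_ (pow_pos hw0' n)
  refine hw.trans (le_of_eq ?_)
  rw [mul_left_comm, ← pow_add]
  congr 2
  omega

theorem iteratedDeriv_two_quad_mul_exp (b0 b1 b2 L : ℂ) :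
    iteratedDeriv 2 (fun z : ℂ => (b0 + b1 * z + b2 * z ^ 2) * Complex.exp (L * z)) 0 =
      b0 * L ^ 2 + 2 * b1 * L + 2 * b2 := by
  have hd : ∀ (b0 b1 b2 z : ℂ),
      HasDerivAt (fun z : ℂ => (b0 + b1 * z + b2 * z ^ 2) * Complex.exp (L * z))
        (((b1 + b0 * L) + (2 * b2 + b1 * L) * z + (b2 * L) * z ^ 2) * Complex.exp (L * z)) z := by
    intro b0 b1 b2 z
    have h1 : HasDerivAt (fun z : ℂ => b0 + b1 * z + b2 * z ^ 2) (b1 + b2 * (2 * z)) z := by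
      have := (((hasDerivAt_id z).const_mul b1).const_add b0).add
        (((hasDerivAt_id z).pow 2).const_mul b2)
      refine this.congr_deriv ?_
      simp
    have h2 : HasDerivAt (fun z : ℂ => Complex.exp (L * z)) (Complex.exp (L * z) * L) z := by
      refine ((hasDerivAt_id z).const_mul L).cexp.congr_deriv ?_
      simp
    refine (h1.mul h2).congr_deriv ?_
    ring
  rw [iteratedDeriv_succ, iteratedDeriv_one]
  have e1 := funext fun z => (hd b0 b1 b2 z).deriv
  rw [e1, (hd _ _ _ 0).deriv]
  simp
  ring

open Filter in
theorem sum_isBigO_rpow {f : ℕ → ℝ} {c0 c1 c2 K : ℝ}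
    (hf : ∀ t : ℝ, 1 ≤ t → |∑ n ∈ Finset.Icc 1 ⌊t⌋₊, f n -
      t * (c0 + c1 * Real.log t + c2 * Real.log t ^ 2)| ≤ K * t ^ ((3 : ℝ) / 4))
    {η : ℝ} (hη : 0 < η) :
    (fun n : ℕ => ∑ k ∈ Finset.Icc 1 n, f k) =O[atTop] fun n : ℕ => (n : ℝ) ^ (1 + η) := by
  have h1 : (fun t : ℝ => ∑ n ∈ Finset.Icc 1 ⌊t⌋₊, f n) =O[atTop] fun t : ℝ => t ^ (1 + η) := by
    have h2 : (fun t : ℝ => ∑ n ∈ Finset.Icc 1 ⌊t⌋₊, f n -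
        t * (c0 + c1 * Real.log t + c2 * Real.log t ^ 2)) =O[atTop] fun t : ℝ => t ^ (1 + η) := by
      refine Asymptotics.IsBigO.of_bound K ?_
      filter_upwards [eventually_ge_atTop 1] with t ht
      have hK : 0 ≤ K := by
        have := (abs_nonneg _).trans (hf 1 le_rfl)
        simpa using this
      rw [Real.norm_eq_abs, Real.norm_of_nonneg (by positivity)]
      refine (hf t ht).trans ?_
      gcongr
      linarith
    have h3 : (fun t : ℝ => t * (c0 + c1 * Real.log t + c2 * Real.log t ^ 2)) =O[atTop]
        fun t : ℝ => t ^ (1 + η) := by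
      simpa using rpow_mul_logQuad_isBigO c0 c1 c2 1 hη
    simpa using h2.add h3
  simpa [Function.comp_def] using h1.comp_tendsto tendsto_natCast_atTop_atTop

theorem dirichlet_series_expansion {f : ℕ → ℝ} (hf0 : ∀ n, 0 ≤ f n) {c0 c1 c2 K : ℝ}
    (hf : ∀ t : ℝ, 1 ≤ t → |∑ n ∈ Finset.Icc 1 ⌊t⌋₊, f n -
      t * (c0 + c1 * Real.log t + c2 * Real.log t ^ 2)| ≤ K * t ^ ((3 : ℝ) / 4))
    {D : ℂ → ℂ} (hD : ∀ s : ℂ, 1 < s.re → HasSum (fun n : ℕ => (f n : ℂ) / (n : ℂ) ^ s) (D s))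
    {w : ℝ} (hw : 0 < w) :
    ‖(w : ℂ) ^ 3 * D (1 + w) / (1 + w) - (2 * c2 + c1 * w + c0 * w ^ 2)‖ ≤ 4 * K * w ^ 3 := by
  have hre : (1 + (w : ℂ)).re = 1 + w := by simp
  have h1 := LSeries_eq_mul_integral_of_nonneg f (r := 1 + w / 2) (by linarith)
    (s := 1 + (w : ℂ)) (by rw [hre]; linarith) (sum_isBigO_rpow hf (half_pos hw)) hf0
  have h2 : LSeries (fun n => (f n : ℂ)) (1 + w) = D (1 + w) := by
    have hs : (1 + w : ℂ) ≠ 0 := by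
      intro h
      have := congrArg Complex.re h
      rw [hre] at this
      simp at this
      linarith
    rw [← (hD (1 + w) (by rw [hre]; linarith)).tsum_eq]
    refine tsum_congr fun n => ?_
    rw [LSeries.term_def]
    split_ifs with hn
    · simp [hn, Complex.zero_cpow hs]
    · rfl
  set I : ℝ := ∫ t in Set.Ioi (1 : ℝ), (∑ n ∈ Finset.Icc 1 ⌊t⌋₊, f n) * t ^ (-2 - w) with hI
  have h3 : ∫ t in Set.Ioi (1 : ℝ), (∑ k ∈ Finset.Icc 1 ⌊t⌋₊, (f k : ℂ)) *
      (t : ℂ) ^ (-((1 + w : ℂ) + 1)) = (I : ℂ) := by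
    rw [hI, ← integral_complex_ofReal]
    refine MeasureTheory.setIntegral_congr_fun measurableSet_Ioi fun t ht => ?_
    have ht0 : (0 : ℝ) ≤ t := (zero_lt_one.trans ht).le
    push_cast
    rw [Complex.ofReal_cpow ht0]
    congr 2
    push_cast
    ring
  rw [h2, h3] at h1
  have h4 := integral_sum_sub_logQuad hf hw
  rw [← hI] at h4
  have hs : (1 + w : ℂ) ≠ 0 := by
    exact_mod_cast (by linarith : (1 + w : ℝ) ≠ 0)
  have h5 : (w : ℂ) ^ 3 * D (1 + w) / (1 + w) - (2 * c2 + c1 * w + c0 * w ^ 2) =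
      ((w ^ 3 * (I - (c0 / w + c1 / w ^ 2 + 2 * c2 / w ^ 3)) : ℝ) : ℂ) := by
    rw [h1]
    have : w ^ 3 * (I - (c0 / w + c1 / w ^ 2 + 2 * c2 / w ^ 3)) =
        w ^ 3 * I - (2 * c2 + c1 * w + c0 * w ^ 2) := by
      field_simp
      ring
    rw [this]
    push_cast
    field_simp
  rw [h5, Complex.norm_real, Real.norm_eq_abs, abs_mul, abs_of_pos (pow_pos hw 3), mul_comm]
  gcongr

open Filter Topology in
theorem residue_eq {f : ℕ → ℝ} (hf0 : ∀ n, 0 ≤ f n) {c0 c1 c2 K : ℝ}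
    (hf : ∀ t : ℝ, 1 ≤ t → |∑ n ∈ Finset.Icc 1 ⌊t⌋₊, f n -
      t * (c0 + c1 * Real.log t + c2 * Real.log t ^ 2)| ≤ K * t ^ ((3 : ℝ) / 4))
    {D : ℂ → ℂ} (hD : ∀ s : ℂ, 1 < s.re → HasSum (fun n : ℕ => (f n : ℂ) / (n : ℂ) ^ s) (D s))
    {x : ℝ} (hx : 0 < x) {g : ℂ → ℂ} (hg : AnalyticAt ℂ g 1)
    (hgD : ∀ᶠ s in 𝓝[≠] (1 : ℂ), g s = (s - 1) ^ 3 * D s * (x : ℂ) ^ (s - 1) / s) :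
    iteratedDeriv 2 g 1 / 2 = ((c0 + c1 * Real.log x + c2 * Real.log x ^ 2 : ℝ) : ℂ) := by
  have hx0 : (x : ℂ) ≠ 0 := by exact_mod_cast hx.ne'
  set L : ℂ := Complex.log x with hL
  set E : ℂ → ℂ := fun z => (2 * c2 + c1 * z + c0 * z ^ 2) * Complex.exp (L * z) with hE
  have hEa : AnalyticAt ℂ E 0 := by
    have : Differentiable ℂ E := by fun_prop
    exact this.analyticAt 0
  have hG : AnalyticAt ℂ (fun z => g (1 + z)) 0 := by
    refine AnalyticAt.fun_comp (by simpa using hg) (by fun_prop)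
  have hK : 0 ≤ K := by
    have := (abs_nonneg _).trans (hf 1 le_rfl)
    simpa using this
  have h0 : iteratedDeriv 2 (fun z => g (1 + z) - E z) 0 = 0 := by
    refine iteratedDeriv_two_eq_zero (hG.sub hEa) (K := 4 * K * Real.exp |Real.log x|) ?_
    have htend : Tendsto (fun w : ℝ => 1 + (w : ℂ)) (𝓝[>] 0) (𝓝[≠] (1 : ℂ)) := by
      refine tendsto_nhdsWithin_iff.mpr ⟨?_, ?_⟩
      · have : Continuous fun w : ℝ => 1 + (w : ℂ) := by fun_prop
        have := (this.tendsto 0).mono_left (nhdsWithin_le_nhds (s := Set.Ioi 0))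
        simpa using this
      · filter_upwards [self_mem_nhdsWithin] with w hw
        have : w ≠ 0 := ne_of_gt hw
        simpa using this
    have hlt1 : ∀ᶠ w : ℝ in 𝓝[>] 0, w < 1 := nhdsWithin_le_nhds (Iio_mem_nhds zero_lt_one)
    filter_upwards [htend.eventually hgD, self_mem_nhdsWithin, hlt1] with w h1 hw0 hw1
    have hw : 0 < w := hw0
    have h2 := dirichlet_series_expansion hf0 hf hD hw
    have h3 : g (1 + w) - E w = ((w : ℂ) ^ 3 * D (1 + w) / (1 + w) -
        (2 * c2 + c1 * w + c0 * w ^ 2)) * Complex.exp (L * w) := by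
      rw [h1]
      simp only [hE]
      rw [add_sub_cancel_left, Complex.cpow_def_of_ne_zero hx0]
      ring
    have h4 : ‖Complex.exp (L * w)‖ ≤ Real.exp |Real.log x| := by
      rw [Complex.norm_exp, hL, ← Complex.ofReal_log hx.le, ← Complex.ofReal_mul, Complex.ofReal_re]
      gcongr
      calc Real.log x * w ≤ |Real.log x| * w := by gcongr; exact le_abs_self _
        _ ≤ |Real.log x| := mul_le_of_le_one_right (abs_nonneg _) hw1.le
    rw [h3, norm_mul]
    calc _ ≤ (4 * K * w ^ 3) * Real.exp |Real.log x| := by gcongr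
      _ = _ := by ring
  have h1 : iteratedDeriv 2 g 1 = iteratedDeriv 2 (fun z => g (1 + z)) 0 := by
    rw [iteratedDeriv_comp_const_add]
    simp
  have h2 : iteratedDeriv 2 (fun z => g (1 + z) - E z) 0 =
      iteratedDeriv 2 (fun z => g (1 + z)) 0 - iteratedDeriv 2 E 0 :=
    iteratedDeriv_fun_sub hG.contDiffAt hEa.contDiffAt
  rw [h2, sub_eq_zero] at h0
  rw [h1, h0, hE, iteratedDeriv_two_quad_mul_exp, hL, ← Complex.ofReal_log hx.le]
  push_cast
  ring

theorem main_term_eq {ε : ℝ} (hε4 : ε ≤ 1 / 4) {q δ : ℕ} {R : ℝ → ℝ} (hR : IsLogQuad R) {K : ℝ}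
    (hK : ∀ t : ℝ, 0 < t → |∑ n ∈ Finset.Icc 1 ⌊t⌋₊,
      (if n.gcd q = δ then (d3 n : ℝ) else 0) - R t| ≤ K * t ^ ((1 : ℝ) / 2 + ε))
    {D : ℂ → ℂ} (hD : ∀ s : ℂ, 1 < s.re →
      HasSum (fun n : ℕ => if n.gcd q = δ then (d3 n : ℂ) / (n : ℂ) ^ s else 0) (D s))
    {x : ℝ} (hx : 0 < x) {g : ℂ → ℂ} (hg : AnalyticAt ℂ g 1)
    (hgD : ∀ᶠ s in nhdsWithin (1 : ℂ) {(1 : ℂ)}ᶜ,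
      g s = (s - 1) ^ 3 * D s * (x : ℂ) ^ (s - 1) / s) :
    (x : ℂ) * (iteratedDeriv 2 g 1 / 2) = (R x : ℂ) := by
  obtain ⟨c0, c1, c2, h⟩ := hR
  have hK0 : 0 ≤ K := by
    have := (abs_nonneg _).trans (hK 1 one_pos)
    simpa using this
  rw [residue_eq (f := fun n => if n.gcd q = δ then (d3 n : ℝ) else 0) (c0 := c0) (c1 := c1)
    (c2 := c2) (K := K) (fun n => by split_ifs <;> positivity) ?_ (D := D) ?_ hx hg hgD, h x hx]
  · push_cast
    ring
  · intro t ht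
    rw [← h t (by linarith)]
    refine (hK t (by linarith)).trans ?_
    gcongr
    linarith
  · intro s hs
    refine (hD s hs).congr_fun fun n => ?_
    split_ifs <;> simp

/-- For every `ε > 0` there is a constant `C = C(ε)` such that for every
real `x ≥ 2` and integer `q ≥ 1` we have `Σ_{a=1}^{q} |E_x(q,a)| ≤ C · x^{1/2+ε} q^{3/4}`.
Here, for each `a` with `δ = gcd(q,a)`, `D a` is the meromorphic continuation of the
Dirichlet series `Σ_{n ≥ 1, gcd(n,q)=δ} d₃(n) n^{-s}` (characterised by the `HasSum`
hypothesis on `Re s > 1`, with its only pole at `s = 1` of order at most `3`, expressed by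
the analytic function `g` with `g(s) = (s-1)³ D_a(s) x^{s-1} / s` near `s = 1`), the main
term is `M a = (x/φ(q/δ)) · Res_{s=1}{ D_a(s) x^{s-1}/s } = (x/φ(q/δ)) · (1/2!) g''(1)`,
and `E_x(q,a) = Σ_{n ≤ x, n ≡ a (q)} d₃(n) − M a`. -/
theorem stmt1 :
    ∀ ε : ℝ, 0 < ε → ∃ C : ℝ, 0 < C ∧
      ∀ x : ℝ, 2 ≤ x → ∀ q : ℕ, 1 ≤ q →
      ∀ D : ℕ → ℂ → ℂ, ∀ M : ℕ → ℂ,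
      (∀ a : ℕ, ∀ s : ℂ, 1 < s.re →
        HasSum (fun n : ℕ =>
          if Nat.gcd n q = Nat.gcd q a then (d3 n : ℂ) / (n : ℂ) ^ s else 0) (D a s)) →
      (∀ a : ℕ, ∃ g : ℂ → ℂ, AnalyticAt ℂ g 1 ∧
        (∀ᶠ s in nhdsWithin (1 : ℂ) {(1 : ℂ)}ᶜ,
          g s = (s - 1) ^ 3 * D a s * (x : ℂ) ^ (s - 1) / s) ∧
        M a = (x : ℂ) / (Nat.totient (q / Nat.gcd q a) : ℂ) * (iteratedDeriv 2 g 1 / 2)) →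
      ∑ a ∈ Finset.Icc 1 q,
          ‖(∑ n ∈ (Finset.Icc 1 ⌊x⌋₊).filter (fun n => n % q = a % q), (d3 n : ℂ)) - M a‖
        ≤ C * x ^ ((1 : ℝ) / 2 + ε) * (q : ℝ) ^ ((3 : ℝ) / 4) := by
  intro ε hε
  obtain ⟨C, hC, hE⟩ := sum_abs_error_le (ε := min ε (1 / 4)) (by positivity) (min_le_right _ _)
  refine ⟨C, by positivity, fun x hx q hq D M hD hM => ?_⟩
  obtain ⟨R, hR, hE⟩ := hE q (by omega)
  have hx0 : 0 < x := by linarith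
  have hMa : ∀ a, M a = ((R (q.gcd a) x / (q / q.gcd a).totient : ℝ) : ℂ) := by
    intro a
    obtain ⟨g, hg, hgD, hMg⟩ := hM a
    obtain ⟨hRq, K, hK⟩ := hR (q.gcd a) (Nat.gcd_dvd_left q a)
    rw [hMg, div_mul_eq_mul_div, main_term_eq (min_le_right _ _) hRq hK (hD a) hx0 hg hgD]
    push_cast
    rfl
  calc _ = ∑ a ∈ Finset.Icc 1 q,
        |∑ n ∈ (Finset.Icc 1 ⌊x⌋₊).filter (fun n => n % q = a % q), (d3 n : ℝ) -
          R (q.gcd a) x / (q / q.gcd a).totient| := by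
        refine Finset.sum_congr rfl fun a _ => ?_
        rw [hMa, ← Real.norm_eq_abs, ← Complex.norm_real]
        push_cast
        rfl
    _ ≤ _ := hE x hx0
    _ ≤ _ := by
        gcongr
        · linarith
        · exact min_le_left _ _
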